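/- arXiv:1503.02746 — 5 statements merged into one kernel-verified Lean document; each statement's English description precedes it below -/
import Mathlib

section
/- Let G be a distance-regular graph with degree k, such that adjacent vertices have exactly λ common neighbors and vertices at distance 2 have exactly μ common neighbors, and let s be the least eigenvalue of the real adjacency matrix of G. If λ > ⌊s⌋²·μ, then G has a clique geometry all of whose members have order exactly 1 + k/|s| (i.e., G is Delsarte-geometric). -/
open Finset

/-- A connected graph is *distance-regular* with intersection arrays `b`, `c` if, whenever
`u, v` are vertices at distance `i`, the vertex `v` has exactly `b i` neighbors at distance
`i + 1` from `u` and exactly `c i` neighbors at distance `i - 1` from `u`. -/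
def IsDistanceRegular {V : Type*} [Fintype V] [DecidableEq V] (G : SimpleGraph V)
    [DecidableRel G.Adj] (b c : ℕ → ℕ) : Prop :=
  G.Connected ∧
    ∀ u v : V, ∀ i : ℕ, G.dist u v = i →
      ((G.neighborFinset v).filter fun w => G.dist u w = i + 1).card = b i ∧
      ((G.neighborFinset v).filter fun w => G.dist u w = i - 1).card = c i

/-- `θ` is an eigenvalue of the real adjacency matrix of `G`. -/
def IsAdjEigenvalue {V : Type*} [Fintype V] [DecidableEq V] (G : SimpleGraph V)
    [DecidableRel G.Adj] (θ : ℝ) : Prop :=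
  ∃ x : V → ℝ, x ≠ 0 ∧ (G.adjMatrix ℝ).mulVec x = θ • x

/-- A clique (given as a finset) is a *maximal clique* if it is not properly contained in any
other clique. -/
def IsMaximalClique {V : Type*} (G : SimpleGraph V) (c : Finset V) : Prop :=
  G.IsClique (c : Set V) ∧ ∀ d : Finset V, G.IsClique (d : Set V) → c ⊆ d → c = d

/-- A *clique geometry* of `G` is a collection of cliques, all maximal, such that every pair of
adjacent vertices belongs to exactly one member of the collection. -/
def IsCliqueGeometry {V : Type*} (G : SimpleGraph V) (C : Set (Finset V)) : Prop :=
  (∀ c ∈ C, IsMaximalClique G c) ∧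
    ∀ u v : V, G.Adj u v → ∃! c, c ∈ C ∧ u ∈ c ∧ v ∈ c

section Spectral

variable {V : Type*} [Fintype V] [DecidableEq V] {G : SimpleGraph V} [DecidableRel G.Adj]

/-- The quadratic form of the adjacency matrix is bounded below by its least eigenvalue. -/
lemma mul_sum_sq_le_of_le_adjEigenvalue {s : ℝ}
    (hmin : ∀ θ : ℝ, IsAdjEigenvalue G θ → s ≤ θ) (f : V → ℝ) :
    s * ∑ v, f v ^ 2 ≤ ∑ v, f v * ∑ w ∈ G.neighborFinset v, f w := by
  have hH : (G.adjMatrix ℝ - s • (1 : Matrix V V ℝ)).IsHermitian := by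
    apply Matrix.IsHermitian.sub
    · simp [Matrix.IsHermitian]
    · simp [Matrix.IsHermitian]
  have hP : (G.adjMatrix ℝ - s • (1 : Matrix V V ℝ)).PosSemidef := by
    rw [hH.posSemidef_iff_eigenvalues_nonneg]
    intro i
    have h := hH.mulVec_eigenvectorBasis i
    have hne : (WithLp.ofLp (hH.eigenvectorBasis i)) ≠ 0 := by
      intro h0
      have h1 := hH.eigenvectorBasis.orthonormal.ne_zero i
      exact h1 (by ext j; simpa using congrFun h0 j)
    have := hmin (hH.eigenvalues i + s) ⟨_, hne, by
      rw [Matrix.sub_mulVec, Matrix.smul_mulVec, Matrix.one_mulVec, sub_eq_iff_eq_add] at h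
      rw [h, add_smul]⟩
    simpa using this
  have h := hP.dotProduct_mulVec_nonneg f
  simp only [star_trivial, Matrix.sub_mulVec, Matrix.smul_mulVec, Matrix.one_mulVec,
    dotProduct_sub, dotProduct_smul, smul_eq_mul] at h
  simp only [dotProduct, SimpleGraph.adjMatrix_mulVec_apply] at h
  simp only [sq]
  linarith

/-- A graph with an edge has least eigenvalue at most `-1`. -/
lemma le_neg_one_of_adj {s : ℝ} (hmin : ∀ θ : ℝ, IsAdjEigenvalue G θ → s ≤ θ) {u v : V}
    (huv : G.Adj u v) : s ≤ -1 := by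
  have h := mul_sum_sq_le_of_le_adjEigenvalue hmin
    (fun w => (if w = u then 1 else 0) - (if w = v then 1 else 0))
  have hne := huv.ne
  have e1 : ∀ w : V, ((if w = u then (1 : ℝ) else 0) - (if w = v then 1 else 0)) ^ 2
      = (if w = u then 1 else 0) + (if w = v then 1 else 0) := by
    intro w; split_ifs <;> simp_all
  have e2 : ∀ a : V, ∑ w ∈ G.neighborFinset a,
      ((if w = u then (1 : ℝ) else 0) - (if w = v then 1 else 0)) =
      (if G.Adj a u then 1 else 0) - (if G.Adj a v then 1 else 0) := by
    intro a; simp [Finset.sum_sub_distrib]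
  simp only [e1, e2, sub_mul, ite_mul, zero_mul, one_mul, Finset.sum_sub_distrib,
    Finset.sum_add_distrib, Finset.sum_ite_eq', Finset.mem_univ, if_true] at h
  simp [huv, huv.symm] at h
  linarith

/-- The degree of a locally `lam`-regular graph with least eigenvalue `s` is at most
`s ^ 2 - s * lam`. -/
lemma degree_le_of_le_adjEigenvalue {s : ℝ} {k lam : ℕ}
    (hmin : ∀ θ : ℝ, IsAdjEigenvalue G θ → s ≤ θ) (hreg : G.IsRegularOfDegree k)
    (hlam : ∀ u v : V, G.Adj u v → (G.neighborFinset u ∩ G.neighborFinset v).card = lam)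
    (hs : s < 0) (hk : 0 < k) (x : V) : (k : ℝ) ≤ s ^ 2 - s * lam := by
  set f : V → ℝ := fun v => (if v = x then (k : ℝ) else 0) +
    (if v ∈ G.neighborFinset x then s else 0) with hf
  have hcard : (G.neighborFinset x).card = k := by
    rw [G.card_neighborFinset_eq_degree]; exact hreg x
  have hx : f x = k := by simp [hf]
  have hN : ∀ v ∈ G.neighborFinset x, f v = s := by
    intro v hv
    have : v ≠ x := by rintro rfl; simp at hv
    simp only [hf, if_neg this, if_pos hv, zero_add]
  have hsum : ∀ g : V → ℝ, ∑ v, f v * g v = k * g x + s * ∑ v ∈ G.neighborFinset x, g v := by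
    intro g
    simp only [hf, add_mul, ite_mul, zero_mul, Finset.sum_add_distrib, Finset.sum_ite_eq',
      Finset.mem_univ, if_true, Finset.sum_ite_mem, Finset.univ_inter, Finset.mul_sum]
  have hNx : ∑ w ∈ G.neighborFinset x, f w = k * s := by
    rw [Finset.sum_congr rfl hN]; simp [hcard]
  have hNv : ∀ v ∈ G.neighborFinset x, ∑ w ∈ G.neighborFinset v, f w = k + lam * s := by
    intro v hv
    have hadj : G.Adj x v := by simpa using hv
    have hc := hlam v x hadj.symm
    simp only [hf, Finset.sum_add_distrib, Finset.sum_ite_eq', Finset.sum_ite_mem,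
      Finset.sum_const, hc, nsmul_eq_mul]
    simp [hadj.symm]
  have h := mul_sum_sq_le_of_le_adjEigenvalue hmin f
  simp only [sq] at h
  rw [hsum f, hsum, hNx, hx, Finset.sum_congr rfl hNv, Finset.sum_const, hcard,
    nsmul_eq_mul] at h
  have hk' : (0 : ℝ) < k := by exact_mod_cast hk
  have h2 : k * s * (s ^ 2 - s * lam - k) ≤ 0 := by linarith
  have h3 : k * s < 0 := mul_neg_of_pos_of_neg hk' hs
  by_contra hcon
  nlinarith

end Spectral

section Delsarte

variable {V : Type*} [Fintype V] [DecidableEq V] {G : SimpleGraph V} [DecidableRel G.Adj]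

/-- Right multiplication by the adjacency matrix of a distance-regular graph preserves
matrices whose entries depend only on the distance. -/
lemma IsDistanceRegular.exists_mul_adjMatrix {b c : ℕ → ℕ} {k : ℕ}
    (h : IsDistanceRegular G b c) (hreg : G.IsRegularOfDegree k) {M : Matrix V V ℝ}
    (hM : ∃ g : ℕ → ℝ, ∀ u v, M u v = g (G.dist u v)) :
    ∃ g : ℕ → ℝ, ∀ u v, (M * G.adjMatrix ℝ) u v = g (G.dist u v) := by
  obtain ⟨g, hg⟩ := hM
  refine ⟨fun i => k * g i + b i * (g (i + 1) - g i) + c i * (g (i - 1) - g i), fun u v => ?_⟩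
  obtain ⟨hb, hc⟩ := h.2 u v _ rfl
  rw [SimpleGraph.mul_adjMatrix_apply]
  have key : ∀ w ∈ G.neighborFinset v, M u w = g (G.dist u v) +
      (if G.dist u w = G.dist u v + 1 then g (G.dist u v + 1) - g (G.dist u v) else 0) +
      (if G.dist u w = G.dist u v - 1 then g (G.dist u v - 1) - g (G.dist u v) else 0) := by
    intro w hw
    have hvw : G.Adj v w := by simpa using hw
    have h1 : G.dist v w = 1 := SimpleGraph.dist_eq_one_iff_adj.2 hvw
    have h2 := h.1.dist_triangle (u := u) (v := v) (w := w)
    have h3 := h.1.dist_triangle (u := u) (v := w) (w := v)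
    rw [G.dist_comm (u := w) (v := v)] at h3
    rw [hg]
    rcases (by omega : G.dist u w = G.dist u v + 1 ∨ G.dist u w = G.dist u v ∨
      (G.dist u w = G.dist u v - 1 ∧ 0 < G.dist u v)) with e | e | ⟨e, e'⟩
    · rw [e, if_pos rfl, if_neg (by omega)]; ring
    · rw [e, if_neg (by omega)]
      split_ifs with h0
      · rw [← h0]; ring
      · ring
    · rw [e, if_neg (by omega), if_pos rfl]; ring
  rw [Finset.sum_congr rfl key, Finset.sum_add_distrib, Finset.sum_add_distrib,
    ← Finset.sum_filter, ← Finset.sum_filter, Finset.sum_const, Finset.sum_const,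
    Finset.sum_const, hb, hc, G.card_neighborFinset_eq_degree, hreg v]
  simp

/-- The entries of a polynomial in the adjacency matrix of a distance-regular graph depend only
on the distance. -/
lemma IsDistanceRegular.exists_aeval_adjMatrix {b c : ℕ → ℕ} {k : ℕ}
    (h : IsDistanceRegular G b c) (hreg : G.IsRegularOfDegree k) (p : Polynomial ℝ) :
    ∃ g : ℕ → ℝ, ∀ u v, Polynomial.aeval (G.adjMatrix ℝ) p u v = g (G.dist u v) := by
  have hpow : ∀ n : ℕ, ∃ g : ℕ → ℝ, ∀ u v, (G.adjMatrix ℝ ^ n) u v = g (G.dist u v) := by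
    intro n
    induction n with
    | zero =>
      refine ⟨fun i => if i = 0 then 1 else 0, fun u v => ?_⟩
      simp [Matrix.one_apply, h.1.dist_eq_zero_iff]
    | succ n ih =>
      simp only [pow_succ]
      exact h.exists_mul_adjMatrix hreg ih
  choose g hg using hpow
  refine ⟨fun i => ∑ n ∈ Finset.range (p.natDegree + 1), p.coeff n * g n i, fun u v => ?_⟩
  simp [Polynomial.aeval_eq_sum_range, Matrix.sum_apply, hg]

/-- The **Delsarte clique bound** for an eigenvalue of a distance-regular graph. -/
lemma IsDistanceRegular.clique_bound {b c : ℕ → ℕ} {k : ℕ} {s : ℝ}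
    (h : IsDistanceRegular G b c) (hreg : G.IsRegularOfDegree k) (hs : IsAdjEigenvalue G s)
    {C : Finset V} (hC : G.IsClique (C : Set V)) (hne : C.Nonempty) :
    0 ≤ (k : ℝ) + ((C.card : ℝ) - 1) * s := by
  set A := G.adjMatrix ℝ with hA
  obtain ⟨y, hy0, hy⟩ := hs
  have hroot : (minpoly ℝ A).IsRoot s := by
    rw [← Matrix.minpoly_toLin']
    apply Module.End.isRoot_of_hasEigenvalue
    exact Module.End.hasEigenvalue_of_hasEigenvector (x := y)
      ⟨Module.End.mem_eigenspace_iff.2 (by simpa using hy), hy0⟩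
  obtain ⟨q, hq⟩ := Polynomial.dvd_iff_isRoot.2 hroot
  have hintegral : IsIntegral ℝ A := Algebra.IsIntegral.isIntegral A
  have hp0 : minpoly ℝ A ≠ 0 := minpoly.ne_zero hintegral
  have hq0 : q ≠ 0 := by rintro rfl; simp [hq] at hp0
  have hM0 : Polynomial.aeval A q ≠ 0 := by
    intro h0
    have hd := minpoly.degree_le_of_ne_zero ℝ A hq0 h0
    rw [hq, Polynomial.degree_mul, Polynomial.degree_X_sub_C,
      Polynomial.degree_eq_natDegree hq0] at hd
    norm_cast at hd
    omega
  have hAM : A * Polynomial.aeval A q = s • Polynomial.aeval A q := by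
    have := minpoly.aeval ℝ A
    rw [hq, map_mul, map_sub, Polynomial.aeval_X, Polynomial.aeval_C, sub_mul, sub_eq_zero] at this
    rw [this, ← Algebra.smul_def]
  set M := Polynomial.aeval A q with hM
  obtain ⟨g, hg⟩ := h.exists_aeval_adjMatrix hreg q
  obtain ⟨e, he⟩ := h.exists_aeval_adjMatrix hreg (q * q)
  simp only [map_mul, ← hA, ← hM] at hg he
  have hsymm : ∀ u v, M u v = M v u := fun u v => by rw [hg, hg, G.dist_comm]
  have hAE : A * (M * M) = s • (M * M) := by rw [← mul_assoc, hAM, smul_mul_assoc]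
  have hrel : (k : ℝ) * e 1 = s * e 0 := by
    obtain ⟨u, -⟩ := hne
    have h1 := congrFun (congrFun hAE u) u
    rw [hA, SimpleGraph.adjMatrix_mul_apply, Matrix.smul_apply, he, SimpleGraph.dist_self] at h1
    rw [smul_eq_mul] at h1
    rw [← h1, Finset.sum_congr rfl (g := fun _ => e 1), Finset.sum_const,
      G.card_neighborFinset_eq_degree, hreg u, nsmul_eq_mul]
    intro w hw
    have hw : G.Adj u w := by simpa using hw
    rw [he, SimpleGraph.dist_eq_one_iff_adj.2 hw.symm]
  have he0 : 0 < e 0 := by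
    obtain ⟨u, w, huw⟩ : ∃ u w, M u w ≠ 0 := by
      by_contra! hcon
      exact hM0 (by ext u w; simpa using hcon u w)
    have h1 := he u u
    rw [SimpleGraph.dist_self] at h1
    rw [← h1, Matrix.mul_apply]
    refine Finset.sum_pos' (fun w _ => ?_) ⟨w, Finset.mem_univ _, ?_⟩
    · rw [hsymm w u]; exact mul_self_nonneg _
    · rw [hsymm w u]; exact mul_self_pos.2 huw
  have hsq : 0 ≤ ∑ u ∈ C, ∑ v ∈ C, (M * M) u v := by
    have : ∑ u ∈ C, ∑ v ∈ C, (M * M) u v = ∑ w, (∑ u ∈ C, M w u) ^ 2 := by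
      simp only [Matrix.mul_apply, sq, Finset.sum_mul_sum]
      rw [Finset.sum_comm (s := Finset.univ)]
      refine Finset.sum_congr rfl fun u _ => ?_
      rw [Finset.sum_comm]
      exact Finset.sum_congr rfl fun w _ => Finset.sum_congr rfl fun v _ => by rw [hsymm u w]
    rw [this]; positivity
  have hval : ∑ u ∈ C, ∑ v ∈ C, (M * M) u v = C.card * (e 0 + (C.card - 1) * e 1) := by
    rw [← nsmul_eq_mul]
    refine Finset.sum_eq_card_nsmul fun u hu => ?_
    rw [← Finset.add_sum_erase C _ hu, he, SimpleGraph.dist_self,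
      Finset.sum_congr rfl (g := fun _ => e 1), Finset.sum_const, Finset.card_erase_of_mem hu,
      nsmul_eq_mul, Nat.cast_sub hne.card_pos, Nat.cast_one]
    intro v hv
    have hv := Finset.mem_erase.1 hv
    rw [he, SimpleGraph.dist_eq_one_iff_adj.2 (hC hu hv.2 hv.1.symm)]
  rw [hval] at hsq
  have hcp : (0 : ℝ) < C.card := by exact_mod_cast hne.card_pos
  have h2 : 0 ≤ e 0 + (C.card - 1) * e 1 := nonneg_of_mul_nonneg_right hsq hcp
  have h3 : 0 ≤ e 0 * (k + (C.card - 1) * s) := by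
    have := mul_nonneg (Nat.cast_nonneg (α := ℝ) k) h2
    nlinarith
  exact nonneg_of_mul_nonneg_right h3 he0

end Delsarte

section Combinatorics

/-- A Bonferroni lower bound for the union of a family of sets of equal size with small pairwise
intersections. -/
lemma two_mul_card_mul_le_card_biUnion {ι α : Type*} [DecidableEq ι] [DecidableEq α]
    (S : Finset ι) (A : ι → Finset α) (a nu : ℕ) (ha : ∀ i ∈ S, (A i).card = a)
    (hnu : ∀ i ∈ S, ∀ j ∈ S, i ≠ j → (A i ∩ A j).card ≤ nu) :
    2 * (S.card * a) ≤ 2 * (S.biUnion A).card + S.card * (S.card - 1) * nu := by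
  induction S using Finset.induction_on with
  | empty => simp
  | insert j S hj ih =>
    have ih := ih (fun i hi => ha i (Finset.mem_insert_of_mem hi))
      (fun i hi l hl => hnu i (Finset.mem_insert_of_mem hi) l (Finset.mem_insert_of_mem hl))
    have h1 := Finset.card_union_add_card_inter (A j) (S.biUnion A)
    have h2 : (A j ∩ S.biUnion A).card ≤ S.card * nu := by
      rw [Finset.inter_biUnion]
      refine Finset.card_biUnion_le_card_mul _ _ _ fun i hi => ?_
      exact hnu j (Finset.mem_insert_self _ _) i (Finset.mem_insert_of_mem hi)
        (by rintro rfl; exact hj hi)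
    rw [ha j (Finset.mem_insert_self _ _)] at h1
    rw [Finset.biUnion_insert, Finset.card_insert_of_notMem hj, Nat.add_sub_cancel]
    rcases Nat.eq_zero_or_pos S.card with h0 | h0
    · rw [h0] at h2 ⊢; omega
    · obtain ⟨t, ht⟩ : ∃ t, S.card = t + 1 := ⟨S.card - 1, by omega⟩
      rw [ht] at h2 ih ⊢
      rw [Nat.add_sub_cancel] at ih
      nlinarith

/-- Two distinct maximal cliques contain nonadjacent vertices, one in each. -/
lemma IsMaximalClique.exists_not_adj {V : Type*} [DecidableEq V] {G : SimpleGraph V}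
    {C D : Finset V} (hC : IsMaximalClique G C) (hD : IsMaximalClique G D) (hne : C ≠ D) : ∃ u ∈ C, ∃ v ∈ D, u ≠ v ∧ ¬ G.Adj u v := by
  by_contra! hcon
  have hU : G.IsClique ((C ∪ D : Finset V) : Set V) := by
    intro u hu v hv huv
    simp only [Finset.coe_union, Set.mem_union, Finset.mem_coe] at hu hv
    rcases hu with hu | hu <;> rcases hv with hv | hv
    · exact hC.1 hu hv huv
    · exact hcon u hu v hv huv
    · exact (hcon v hv u hu huv.symm).symm
    · exact hD.1 hu hv huv
  exact hne ((hC.2 _ hU Finset.subset_union_left).trans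
    (hD.2 _ hU Finset.subset_union_right).symm)

variable {V : Type*} [Fintype V] [DecidableEq V] {G : SimpleGraph V} [DecidableRel G.Adj]

/-- Every clique of a finite graph lies in a maximal clique. -/
lemma exists_isMaximalClique_superset {C : Finset V} (hC : G.IsClique (C : Set V)) :
    ∃ D, IsMaximalClique G D ∧ C ⊆ D := by
  classical
  obtain ⟨D, hD, hmax⟩ := Finset.exists_max_image
    (Finset.univ.filter fun D : Finset V => G.IsClique (D : Set V) ∧ C ⊆ D) Finset.card
    ⟨C, by simp [hC]⟩
  simp only [Finset.mem_filter, Finset.mem_univ, true_and] at hD hmax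
  exact ⟨D, ⟨hD.1, fun E hE hDE =>
    Finset.eq_of_subset_of_card_le hDE (hmax E ⟨hE, hD.2.trans hDE⟩)⟩, hD.2⟩

/-- Two distinct maximal cliques through an edge have total size at most `lam + mu + 2`. -/
lemma IsMaximalClique.card_add_card_le {lam mu : ℕ}
    (hlam : ∀ u v : V, G.Adj u v → (G.neighborFinset u ∩ G.neighborFinset v).card = lam)
    (hmu : ∀ u v : V, u ≠ v → ¬ G.Adj u v →
      (G.neighborFinset u ∩ G.neighborFinset v).card ≤ mu)
    {C D : Finset V} (hC : IsMaximalClique G C) (hD : IsMaximalClique G D) (hne : C ≠ D)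
    {x y : V} (hxy : G.Adj x y) (hxC : x ∈ C) (hyC : y ∈ C) (hxD : x ∈ D) (hyD : y ∈ D) :
    C.card + D.card ≤ lam + mu + 2 := by
  obtain ⟨u, hu, v, hv, huv, hadj⟩ := hC.exists_not_adj hD hne
  have h1 : (C ∩ D).card ≤ mu := by
    refine le_trans (Finset.card_le_card fun w hw => ?_) (hmu u v huv hadj)
    have hw := Finset.mem_inter.1 hw
    have hwu : u ≠ w := by rintro rfl; exact hadj (hD.1 hw.2 hv huv)
    have hwv : v ≠ w := by rintro rfl; exact hadj (hC.1 hu hw.1 huv)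
    simp [hC.1 hu hw.1 hwu, hD.1 hv hw.2 hwv]
  have h2 : (C ∪ D).card ≤ lam + 2 := by
    have h3 : C ∪ D ⊆ insert x (insert y (G.neighborFinset x ∩ G.neighborFinset y)) := by
      intro w hw
      simp only [Finset.mem_insert, Finset.mem_inter, SimpleGraph.mem_neighborFinset]
      by_cases hwx : w = x
      · exact Or.inl hwx
      by_cases hwy : w = y
      · exact Or.inr (Or.inl hwy)
      refine Or.inr (Or.inr ?_)
      rcases Finset.mem_union.1 hw with hw | hw
      · exact ⟨hC.1 hxC hw (Ne.symm hwx), hC.1 hyC hw (Ne.symm hwy)⟩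
      · exact ⟨hD.1 hxD hw (Ne.symm hwx), hD.1 hyD hw (Ne.symm hwy)⟩
    refine (Finset.card_le_card h3).trans ?_
    rw [← hlam x y hxy]
    exact (Finset.card_insert_le _ _).trans (Nat.succ_le_succ (Finset.card_insert_le _ _))
  have := Finset.card_union_add_card_inter C D
  omega

/-- The closed neighborhood of `y` inside the local graph at `x`. -/
def closedLocalNbhd (G : SimpleGraph V) [DecidableRel G.Adj] (x y : V) : Finset V :=
  insert y (G.neighborFinset x ∩ G.neighborFinset y)

lemma mem_closedLocalNbhd {x y w : V} :
    w ∈ closedLocalNbhd G x y ↔ w = y ∨ G.Adj x w ∧ G.Adj y w := by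
  simp [closedLocalNbhd]

lemma card_closedLocalNbhd {lam : ℕ}
    (hlam : ∀ u v : V, G.Adj u v → (G.neighborFinset u ∩ G.neighborFinset v).card = lam)
    {x y : V} (hxy : G.Adj x y) : (closedLocalNbhd G x y).card = lam + 1 := by
  rw [closedLocalNbhd, Finset.card_insert_of_notMem (by simp), hlam x y hxy]

lemma closedLocalNbhd_subset {x y : V} (hxy : G.Adj x y) :
    closedLocalNbhd G x y ⊆ G.neighborFinset x := by
  intro w hw
  rcases mem_closedLocalNbhd.1 hw with rfl | h
  · simpa using hxy
  · simpa using h.1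

lemma card_closedLocalNbhd_inter_le {nu : ℕ}
    (hmu : ∀ u v : V, u ≠ v → ¬ G.Adj u v →
      (G.neighborFinset u ∩ G.neighborFinset v).card ≤ nu + 1)
    {x y z : V} (hxy : G.Adj x y) (hxz : G.Adj x z) (hne : y ≠ z) (hyz : ¬ G.Adj y z) :
    (closedLocalNbhd G x y ∩ closedLocalNbhd G x z).card ≤ nu := by
  have hsub : insert x (closedLocalNbhd G x y ∩ closedLocalNbhd G x z) ⊆
      G.neighborFinset y ∩ G.neighborFinset z := by
    intro w hw
    simp only [Finset.mem_insert, Finset.mem_inter, mem_closedLocalNbhd,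
      SimpleGraph.mem_neighborFinset] at hw ⊢
    rcases hw with rfl | ⟨rfl | h1, rfl | h2⟩
    · exact ⟨hxy.symm, hxz.symm⟩
    · exact absurd rfl hne
    · exact absurd h2.2.symm hyz
    · exact absurd h1.2 hyz
    · exact ⟨h1.2, h2.2⟩
  have hx : x ∉ closedLocalNbhd G x y ∩ closedLocalNbhd G x z := by
    simp [mem_closedLocalNbhd, hxy.ne]
  have := (Finset.card_le_card hsub).trans (hmu y z hne hyz)
  rw [Finset.card_insert_of_notMem hx] at this
  omega

/-- A coclique in a local graph has at most `m` vertices. -/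
lemma card_local_coclique_le {k lam nu m : ℕ} (hreg : G.IsRegularOfDegree k)
    (hlam : ∀ u v : V, G.Adj u v → (G.neighborFinset u ∩ G.neighborFinset v).card = lam)
    (hmu : ∀ u v : V, u ≠ v → ¬ G.Adj u v →
      (G.neighborFinset u ∩ G.neighborFinset v).card ≤ nu + 1)
    (hm : 1 ≤ m) (hk : k ≤ m * (lam + m)) (hl : m ^ 2 * (nu + 1) < lam) {x : V} {S : Finset V}
    (hS : S ⊆ G.neighborFinset x) (hco : ∀ u ∈ S, ∀ v ∈ S, ¬ G.Adj u v) : S.card ≤ m := by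
  by_contra! hcon
  obtain ⟨T, hTS, hT⟩ := Finset.exists_subset_card_eq (n := m + 1) hcon
  have hx : ∀ y ∈ T, G.Adj x y := fun y hy => by simpa using hS (hTS hy)
  have h := two_mul_card_mul_le_card_biUnion T (closedLocalNbhd G x) (lam + 1) nu
    (fun y hy => card_closedLocalNbhd hlam (hx y hy))
    (fun y hy z hz hne => card_closedLocalNbhd_inter_le hmu (hx y hy) (hx z hz) hne
      (hco y (hTS hy) z (hTS hz)))
  have h2 : (T.biUnion (closedLocalNbhd G x)).card ≤ k := by
    rw [← hreg x, ← G.card_neighborFinset_eq_degree]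
    exact Finset.card_le_card (Finset.biUnion_subset.2 fun y hy =>
      closedLocalNbhd_subset (hx y hy))
  rw [hT, Nat.add_sub_cancel] at h
  have h3 : m * nu ≤ m ^ 2 * nu := Nat.mul_le_mul_right _ (by nlinarith)
  nlinarith

/-- Every edge lies in a large clique. -/
lemma exists_large_clique {k lam nu m : ℕ} (hreg : G.IsRegularOfDegree k)
    (hlam : ∀ u v : V, G.Adj u v → (G.neighborFinset u ∩ G.neighborFinset v).card = lam)
    (hmu : ∀ u v : V, u ≠ v → ¬ G.Adj u v →
      (G.neighborFinset u ∩ G.neighborFinset v).card ≤ nu + 1)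
    (hm : 1 ≤ m) (hk : k ≤ m * (lam + m)) (hl : m ^ 2 * (nu + 1) < lam) {x z : V}
    (hxz : G.Adj x z) :
    ∃ C : Finset V, G.IsClique (C : Set V) ∧ x ∈ C ∧ z ∈ C ∧
      lam + 2 ≤ C.card + (m - 1) * nu := by
  classical
  obtain ⟨S, hS, hmax⟩ := Finset.exists_max_image
    (Finset.univ.filter fun S : Finset V => S ⊆ G.neighborFinset x ∧
      ∀ u ∈ S, ∀ v ∈ S, ¬ G.Adj u v) Finset.card ⟨∅, by simp⟩
  simp only [Finset.mem_filter, Finset.mem_univ, true_and] at hS hmax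
  obtain ⟨hSx, hco⟩ := hS
  have hx : ∀ y ∈ S, G.Adj x y := fun y hy => by simpa using hSx hy
  have htm : S.card ≤ m := card_local_coclique_le hreg hlam hmu hm hk hl hSx hco
  set B := closedLocalNbhd G x with hB
  set T : V → Finset V := fun y => B y \ (S.erase y).biUnion B with hT
  have hBcard : ∀ y ∈ S, (B y).card = lam + 1 := fun y hy => card_closedLocalNbhd hlam (hx y hy)
  have hTcard : ∀ y ∈ S, lam + 1 ≤ (T y).card + (S.card - 1) * nu := by
    intro y hy
    have h1 := Finset.card_sdiff_add_card_inter (B y) ((S.erase y).biUnion B)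
    have h2 : (B y ∩ (S.erase y).biUnion B).card ≤ (S.card - 1) * nu := by
      rw [Finset.inter_biUnion, ← Finset.card_erase_of_mem hy]
      refine Finset.card_biUnion_le_card_mul _ _ _ fun w hw => ?_
      obtain ⟨hwy, hw⟩ := Finset.mem_erase.1 hw
      exact card_closedLocalNbhd_inter_le hmu (hx y hy) (hx w hw) hwy.symm (hco y hy w hw)
    rw [hBcard y hy] at h1
    simp only [hT]
    omega
  have hTx : ∀ y ∈ S, T y ⊆ G.neighborFinset x := fun y hy =>
    Finset.sdiff_subset.trans (closedLocalNbhd_subset (hx y hy))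
  have hTnot : ∀ y ∈ S, ∀ w ∈ T y, ∀ u ∈ S, u ≠ y → w ≠ u ∧ ¬ G.Adj u w := by
    intro y hy w hw u hu huy
    have hxw : G.Adj x w := by simpa using hTx y hy hw
    have h1 : w ∉ B u := fun h => (Finset.mem_sdiff.1 hw).2
      (Finset.mem_biUnion.2 ⟨u, Finset.mem_erase.2 ⟨huy, hu⟩, h⟩)
    rw [hB, mem_closedLocalNbhd] at h1
    tauto
  have hTclique : ∀ y ∈ S, G.IsClique (T y : Set V) := by
    intro y hy u hu v hv huv
    by_contra hadj
    have hnu := hTnot y hy u hu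
    have hnv := hTnot y hy v hv
    have hbig := hmax (insert u (insert v (S.erase y))) ⟨?_, ?_⟩
    · rw [Finset.card_insert_of_notMem, Finset.card_insert_of_notMem,
        Finset.card_erase_of_mem hy] at hbig
      · have := Finset.card_pos.2 ⟨y, hy⟩; omega
      · intro h
        obtain ⟨h1, h2⟩ := Finset.mem_erase.1 h
        exact (hnv v h2 h1).1 rfl
      · intro h
        rcases Finset.mem_insert.1 h with h | h
        · exact huv h
        obtain ⟨h1, h2⟩ := Finset.mem_erase.1 h
        exact (hnu u h2 h1).1 rfl
    · intro w hw
      simp only [Finset.mem_insert, Finset.mem_erase] at hw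
      rcases hw with rfl | rfl | hw
      · exact hTx y hy hu
      · exact hTx y hy hv
      · exact hSx hw.2
    · intro a ha c hc
      simp only [Finset.mem_insert, Finset.mem_erase] at ha hc
      rcases ha with rfl | rfl | ha <;> rcases hc with rfl | rfl | hc
      · exact G.irrefl
      · exact hadj
      · exact fun h => (hnu c hc.2 hc.1).2 h.symm
      · exact fun h => hadj h.symm
      · exact G.irrefl
      · exact fun h => (hnv c hc.2 hc.1).2 h.symm
      · exact (hnu a ha.2 ha.1).2
      · exact (hnv a ha.2 ha.1).2
      · exact hco a ha.2 c hc.2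
  have hcover : G.neighborFinset x ⊆ S.biUnion B := by
    intro w hw
    have hxw : G.Adj x w := by simpa using hw
    by_contra hnot
    simp only [Finset.mem_biUnion, not_exists, not_and, hB, mem_closedLocalNbhd] at hnot
    have hnot : ∀ y ∈ S, w ≠ y ∧ ¬ G.Adj y w := fun y hy => by
      have := hnot y hy; tauto
    have hwS : w ∉ S := fun h => (hnot w h).1 rfl
    have hbig := hmax (insert w S) ⟨Finset.insert_subset hw hSx, ?_⟩
    · rw [Finset.card_insert_of_notMem hwS] at hbig; omega
    · intro a ha c hc
      rcases Finset.mem_insert.1 ha with rfl | haS <;>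
        rcases Finset.mem_insert.1 hc with rfl | hcS
      · exact G.irrefl
      · exact fun h => (hnot c hcS).2 h.symm
      · exact (hnot a haS).2
      · exact hco a haS c hcS
  have hdisj : (S : Set V).PairwiseDisjoint T := by
    intro y hy u hu hyu
    rw [Function.onFun, Finset.disjoint_left]
    intro w hwy hwu
    exact (Finset.mem_sdiff.1 hwu).2 (Finset.mem_biUnion.2
      ⟨y, Finset.mem_erase.2 ⟨hyu, hy⟩, (Finset.mem_sdiff.1 hwy).1⟩)
  have hk2 : (G.neighborFinset x).card ≤ S.card * (lam + 1) :=
    (Finset.card_le_card hcover).trans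
      (Finset.card_biUnion_le_card_mul _ _ _ fun y hy => (hBcard y hy).le)
  have hU : S.card * (lam + 1) ≤ (S.biUnion T).card + S.card * ((S.card - 1) * nu) := by
    rw [Finset.card_biUnion hdisj, ← smul_eq_mul, ← smul_eq_mul, ← Finset.sum_const,
      ← Finset.sum_const, ← Finset.sum_add_distrib]
    exact Finset.sum_le_sum hTcard
  have hR : (G.neighborFinset x \ S.biUnion T).card ≤ S.card * ((S.card - 1) * nu) := by
    rw [Finset.card_sdiff_of_subset (Finset.biUnion_subset.2 hTx)]
    omega
  have hSpos : 0 < S.card := by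
    obtain ⟨y, hy, -⟩ := Finset.mem_biUnion.1 (hcover (show z ∈ _ by simpa using hxz))
    exact Finset.card_pos.2 ⟨y, hy⟩
  obtain ⟨y, hy, hyz⟩ : ∃ y ∈ S, nu + 1 ≤ (B z ∩ T y).card := by
    by_contra! hcon
    have h1 := Finset.card_sdiff_add_card_inter (B z) (S.biUnion T)
    rw [hB, card_closedLocalNbhd hlam hxz, ← hB] at h1
    have h2 : (B z \ S.biUnion T).card ≤ S.card * ((S.card - 1) * nu) :=
      (Finset.card_le_card (Finset.sdiff_subset_sdiff (closedLocalNbhd_subset hxz)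
        (Finset.Subset.refl _))).trans hR
    have h3 : (B z ∩ S.biUnion T).card ≤ S.card * nu := by
      rw [Finset.inter_biUnion]
      exact Finset.card_biUnion_le_card_mul _ _ _ fun u hu => Nat.le_of_lt_succ (hcon u hu)
    have h4 : S.card * ((S.card - 1) * nu) + S.card * nu = S.card ^ 2 * nu := by
      obtain ⟨t, ht⟩ : ∃ t, S.card = t + 1 := ⟨S.card - 1, by omega⟩
      rw [ht, Nat.add_sub_cancel]; ring
    have h5 : S.card ^ 2 * nu ≤ m ^ 2 * nu :=
      Nat.mul_le_mul_right _ (Nat.pow_le_pow_left htm 2)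
    nlinarith
  have hzT : ∀ w ∈ T y, z ≠ w → G.Adj z w := by
    intro w hw hzw
    by_contra hadj
    have hzT : z ∉ T y := fun h => hadj (hTclique y hy h hw hzw)
    have hsub : insert x (B z ∩ T y) ⊆ G.neighborFinset z ∩ G.neighborFinset w := by
      intro u hu
      rcases Finset.mem_insert.1 hu with rfl | hu
      · have : G.Adj u w := by simpa using hTx y hy hw
        simp [hxz.symm, this.symm]
      · obtain ⟨huB, huT⟩ := Finset.mem_inter.1 hu
        rw [hB, mem_closedLocalNbhd] at huB
        rcases huB with rfl | huB
        · exact absurd huT hzT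
        · have hwu : w ≠ u := by rintro rfl; exact hadj huB.2
          have : G.Adj w u := hTclique y hy hw huT hwu
          simp [huB.2, this]
    have hxn : x ∉ B z ∩ T y := by simp [hB, mem_closedLocalNbhd, hxz.ne]
    have := (Finset.card_le_card hsub).trans (hmu z w hzw hadj)
    rw [Finset.card_insert_of_notMem hxn] at this
    omega
  have hxT : x ∉ T y := fun h => by simpa using hTx y hy h
  refine ⟨insert x (insert z (T y)), ?_, by simp, by simp, ?_⟩
  · rw [Finset.coe_insert, Finset.coe_insert, SimpleGraph.isClique_insert,
      SimpleGraph.isClique_insert]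
    refine ⟨⟨hTclique y hy, hzT⟩, fun w hw _ => ?_⟩
    rcases hw with rfl | hw
    · exact hxz
    · simpa using hTx y hy hw
  · have h1 := Finset.card_le_card (Finset.insert_subset_insert x
      (Finset.subset_insert z (T y)))
    rw [Finset.card_insert_of_notMem hxT] at h1
    have h2 := hTcard y hy
    have h3 : (S.card - 1) * nu ≤ (m - 1) * nu :=
      Nat.mul_le_mul_right _ (Nat.sub_le_sub_right htm 1)
    omega

end Combinatorics

section Geometry

variable {V : Type*} [Fintype V] [DecidableEq V] {G : SimpleGraph V} [DecidableRel G.Adj]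

/-- A sum over the neighbors of `v` can be arranged along the members of a clique geometry
through `v`. -/
lemma IsCliqueGeometry.sum_neighborFinset {C : Finset (Finset V)}
    (hC : IsCliqueGeometry G (C : Set (Finset V))) (f : V → ℝ) (v : V) :
    ∑ w ∈ G.neighborFinset v, f w = ∑ L ∈ C with v ∈ L, ∑ w ∈ L.erase v, f w := by
  rw [← Finset.sum_biUnion]
  · refine Finset.sum_congr (Finset.ext fun w => ?_) fun _ _ => rfl
    simp only [SimpleGraph.mem_neighborFinset, Finset.mem_biUnion, Finset.mem_filter,
      Finset.mem_erase]
    constructor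
    · intro h
      obtain ⟨L, ⟨h1, h2, h3⟩, -⟩ := hC.2 v w h
      exact ⟨L, ⟨h1, h2⟩, h.ne', h3⟩
    · rintro ⟨L, ⟨h1, h2⟩, h3, h4⟩
      exact (hC.1 L h1).1 h2 h4 h3.symm
  · intro L hL D hD hne
    rw [Function.onFun, Finset.disjoint_left]
    intro w hwL hwD
    simp only [Finset.coe_filter, Set.mem_ofPred_eq, Finset.mem_erase] at hL hD hwL hwD
    have hadj : G.Adj v w := (hC.1 L hL.1).1 hL.2 hwL.2 hwL.1.symm
    exact hne ((hC.2 v w hadj).unique ⟨hL.1, hL.2, hwL.2⟩ ⟨hD.1, hD.2, hwD.2⟩)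

/-- The neighbors of `v` are partitioned by the members of a clique geometry through `v`. -/
lemma IsCliqueGeometry.degree_eq_sum {C : Finset (Finset V)} {k : ℕ}
    (hC : IsCliqueGeometry G (C : Set (Finset V))) (hreg : G.IsRegularOfDegree k) (v : V) :
    (k : ℝ) = ∑ L ∈ C with v ∈ L, ((L.card : ℝ) - 1) := by
  have h := hC.sum_neighborFinset (fun _ => 1) v
  rw [Finset.sum_const, G.card_neighborFinset_eq_degree, hreg v, nsmul_one] at h
  rw [h]
  refine Finset.sum_congr rfl fun L hL => ?_
  have hv := (Finset.mem_filter.1 hL).2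
  rw [Finset.sum_const, nsmul_one, Finset.card_erase_of_mem hv,
    Nat.cast_sub (Finset.card_pos.2 ⟨v, hv⟩), Nat.cast_one]

/-- If each vertex lies in exactly `m` members of a clique geometry, all of which have more than
`m` vertices, then `-m` is an eigenvalue. -/
lemma IsCliqueGeometry.isAdjEigenvalue_neg [Nonempty V] {C : Finset (Finset V)} {m : ℕ}
    (hC : IsCliqueGeometry G (C : Set (Finset V)))
    (hm : ∀ v, (C.filter fun L => v ∈ L).card = m) (hbig : ∀ L ∈ C, m < L.card) :
    IsAdjEigenvalue G (-m) := by
  have hcount : C.card < Fintype.card V := by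
    have h1 : ∑ v : V, (C.filter fun L => v ∈ L).card = ∑ L ∈ C, L.card := by
      simp only [Finset.card_filter]
      rw [Finset.sum_comm]
      simp
    have h2 : C.card * (m + 1) ≤ ∑ L ∈ C, L.card := by
      rw [← smul_eq_mul]
      exact Finset.card_nsmul_le_sum _ _ _ hbig
    rw [← h1, Finset.sum_congr rfl (fun v _ => hm v), Finset.sum_const, Finset.card_univ,
      smul_eq_mul] at h2
    have := Fintype.card_pos (α := V)
    by_contra! hcon
    nlinarith
  let N : (V → ℝ) →ₗ[ℝ] (C → ℝ) :=
    { toFun := fun f L => ∑ w ∈ L.1, f w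
      map_add' := fun f g => by ext L; simp [Finset.sum_add_distrib]
      map_smul' := fun a f => by ext L; simp [Finset.mul_sum] }
  have hker : LinearMap.ker N ≠ ⊥ := LinearMap.ker_ne_bot_of_finrank_lt (by simpa using hcount)
  obtain ⟨f, hf, hf0⟩ := (Submodule.ne_bot_iff _).1 hker
  refine ⟨f, hf0, funext fun v => ?_⟩
  rw [SimpleGraph.adjMatrix_mulVec_apply, hC.sum_neighborFinset,
    Finset.sum_congr rfl (g := fun _ => - f v), Finset.sum_const, hm v]
  · simp
  · intro L hL
    obtain ⟨hL, hv⟩ := Finset.mem_filter.1 hL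
    have h1 : ∑ w ∈ L, f w = 0 := congrFun (LinearMap.mem_ker.1 hf) ⟨L, hL⟩
    rw [← Finset.add_sum_erase L _ hv] at h1
    linarith

/-- Under a Metsch-type condition, the large maximal cliques form a clique geometry, and each
vertex lies in at most `m` of them. -/
lemma exists_cliqueGeometry {k lam nu m : ℕ} (hreg : G.IsRegularOfDegree k)
    (hlam : ∀ u v : V, G.Adj u v → (G.neighborFinset u ∩ G.neighborFinset v).card = lam)
    (hmu : ∀ u v : V, u ≠ v → ¬ G.Adj u v →
      (G.neighborFinset u ∩ G.neighborFinset v).card ≤ nu + 1)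
    (hm : 1 ≤ m) (hk : k ≤ m * (lam + m)) (hl : m ^ 2 * (nu + 1) < lam) :
    ∃ C : Finset (Finset V), IsCliqueGeometry G (C : Set (Finset V)) ∧
      (∀ L ∈ C, m < L.card) ∧ ∀ v, (C.filter fun L => v ∈ L).card ≤ m := by
  classical
  set C : Finset (Finset V) := Finset.univ.filter fun L =>
    IsMaximalClique G L ∧ lam + 2 ≤ L.card + (m - 1) * nu with hCdef
  have hmem : ∀ L, L ∈ C ↔ IsMaximalClique G L ∧ lam + 2 ≤ L.card + (m - 1) * nu := by
    simp [hCdef]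
  obtain ⟨r, rfl⟩ : ∃ r, m = r + 1 := ⟨m - 1, by omega⟩
  simp only [Nat.add_sub_cancel] at hmem
  have hC : IsCliqueGeometry G (C : Set (Finset V)) := by
    refine ⟨fun L hL => ((hmem L).1 hL).1, fun u v huv => ?_⟩
    obtain ⟨K, hK, huK, hvK, hcard⟩ := exists_large_clique hreg hlam hmu hm hk hl huv
    obtain ⟨L, hL, hKL⟩ := exists_isMaximalClique_superset hK
    have hKLcard := Finset.card_le_card hKL
    rw [Nat.add_sub_cancel] at hcard
    have hLC : lam + 2 ≤ L.card + r * nu := by omega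
    refine ⟨L, ⟨(hmem L).2 ⟨hL, hLC⟩, hKL huK, hKL hvK⟩, ?_⟩
    rintro D ⟨hD, huD, hvD⟩
    obtain ⟨hD, hDC⟩ := (hmem D).1 hD
    by_contra hne
    have := hD.card_add_card_le hlam hmu hL hne huv huD hvD (hKL huK) (hKL hvK)
    nlinarith [Nat.zero_le (r ^ 2 * nu)]
  refine ⟨C, hC, fun L hL => ?_, fun v => ?_⟩
  · have := ((hmem L).1 hL).2
    nlinarith [Nat.zero_le (r ^ 2 * nu), Nat.zero_le (r ^ 2), Nat.zero_le (r * nu)]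
  · have h := hC.degree_eq_sum hreg v
    have h1 : ((C.filter fun L => v ∈ L).card : ℝ) * ((lam : ℝ) + 1 - r * nu) ≤ k := by
      rw [h, ← nsmul_eq_mul]
      refine Finset.card_nsmul_le_sum _ _ _ fun L hL => ?_
      have h2 := ((hmem L).1 (Finset.mem_filter.1 hL).1).2
      have h3 : ((lam : ℝ) + 2) ≤ L.card + r * nu := by exact_mod_cast h2
      linarith
    by_contra! hcon
    have h2 : (r : ℝ) + 2 ≤ ((C.filter fun L => v ∈ L).card : ℝ) := by exact_mod_cast hcon
    have hk' : (k : ℝ) ≤ (r + 1) * (lam + (r + 1)) := by exact_mod_cast hk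
    have hl' : ((r : ℝ) + 1) ^ 2 * (nu + 1) + 1 ≤ lam := by exact_mod_cast hl
    have hr : (0 : ℝ) ≤ r := Nat.cast_nonneg r
    have hn : (0 : ℝ) ≤ nu := Nat.cast_nonneg nu
    have hrn := mul_nonneg hr hn
    have h3 : (0 : ℝ) ≤ (lam : ℝ) + 1 - r * nu := by nlinarith [mul_nonneg hr hrn]
    have h4 := (mul_le_mul_of_nonneg_right h2 h3).trans (h1.trans hk')
    nlinarith [mul_nonneg hr hrn]

end Geometry

section Main

variable {V : Type*} [Fintype V] [DecidableEq V] {G : SimpleGraph V} [DecidableRel G.Adj]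

/-- If each vertex lies in at most `m = ⌈|s|⌉` members of a clique geometry of a distance-regular
graph, all of which have more than `m` vertices, then these members are Delsarte cliques. -/
lemma IsCliqueGeometry.card_eq {b c : ℕ → ℕ} {k m : ℕ} {s : ℝ}
    (hdrg : IsDistanceRegular G b c) (hreg : G.IsRegularOfDegree k)
    (hs : IsAdjEigenvalue G s) (hmin : ∀ θ : ℝ, IsAdjEigenvalue G θ → s ≤ θ)
    (hneg : s < 0) (hk : 0 < k) (hms : (m : ℤ) = -⌊s⌋) {C : Finset (Finset V)}
    (hC : IsCliqueGeometry G (C : Set (Finset V))) (hbig : ∀ L ∈ C, m < L.card)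
    (hle : ∀ v, (C.filter fun L => v ∈ L).card ≤ m) {L : Finset V} (hL : L ∈ C) :
    (L.card : ℝ) = 1 + (k : ℝ) / |s| := by
  have hk' : (0 : ℝ) < k := by exact_mod_cast hk
  have hbound : ∀ L ∈ C, 0 ≤ (k : ℝ) + ((L.card : ℝ) - 1) * s := fun L hL =>
    hdrg.clique_bound hreg hs (hC.1 L hL).1
      (Finset.card_pos.1 ((Nat.zero_le m).trans_lt (hbig L hL)))
  have hsum : ∀ v, ∑ L ∈ C with v ∈ L, ((k : ℝ) + ((L.card : ℝ) - 1) * s) =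
      k * ((C.filter fun L => v ∈ L).card + s) := by
    intro v
    rw [Finset.sum_add_distrib, ← Finset.sum_mul, ← hC.degree_eq_sum hreg v, Finset.sum_const,
      nsmul_eq_mul]
    ring
  have hcard : ∀ v, (C.filter fun L => v ∈ L).card = m := by
    intro v
    refine le_antisymm (hle v) ?_
    have h1 : 0 ≤ (k : ℝ) * ((C.filter fun L => v ∈ L).card + s) := by
      rw [← hsum v]
      exact Finset.sum_nonneg fun L hL => hbound L (Finset.mem_filter.1 hL).1
    have h2 := nonneg_of_mul_nonneg_right h1 hk'
    have h3 : -((C.filter fun L => v ∈ L).card : ℤ) ≤ ⌊s⌋ := by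
      rw [Int.le_floor]; push_cast; linarith
    omega
  obtain ⟨v, hv⟩ := Finset.card_pos.1 ((Nat.zero_le m).trans_lt (hbig L hL))
  have : Nonempty V := ⟨v⟩
  have hsm : s = -m := by
    refine le_antisymm (hmin _ (hC.isAdjEigenvalue_neg hcard hbig)) ?_
    have h1 := Int.floor_le s
    have h2 : ((m : ℤ) : ℝ) = -(⌊s⌋ : ℝ) := by exact_mod_cast congrArg (Int.cast (R := ℝ)) hms
    push_cast at h2
    linarith
  have hzero := hsum v
  rw [hcard v, hsm, add_neg_cancel, mul_zero, ← hsm,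
    Finset.sum_eq_zero_iff_of_nonneg fun L hL => hbound L (Finset.mem_filter.1 hL).1] at hzero
  have h := hzero L (Finset.mem_filter.2 ⟨hL, hv⟩)
  rw [abs_of_neg hneg]
  have hs0 : -s ≠ 0 := by linarith
  rw [show (k : ℝ) = ((L.card : ℝ) - 1) * -s by linarith, mul_div_cancel_right₀ _ hs0]
  ring

/-- A complete graph with an edge is Delsarte-geometric. -/
lemma exists_delsarteGeometry_of_complete {b c : ℕ → ℕ} {k : ℕ} {s : ℝ}
    (hdrg : IsDistanceRegular G b c) (hreg : G.IsRegularOfDegree k)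
    (hs : IsAdjEigenvalue G s) (hneg : s ≤ -1) (hk : 0 < k)
    (hcomplete : ∀ u v : V, u ≠ v → G.Adj u v) :
    ∃ C : Set (Finset V), IsCliqueGeometry G C ∧
      ∀ cl ∈ C, (cl.card : ℝ) = 1 + (k : ℝ) / |s| := by
  have hcl : G.IsClique ((Finset.univ : Finset V) : Set V) := fun u _ v _ h => hcomplete u v h
  refine ⟨{Finset.univ}, ⟨?_, fun u v _ => ⟨Finset.univ, by simp, by simp +contextual⟩⟩, ?_⟩
  · rintro _ rfl
    exact ⟨hcl, fun D _ hD => (Finset.univ_subset_iff.1 hD).symm⟩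
  · rintro _ rfl
    have : Nonempty V := hdrg.1.nonempty
    obtain ⟨v⟩ := this
    have hcard : (Finset.univ : Finset V).card = k + 1 := by
      rw [← hreg v, ← G.card_neighborFinset_eq_degree,
        show G.neighborFinset v = Finset.univ.erase v by
          ext w
          simp only [SimpleGraph.mem_neighborFinset, Finset.mem_erase, Finset.mem_univ, and_true]
          exact ⟨fun h => h.ne', fun h => hcomplete v w h.symm⟩,
        Finset.card_erase_add_one (Finset.mem_univ v)]
    have h := hdrg.clique_bound hreg hs hcl ⟨v, Finset.mem_univ v⟩
    rw [hcard] at h ⊢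
    push_cast at h ⊢
    have hk' : (0 : ℝ) < k := by exact_mod_cast hk
    have hs1 : s = -1 := by
      refine le_antisymm hneg ?_
      by_contra! hlt
      nlinarith
    simp [hs1, add_comm]

end Main

/-- **Bang–Koolen theorem**: a distance-regular graph with least eigenvalue `s` and
`λ > ⌊s⌋²·μ` is Delsarte-geometric. -/
theorem bang_koolen_delsarte_geometric {V : Type*} [Fintype V] [DecidableEq V]
    (G : SimpleGraph V) [DecidableRel G.Adj] (b c : ℕ → ℕ) (k lam mu : ℕ) (s : ℝ)
    (hdrg : IsDistanceRegular G b c) (hreg : G.IsRegularOfDegree k)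
    (hlam : ∀ u v : V, G.Adj u v → (G.neighborFinset u ∩ G.neighborFinset v).card = lam)
    (hmu : ∀ u v : V, G.dist u v = 2 → (G.neighborFinset u ∩ G.neighborFinset v).card = mu)
    (hs : IsAdjEigenvalue G s) (hmin : ∀ θ : ℝ, IsAdjEigenvalue G θ → s ≤ θ)
    (hineq : (lam : ℝ) > (⌊s⌋ : ℝ) ^ 2 * (mu : ℝ)) :
    ∃ C : Set (Finset V), IsCliqueGeometry G C ∧
      ∀ cl ∈ C, (cl.card : ℝ) = 1 + (k : ℝ) / |s| := by
  by_cases hedge : ∃ u v, G.Adj u v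
  swap
  · push Not at hedge
    exact ⟨∅, ⟨by simp, fun u v h => absurd h (hedge u v)⟩, by simp⟩
  obtain ⟨x, y, hxy⟩ := hedge
  have hs1 : s ≤ -1 := le_neg_one_of_adj hmin hxy
  have hk : 0 < k := by
    rw [← hreg x]
    exact (G.degree_pos_iff_exists_adj x).2 ⟨y, hxy⟩
  by_cases hcomplete : ∀ u v : V, u ≠ v → G.Adj u v
  · exact exists_delsarteGeometry_of_complete hdrg hreg hs hs1 hk hcomplete
  have hfloor : ⌊s⌋ ≤ -1 := by
    have : (⌊s⌋ : ℝ) ≤ -1 := (Int.floor_le s).trans hs1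
    exact_mod_cast this
  obtain ⟨m, hm⟩ : ∃ m : ℕ, (m : ℤ) = -⌊s⌋ := ⟨(-⌊s⌋).toNat, Int.toNat_of_nonneg (by omega)⟩
  have hm1 : 1 ≤ m := by omega
  have hmR : (⌊s⌋ : ℝ) = -m := by
    have : ⌊s⌋ = -(m : ℤ) := by omega
    rw [this]; push_cast; ring
  have hdist : ∀ u v w : V, u ≠ v → ¬ G.Adj u v → G.Adj u w → G.Adj v w → G.dist u v = 2 := by
    intro u v w hne hadj huw hvw
    have h1 : G.dist u v ≤ 2 := by
      have := hdrg.1.dist_triangle (u := u) (v := w) (w := v)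
      rw [SimpleGraph.dist_eq_one_iff_adj.2 huw, SimpleGraph.dist_eq_one_iff_adj.2 hvw.symm]
        at this
      exact this
    have h2 : G.dist u v ≠ 0 := fun h => hne (hdrg.1.dist_eq_zero_iff.1 h)
    have h3 : G.dist u v ≠ 1 := fun h => hadj (SimpleGraph.dist_eq_one_iff_adj.1 h)
    omega
  have hmu_le : ∀ u v : V, u ≠ v → ¬ G.Adj u v →
      (G.neighborFinset u ∩ G.neighborFinset v).card ≤ mu := by
    intro u v hne hadj
    rcases (G.neighborFinset u ∩ G.neighborFinset v).eq_empty_or_nonempty with h | ⟨w, hw⟩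
    · simp [h]
    · simp only [Finset.mem_inter, SimpleGraph.mem_neighborFinset] at hw
      exact (hmu u v (hdist u v w hne hadj hw.1 hw.2)).le
  have hmu_pos : 0 < mu := by
    by_contra! hmu0
    have hwalk : ∀ u v : V, G.Walk u v → u = v ∨ G.Adj u v := by
      intro u v p
      induction p with
      | nil => exact Or.inl rfl
      | @cons u w v huw _ ih =>
        rcases ih with rfl | hwv
        · exact Or.inr huw
        by_contra! hcon
        have h0 := Finset.card_eq_zero.1 (Nat.le_zero.1 ((hmu_le u v hcon.1 hcon.2).trans hmu0))
        have hw : w ∈ G.neighborFinset u ∩ G.neighborFinset v := by simp [huw, hwv.symm]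
        simp [h0] at hw
    refine hcomplete fun u v hne => ?_
    obtain ⟨p⟩ := hdrg.1.preconnected u v
    exact (hwalk u v p).resolve_left hne
  obtain ⟨nu, rfl⟩ : ∃ nu, mu = nu + 1 := ⟨mu - 1, by omega⟩
  have hl : m ^ 2 * (nu + 1) < lam := by
    rw [hmR, neg_sq] at hineq
    exact_mod_cast hineq
  have hkle : k ≤ m * (lam + m) := by
    have h1 := degree_le_of_le_adjEigenvalue hmin hreg hlam (by linarith) hk x
    have h2 := Int.floor_le s
    rw [hmR] at h2
    have h3 : (k : ℝ) ≤ m * (lam + m) := by nlinarith [Nat.cast_nonneg (α := ℝ) lam]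
    exact_mod_cast h3
  obtain ⟨C, hC, hbig, hle⟩ := exists_cliqueGeometry hreg hlam hmu_le hm1 hkle hl
  exact ⟨C, hC, fun L hL =>
    hC.card_eq hdrg hreg hs hmin (by linarith) hk hm hbig hle hL⟩
end

section
/- Let G be a connected strongly regular graph with parameters (n, k, λ, μ) which is not a complete graph, and let r denote the second-largest eigenvalue of the real adjacency matrix of G. Then r < max{ 4·√(2n), (6/(√13 − 1))·√(k·(μ − 1)) } + √k. -/
open Finset

/-- A Bonferroni-type inequality for sets with small pairwise intersections. -/
theorem two_mul_card_mul_le_card_biUnion_s14 {ι α : Type*} [DecidableEq ι] [DecidableEq α]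
    (S : Finset ι) (B : ι → Finset α) (m c : ℕ) (hB : ∀ y ∈ S, m ≤ #(B y))
    (hc : ∀ y ∈ S, ∀ z ∈ S, y ≠ z → #(B y ∩ B z) ≤ c) :
    2 * (#S : ℤ) * m ≤ 2 * #(S.biUnion B) + #S * (#S - 1) * c := by
  induction S using Finset.induction_on with
  | empty => simp
  | insert a S ha ih =>
    have h1 := ih (fun y hy => hB y (mem_insert_of_mem hy))
      (fun y hy z hz => hc y (mem_insert_of_mem hy) z (mem_insert_of_mem hz))
    have h2 : #(B a ∩ S.biUnion B) ≤ #S * c := by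
      rw [inter_biUnion]
      refine card_biUnion_le_card_mul _ _ _ fun z hz => ?_
      exact hc a (mem_insert_self _ _) z (mem_insert_of_mem hz) (by rintro rfl; exact ha hz)
    have h3 := card_union_add_card_inter (B a) (S.biUnion B)
    have h4 := hB a (mem_insert_self _ _)
    rw [biUnion_insert, card_insert_of_notMem ha]
    zify at h2 h3 h4
    push_cast
    nlinarith

/-- If sets of every size up to `t` obey the Bonferroni bound inside a set of size `k`, then
`t` is small compared with `m / c`. -/
theorem small_of_bonferroni_bound (k m c : ℤ) (t : ℕ) (hc : 0 ≤ c) (hm : 1 ≤ m) (hmk : m ≤ k)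
    (hk : 3 * k * c ≤ (m - 1) ^ 2) (ht : 1 ≤ t)
    (h : ∀ j : ℕ, j ≤ t → 2 * (j : ℤ) * m ≤ 2 * k + j * (j - 1) * c) :
    (2 * (t : ℤ) - 1) * c < m ∧ 3 * (t : ℤ) * m ≤ 4 * k := by
  have hcm : c < m := by nlinarith
  have key : ∀ j : ℕ, 1 ≤ j → j ≤ t → (2 * (j : ℤ) - 1) * c < m := by
    intro j hj
    induction j, hj using Nat.le_induction with
    | base => intro _; simpa using by linarith
    | succ j hj ih =>
      intro hjt
      have h1 := ih (by omega)
      have h2 := h (j + 1) hjt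
      push_cast at h2 ⊢
      by_contra! h3
      have hj0 : (1 : ℤ) ≤ j := by exact_mod_cast hj
      have h4 : ((j : ℤ) + 1) * (3 * m - c) ≤ 4 * k := by nlinarith
      have h5 : (m + c) * (3 * m - c) ≤ 2 * c * ((j : ℤ) + 1) * (3 * m - c) := by
        apply mul_le_mul_of_nonneg_right <;> linarith
      have h6 : c * (((j : ℤ) + 1) * (3 * m - c)) ≤ c * (4 * k) :=
        mul_le_mul_of_nonneg_left h4 hc
      nlinarith
  have h1 := key t ht le_rfl
  refine ⟨h1, ?_⟩
  have h2 := h t le_rfl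
  have ht0 : (1 : ℤ) ≤ t := by exact_mod_cast ht
  have h3 : (t : ℤ) * (2 * ((t : ℤ) - 1) * c) ≤ t * m := by
    apply mul_le_mul_of_nonneg_left <;> nlinarith
  nlinarith

section LocalStructure

variable {α : Type*} [DecidableEq α]

/-- A set of pairwise `R`-unrelated elements of `D`. -/
def IsUnrelatedIn (D : Finset α) (R : α → α → Prop) (S : Finset α) : Prop :=
  S ⊆ D ∧ ∀ u ∈ S, ∀ v ∈ S, u ≠ v → ¬ R u v

theorem IsUnrelatedIn.insert {D : Finset α} {R : α → α → Prop} {S : Finset α} {a : α}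
    (hsymm : ∀ u v, R u v → R v u) (hS : IsUnrelatedIn D R S) (ha : a ∈ D)
    (haS : ∀ u ∈ S, ¬ R u a) : IsUnrelatedIn D R (insert a S) := by
  refine ⟨insert_subset ha hS.1, fun u hu v hv huv => ?_⟩
  rw [mem_insert] at hu hv
  rcases hu with rfl | hu <;> rcases hv with rfl | hv
  · exact absurd rfl huv
  · exact fun h => haS v hv (hsymm _ _ h)
  · exact haS u hu
  · exact hS.2 u hu v hv huv

/-- The elements of `D` related to `y` and to no other member of `S`. -/
def privatePart (D : Finset α) (R : α → α → Prop) [DecidableRel R] (S : Finset α) (y : α) :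
    Finset α :=
  D.filter fun v => R y v ∧ ∀ z ∈ S, z ≠ y → ¬ R z v

variable {D S : Finset α} {R : α → α → Prop} [DecidableRel R] {m c : ℕ}

theorem mem_privatePart {y v : α} :
    v ∈ privatePart D R S y ↔ v ∈ D ∧ R y v ∧ ∀ z ∈ S, z ≠ y → ¬ R z v := by
  simp [privatePart]

theorem two_mul_card_unrelated_mul_le
    (hdeg : ∀ v ∈ D, m ≤ #(D.filter (R v)))
    (hcn : ∀ u ∈ D, ∀ v ∈ D, ¬ R u v → #(D.filter fun w => R u w ∧ R v w) ≤ c)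
    (hS : IsUnrelatedIn D R S) :
    2 * (#S : ℤ) * m ≤ 2 * #D + #S * (#S - 1) * c := by
  have h := two_mul_card_mul_le_card_biUnion_s14 S (fun y => D.filter (R y)) m c
    (fun y hy => hdeg y (hS.1 hy)) (fun y hy z hz hyz => by
      rw [← filter_and]
      exact hcn y (hS.1 hy) z (hS.1 hz) (hS.2 y hy z hz hyz))
  have h2 : #(S.biUnion fun y => D.filter (R y)) ≤ #D :=
    card_le_card (biUnion_subset.2 fun y _ => filter_subset _ _)
  zify at h2
  linarith

theorem le_card_privatePart (hdeg : ∀ v ∈ D, m ≤ #(D.filter (R v)))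
    (hcn : ∀ u ∈ D, ∀ v ∈ D, ¬ R u v → #(D.filter fun w => R u w ∧ R v w) ≤ c)
    (hS : IsUnrelatedIn D R S) {y : α} (hy : y ∈ S) :
    m ≤ #(privatePart D R S y) + (#S - 1) * c := by
  have h1 : D.filter (R y) ⊆ privatePart D R S y ∪
      (S.erase y).biUnion fun z => D.filter fun w => R y w ∧ R z w := by
    intro v hv
    rw [mem_filter] at hv
    by_cases h : ∀ z ∈ S, z ≠ y → ¬ R z v
    · exact mem_union_left _ (mem_privatePart.2 ⟨hv.1, hv.2, h⟩)
    · push Not at h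
      obtain ⟨z, hz, hzy, hzv⟩ := h
      exact mem_union_right _ (mem_biUnion.2 ⟨z, mem_erase.2 ⟨hzy, hz⟩,
        mem_filter.2 ⟨hv.1, hv.2, hzv⟩⟩)
  have h2 : #((S.erase y).biUnion fun z => D.filter fun w => R y w ∧ R z w) ≤ (#S - 1) * c := by
    rw [← card_erase_of_mem hy]
    refine card_biUnion_le_card_mul _ _ _ fun z hz => ?_
    rw [mem_erase] at hz
    exact hcn y (hS.1 hy) z (hS.1 hz.2) (hS.2 y hy z hz.2 hz.1.symm)
  have := (hdeg y (hS.1 hy)).trans ((card_le_card h1).trans (card_union_le _ _))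
  omega

theorem privatePart_pairwise_related (hrefl : ∀ u, R u u) (hsymm : ∀ u v, R u v → R v u)
    (hS : IsUnrelatedIn D R S) (hmax : ∀ T, IsUnrelatedIn D R T → #T ≤ #S) {y u v : α}
    (hy : y ∈ S) (hu : u ∈ privatePart D R S y) (hv : v ∈ privatePart D R S y) : R u v := by
  rw [mem_privatePart] at hu hv
  by_contra huv
  have hE : IsUnrelatedIn D R (S.erase y) :=
    ⟨(erase_subset _ _).trans hS.1, fun a ha b hb =>
      hS.2 a (mem_of_mem_erase ha) b (mem_of_mem_erase hb)⟩
  have hvE : ∀ a ∈ S.erase y, ¬ R a v := fun a ha => hv.2.2 a (mem_of_mem_erase ha)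
    (ne_of_mem_erase ha)
  have huE : ∀ a ∈ insert v (S.erase y), ¬ R a u := by
    intro a ha
    rw [mem_insert] at ha
    rcases ha with rfl | ha
    · exact fun h => huv (hsymm _ _ h)
    · exact hu.2.2 a (mem_of_mem_erase ha) (ne_of_mem_erase ha)
  have h := hmax _ ((hE.insert hsymm hv.1 hvE).insert hsymm hu.1 huE)
  rw [card_insert_of_notMem fun h => huE u h (hrefl u),
    card_insert_of_notMem fun h => hvE v h (hrefl v), card_erase_of_mem hy] at h
  have := card_pos.2 ⟨y, hy⟩
  omega

theorem exists_privatePart_related (hrefl : ∀ u, R u u) (hsymm : ∀ u v, R u v → R v u)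
    (hdeg : ∀ v ∈ D, m ≤ #(D.filter (R v)))
    (hcn : ∀ u ∈ D, ∀ v ∈ D, ¬ R u v → #(D.filter fun w => R u w ∧ R v w) ≤ c)
    (hS : IsUnrelatedIn D R S) (hmax : ∀ T, IsUnrelatedIn D R T → #T ≤ #S)
    (hm : (2 * #S - 1) * c < m) {v : α} (hv : v ∈ D) :
    ∃ y ∈ S, ∀ p ∈ privatePart D R S y, R v p := by
  by_contra! hcon
  have key : ∀ T ⊆ S, ∃ I, IsUnrelatedIn D R I ∧ #I = #T ∧ (∀ q ∈ I, ¬ R q v) ∧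
      ∀ q ∈ I, ∃ y ∈ T, q ∈ privatePart D R S y := by
    intro T
    induction T using Finset.induction_on with
    | empty => exact fun _ => ⟨∅, ⟨by simp, by simp⟩, by simp⟩
    | insert y T hyT ih =>
      intro hT
      obtain ⟨I, hI, hIT, hIv, hIp⟩ := ih ((subset_insert _ _).trans hT)
      have hyS : y ∈ S := hT (mem_insert_self _ _)
      obtain ⟨p₀, hp₀, hvp₀⟩ := hcon y hyS
      have hbad : ∀ q ∈ insert v I,
          #((privatePart D R S y).filter (R q)) ≤ c := by
        intro q hq
        rw [mem_insert] at hq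
        rcases hq with rfl | hq
        · refine (card_le_card fun w hw => ?_).trans
            (hcn q hv p₀ (mem_privatePart.1 hp₀).1 hvp₀)
          rw [mem_filter] at hw
          exact mem_filter.2 ⟨(mem_privatePart.1 hw.1).1, hw.2,
            privatePart_pairwise_related hrefl hsymm hS hmax hyS hp₀ hw.1⟩
        · obtain ⟨z, hz, hqz⟩ := hIp q hq
          have hzy : y ≠ z := by rintro rfl; exact hyT hz
          refine (card_le_card fun w hw => ?_).trans
            (hcn q (hI.1 hq) y (hS.1 hyS) fun h =>
              (mem_privatePart.1 hqz).2.2 y hyS hzy (hsymm _ _ h))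
          rw [mem_filter] at hw
          exact mem_filter.2 ⟨(mem_privatePart.1 hw.1).1, hw.2, (mem_privatePart.1 hw.1).2.1⟩
      have hvI : v ∉ I := fun h => hIv v h (hrefl v)
      have hlt : #((insert v I).biUnion fun q => (privatePart D R S y).filter (R q)) <
          #(privatePart D R S y) := by
        refine (card_biUnion_le_card_mul _ _ _ hbad).trans_lt ?_
        rw [card_insert_of_notMem hvI, hIT]
        have h1 := le_card_privatePart hdeg hcn hS hyS
        have h2 : #T + 1 ≤ #S := by
          rw [← card_insert_of_notMem hyT]; exact card_le_card hT
        obtain ⟨s, hs⟩ : ∃ s, #S = s + 1 := ⟨#S - 1, by omega⟩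
        rw [hs] at h1 h2 hm
        have h3 : (#T + 1) * c ≤ (s + 1) * c := Nat.mul_le_mul_right _ h2
        have h4 : (2 * (s + 1) - 1) * c = (s + 1) * c + s * c := by
          rw [show 2 * (s + 1) - 1 = (s + 1) + s by omega, add_mul]
        simp only [Nat.add_sub_cancel] at h1
        omega
      obtain ⟨q, hq, hqn⟩ := exists_mem_notMem_of_card_lt_card hlt
      have hqR : ∀ a ∈ insert v I, ¬ R a q := fun a ha h =>
        hqn (mem_biUnion.2 ⟨a, ha, mem_filter.2 ⟨hq, h⟩⟩)
      have hqI : ∀ a ∈ I, ¬ R a q := fun a ha => hqR a (mem_insert_of_mem ha)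
      refine ⟨insert q I, hI.insert hsymm (mem_privatePart.1 hq).1 hqI, ?_, ?_, ?_⟩
      · rw [card_insert_of_notMem fun h => hqI q h (hrefl q), card_insert_of_notMem hyT, hIT]
      · intro a ha
        rw [mem_insert] at ha
        rcases ha with rfl | ha
        · exact fun h => hqR v (mem_insert_self _ _) (hsymm _ _ h)
        · exact hIv a ha
      · intro a ha
        rw [mem_insert] at ha
        rcases ha with rfl | ha
        · exact ⟨y, mem_insert_self _ _, hq⟩
        · obtain ⟨z, hz, h⟩ := hIp a ha
          exact ⟨z, mem_insert_of_mem hz, h⟩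
  obtain ⟨I, hI, hIS, hIv, -⟩ := key S subset_rfl
  have h := hmax _ (hI.insert hsymm hv hIv)
  rw [card_insert_of_notMem fun h => hIv v h (hrefl v)] at h
  omega

/-- A set carrying a reflexive symmetric relation with large neighborhoods, in which unrelated
elements have few common neighbors, is covered by few large cliques. -/
theorem exists_clique_cover (hrefl : ∀ u, R u u) (hsymm : ∀ u v, R u v → R v u)
    (hD : D.Nonempty) (hm1 : 1 ≤ m) (hdeg : ∀ v ∈ D, m ≤ #(D.filter (R v)))
    (hcn : ∀ u ∈ D, ∀ v ∈ D, ¬ R u v → #(D.filter fun w => R u w ∧ R v w) ≤ c)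
    (hk : 3 * (#D : ℤ) * c ≤ ((m : ℤ) - 1) ^ 2) :
    ∃ (S : Finset α) (Q : α → Finset α), (2 * (#S : ℤ) - 1) * c < m ∧
      3 * (#S : ℤ) * m ≤ 4 * #D ∧ D ⊆ S.biUnion Q ∧
      ∀ y ∈ S, Q y ⊆ D ∧ (∀ u ∈ Q y, ∀ v ∈ Q y, R u v) ∧
        (m : ℤ) ≤ #(Q y) + ((#S : ℤ) - 1) * c := by
  classical
  obtain ⟨S, hSmem, hSmax⟩ := exists_max_image (D.powerset.filter (IsUnrelatedIn D R)) card
    ⟨∅, by simp [IsUnrelatedIn]⟩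
  have hS : IsUnrelatedIn D R S := (mem_filter.1 hSmem).2
  have hmax : ∀ T, IsUnrelatedIn D R T → #T ≤ #S := fun T hT =>
    hSmax T (mem_filter.2 ⟨mem_powerset.2 hT.1, hT⟩)
  obtain ⟨d, hd⟩ := hD
  have hS1 : 1 ≤ #S := by
    have := hmax {d} ⟨by simpa using hd, by simp⟩
    simpa using this
  have hmk : m ≤ #D := (hdeg d hd).trans (card_le_card (filter_subset _ _))
  obtain ⟨h1, h2⟩ := small_of_bonferroni_bound #D m c #S (by positivity) (by exact_mod_cast hm1)
    (by exact_mod_cast hmk) hk hS1 fun j hj => by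
      obtain ⟨T, hTS, hT⟩ := exists_subset_card_eq hj
      rw [← hT]
      exact two_mul_card_unrelated_mul_le hdeg hcn
        ⟨hTS.trans hS.1, fun u hu v hv => hS.2 u (hTS hu) v (hTS hv)⟩
  have h1' : (2 * #S - 1) * c < m := by
    zify [show 1 ≤ 2 * #S by omega]
    exact h1
  have hP : ∀ y ∈ S, (m : ℤ) ≤ #(privatePart D R S y) + ((#S : ℤ) - 1) * c := by
    intro y hy
    have := le_card_privatePart hdeg hcn hS hy
    zify [hS1] at this
    exact this
  refine ⟨S, fun y => D.filter fun v => ∀ p ∈ privatePart D R S y, R v p, h1, h2, ?_, ?_⟩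
  · intro v hv
    obtain ⟨y, hy, h⟩ := exists_privatePart_related hrefl hsymm hdeg hcn hS hmax h1' hv
    exact mem_biUnion.2 ⟨y, hy, mem_filter.2 ⟨hv, h⟩⟩
  · intro y hy
    refine ⟨filter_subset _ _, ?_, ?_⟩
    · intro u hu v hv
      rw [mem_filter] at hu hv
      by_contra huv
      have h3 : #(privatePart D R S y) ≤ c := (card_le_card fun p hp =>
        mem_filter.2 ⟨(mem_privatePart.1 hp).1, hu.2 p hp, hv.2 p hp⟩).trans
          (hcn u hu.1 v hv.1 huv)
      have h4 := hP y hy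
      zify at h3 hS1
      nlinarith [mul_nonneg (sub_nonneg.2 hS1) (Int.natCast_nonneg c)]
    · refine (hP y hy).trans ?_
      gcongr
      intro p hp
      exact mem_filter.2 ⟨(mem_privatePart.1 hp).1, fun q hq =>
        privatePart_pairwise_related hrefl hsymm hS hmax hy hp hq⟩

end LocalStructure

theorem SimpleGraph.IsSRGWith.card_neighborFinset {V : Type*} [Fintype V] {G : SimpleGraph V}
    [DecidableRel G.Adj] {n k lam mu : ℕ} (h : G.IsSRGWith n k lam mu) (u : V) :
    #(G.neighborFinset u) = k := by
  rw [SimpleGraph.card_neighborFinset_eq_degree]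
  exact h.regular u

section StronglyRegular

variable {V : Type*} [Fintype V] [DecidableEq V] {G : SimpleGraph V} [DecidableRel G.Adj]
  {n k lam mu : ℕ}

theorem SimpleGraph.IsSRGWith.card_inter_of_adj (h : G.IsSRGWith n k lam mu) {u v : V}
    (huv : G.Adj u v) : #(G.neighborFinset u ∩ G.neighborFinset v) = lam := by
  rw [← h.of_adj u v huv, ← Set.toFinset_card]
  congr 1
  ext w
  simp [SimpleGraph.mem_commonNeighbors]

theorem SimpleGraph.IsSRGWith.card_inter_of_not_adj (h : G.IsSRGWith n k lam mu) {u v : V}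
    (hne : u ≠ v) (huv : ¬ G.Adj u v) :
    #(G.neighborFinset u ∩ G.neighborFinset v) = mu := by
  rw [← h.of_not_adj hne huv, ← Set.toFinset_card]
  congr 1
  ext w
  simp [SimpleGraph.mem_commonNeighbors]

theorem SimpleGraph.IsSRGWith.card_closed_neighbors (h : G.IsSRGWith n k lam mu) {x v : V}
    (hv : v ∈ G.neighborFinset x) :
    #((G.neighborFinset x).filter fun w => v = w ∨ G.Adj v w) = lam + 1 := by
  rw [SimpleGraph.mem_neighborFinset] at hv
  rw [← h.card_inter_of_adj hv, ← card_insert_of_notMem (a := v) (by simp)]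
  congr 1
  ext w
  simp only [mem_filter, SimpleGraph.mem_neighborFinset, mem_insert, mem_inter]
  constructor
  · rintro ⟨h1, rfl | h2⟩
    · exact Or.inl rfl
    · exact Or.inr ⟨h1, h2⟩
  · rintro (rfl | ⟨h1, h2⟩)
    · exact ⟨hv, Or.inl rfl⟩
    · exact ⟨h1, Or.inr h2⟩

theorem SimpleGraph.IsSRGWith.card_common_closed_neighbors_le (h : G.IsSRGWith n k lam mu)
    {x u v : V} (hu : u ∈ G.neighborFinset x) (hv : v ∈ G.neighborFinset x)
    (huv : ¬ (u = v ∨ G.Adj u v)) :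
    #((G.neighborFinset x).filter fun w => (u = w ∨ G.Adj u w) ∧ (v = w ∨ G.Adj v w)) ≤
      mu - 1 := by
  push Not at huv
  rw [SimpleGraph.mem_neighborFinset] at hu hv
  have hx : x ∈ G.neighborFinset u ∩ G.neighborFinset v := by simp [hu.symm, hv.symm]
  rw [← h.card_inter_of_not_adj huv.1 huv.2, ← card_erase_of_mem hx]
  refine card_le_card fun w hw => ?_
  simp only [mem_filter, SimpleGraph.mem_neighborFinset, mem_erase, mem_inter] at hw ⊢
  obtain ⟨h1, rfl | h2, rfl | h3⟩ := hw
  · exact absurd rfl huv.1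
  · exact absurd h3.symm huv.2
  · exact absurd h2 huv.2
  · exact ⟨h1.ne', h2, h3⟩

theorem SimpleGraph.IsSRGWith.exists_clique_cover (h : G.IsSRGWith n k lam mu) (hmu : 1 ≤ mu)
    (hk : 1 ≤ k) (hlam : 3 * (k : ℤ) * ((mu : ℤ) - 1) ≤ (lam : ℤ) ^ 2) (x : V) :
    ∃ (S : Finset V) (Q : V → Finset V), (2 * (#S : ℤ) - 1) * ((mu : ℤ) - 1) < lam + 1 ∧
      3 * (#S : ℤ) * (lam + 1) ≤ 4 * k ∧ G.neighborFinset x ⊆ S.biUnion Q ∧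
      ∀ y ∈ S, Q y ⊆ G.neighborFinset x ∧ (∀ u ∈ Q y, ∀ v ∈ Q y, u = v ∨ G.Adj u v) ∧
        ((lam : ℤ) + 1) ≤ #(Q y) + ((#S : ℤ) - 1) * ((mu : ℤ) - 1) := by
  have hD := h.card_neighborFinset x
  have := _root_.exists_clique_cover (D := G.neighborFinset x)
    (R := fun u v => u = v ∨ G.Adj u v) (m := lam + 1) (c := mu - 1)
    (fun u => Or.inl rfl) (fun u v huv => huv.imp Eq.symm SimpleGraph.Adj.symm)
    (card_pos.1 (by omega)) (by omega) (fun v hv => (h.card_closed_neighbors hv).ge)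
    (fun u hu v hv huv => h.card_common_closed_neighbors_le hu hv huv)
    (by rw [hD]; push_cast [hmu]; simpa using hlam)
  rw [hD] at this
  push_cast [hmu] at this
  exact this

/-- Two large cliques around nonadjacent vertices share at most one vertex. -/
theorem SimpleGraph.IsSRGWith.card_clique_add_card_clique_le (h : G.IsSRGWith n k lam mu)
    {x z : V} (hne : x ≠ z) (hxz : ¬ G.Adj x z) {A B : Finset V}
    (hAx : A ⊆ G.neighborFinset x) (hBz : B ⊆ G.neighborFinset z)
    (hA : ∀ u ∈ A, ∀ v ∈ A, u = v ∨ G.Adj u v) (hB : ∀ u ∈ B, ∀ v ∈ B, u = v ∨ G.Adj u v)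
    (hAB : 1 < #(A ∩ B)) : #A + #B ≤ lam + mu := by
  obtain ⟨u, hu, v, hv, huv⟩ := one_lt_card.1 hAB
  rw [mem_inter] at hu hv
  have hadj : G.Adj u v := (hA u hu.1 v hv.1).resolve_left huv
  have hAx' : ∀ a ∈ A, G.Adj x a := fun a ha => by simpa using hAx ha
  have hBz' : ∀ b ∈ B, G.Adj z b := fun b hb => by simpa using hBz hb
  have hxA : x ∉ A := fun hx => (hAx' x hx).ne rfl
  have hzB : z ∉ B := fun hz => (hBz' z hz).ne rfl
  have hxB : x ∉ B := fun hx => hxz (hBz' x hx).symm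
  have hzA : z ∉ A := fun hz => hxz (hAx' z hz)
  have h1 : #(A ∩ B) ≤ mu := by
    rw [← h.card_inter_of_not_adj hne hxz]
    exact card_le_card (inter_subset_inter hAx hBz)
  have h2 : #((insert x (insert z (A ∪ B))) \ {u, v}) ≤ lam := by
    rw [← h.card_inter_of_adj hadj]
    refine card_le_card fun w hw => ?_
    simp only [mem_sdiff, mem_insert, mem_union, mem_singleton, not_or] at hw
    simp only [mem_inter, SimpleGraph.mem_neighborFinset]
    obtain ⟨rfl | rfl | hw | hw, hwu, hwv⟩ := hw
    · exact ⟨(hAx' u hu.1).symm, (hAx' v hv.1).symm⟩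
    · exact ⟨(hBz' u hu.2).symm, (hBz' v hv.2).symm⟩
    · exact ⟨(hA u hu.1 w hw).resolve_left (Ne.symm hwu),
        (hA v hv.1 w hw).resolve_left (Ne.symm hwv)⟩
    · exact ⟨(hB u hu.2 w hw).resolve_left (Ne.symm hwu),
        (hB v hv.2 w hw).resolve_left (Ne.symm hwv)⟩
  have h3 := le_card_sdiff {u, v} (insert x (insert z (A ∪ B)))
  rw [card_pair huv, card_insert_of_notMem (by simp [hne, hxA, hxB]),
    card_insert_of_notMem (by simp [hzA, hzB])] at h3
  have h4 := card_union_add_card_inter A B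
  omega

/-- If `lam` is large compared with `√(k (mu - 1))`, then `mu` is `O((k / lam) ^ 2)`. -/
theorem SimpleGraph.IsSRGWith.mu_mul_sq_le (h : G.IsSRGWith n k lam mu) (hmu : 1 ≤ mu)
    (hk : 1 ≤ k) (hlam : 3 * (k : ℤ) * ((mu : ℤ) - 1) ≤ (lam : ℤ) ^ 2) {x z : V}
    (hne : x ≠ z) (hxz : ¬ G.Adj x z) : 9 * (mu : ℤ) * (lam + 1) ^ 2 ≤ 16 * (k : ℤ) ^ 2 := by
  obtain ⟨S, P, hS, hSk, hSD, hP⟩ := h.exists_clique_cover hmu hk hlam x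
  obtain ⟨T, Q, hT, hTk, hTD, hQ⟩ := h.exists_clique_cover hmu hk hlam z
  have h1 : mu ≤ #S * #T := by
    rw [← h.card_inter_of_not_adj hne hxz, ← card_product, ← mul_one #(S ×ˢ T)]
    refine (card_le_card (t := (S ×ˢ T).biUnion fun p => P p.1 ∩ Q p.2) fun w hw => ?_).trans
      (card_biUnion_le_card_mul _ _ _ fun p hp => ?_)
    · rw [mem_inter] at hw
      obtain ⟨a, ha, hwa⟩ := mem_biUnion.1 (hSD hw.1)
      obtain ⟨b, hb, hwb⟩ := mem_biUnion.1 (hTD hw.2)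
      exact mem_biUnion.2 ⟨(a, b), mem_product.2 ⟨ha, hb⟩, mem_inter.2 ⟨hwa, hwb⟩⟩
    · rw [mem_product] at hp
      obtain ⟨hP1, hP2, hP3⟩ := hP p.1 hp.1
      obtain ⟨hQ1, hQ2, hQ3⟩ := hQ p.2 hp.2
      by_contra! hlt
      have := h.card_clique_add_card_clique_le hne hxz hP1 hQ1 hP2 hQ2 hlt
      zify at this
      linarith
  zify at h1
  calc 9 * (mu : ℤ) * (lam + 1) ^ 2 ≤ 9 * (#S * #T : ℤ) * (lam + 1) ^ 2 := by gcongr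
    _ = (3 * (#S : ℤ) * (lam + 1)) * (3 * (#T : ℤ) * (lam + 1)) := by ring
    _ ≤ (4 * (k : ℤ)) * (4 * k) := by gcongr
    _ = 16 * (k : ℤ) ^ 2 := by ring

theorem SimpleGraph.IsSRGWith.two_mul_lam_le (h : G.IsSRGWith n k lam mu)
    (hk : lam + 1 < k) (x : V) : 2 * (lam + 1) ≤ k + (mu - 1) := by
  have hD := h.card_neighborFinset x
  obtain ⟨v, hv⟩ := card_pos.1 (show 0 < #(G.neighborFinset x) by omega)
  obtain ⟨u, hu, huv⟩ := exists_mem_notMem_of_card_lt_card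
    (s := (G.neighborFinset x).filter fun w => v = w ∨ G.Adj v w) (t := G.neighborFinset x)
    (by rw [h.card_closed_neighbors hv, hD]; exact hk)
  have hvu : ¬ (v = u ∨ G.Adj v u) := fun h' => huv (mem_filter.2 ⟨hu, h'⟩)
  have h1 := card_union_add_card_inter
    ((G.neighborFinset x).filter fun w => v = w ∨ G.Adj v w)
    ((G.neighborFinset x).filter fun w => u = w ∨ G.Adj u w)
  rw [h.card_closed_neighbors hv, h.card_closed_neighbors hu, ← filter_and, ← filter_or] at h1
  have h2 := h.card_common_closed_neighbors_le hv hu hvu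
  have h3 := hD ▸ card_filter_le (G.neighborFinset x)
    (fun w => (v = w ∨ G.Adj v w) ∨ (u = w ∨ G.Adj u w))
  omega

/-- If `lam` is large compared with `√(k (mu - 1))`, then `n` is at least of order `lam ^ 2`. -/
theorem SimpleGraph.IsSRGWith.sq_le_card (h : G.IsSRGWith n k lam mu) (hmu : 1 ≤ mu)
    (hk : 1 ≤ k) (hlam : 3 * (k : ℤ) * ((mu : ℤ) - 1) ≤ (lam : ℤ) ^ 2) (hG : G ≠ ⊤) :
    (lam : ℤ) ^ 2 < 32 * n := by
  obtain ⟨x, z, hne, hxz⟩ := SimpleGraph.ne_top_iff_exists_not_adj.1 hG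
  have hkn : k + 2 ≤ n := by
    have h1 := card_le_univ (insert x (insert z (G.neighborFinset x)))
    rw [card_insert_of_notMem (by simp [hne]), card_insert_of_notMem (by simp [hxz]),
      h.card_neighborFinset, h.card] at h1
    exact h1
  have hparam := SimpleGraph.IsSRGWith.param_eq G h (by omega)
  have hlk : lam + 1 < k := by
    have : 0 < (n - k - 1) * mu := Nat.mul_pos (by omega) hmu
    rw [← hparam] at this
    have := Nat.pos_of_mul_pos_left this
    omega
  have h1 := h.mu_mul_sq_le hmu hk hlam hne hxz
  have h2 := h.two_mul_lam_le hlk x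
  have h3 : k * (k - lam - 1) ≤ n * mu := by
    rw [hparam]; exact Nat.mul_le_mul_right _ (by omega)
  rw [Nat.sub_sub] at h3
  zify [hmu, hlk.le] at h2 h3 hlk hk
  have h4 : 3 * ((mu : ℤ) - 1) ≤ lam := by
    by_contra! h5
    nlinarith [mul_lt_mul_of_pos_left h5 (show (0 : ℤ) < k by linarith)]
  have h5 : 5 * ((lam : ℤ) + 1) ≤ 3 * k := by linarith
  have h6 : 2 * (k : ℤ) ^ 2 ≤ 5 * (n * mu) := by nlinarith
  have h7 : 18 * (k : ℤ) ^ 2 * (lam + 1) ^ 2 ≤ 80 * n * (k : ℤ) ^ 2 := by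
    calc 18 * (k : ℤ) ^ 2 * (lam + 1) ^ 2 = 9 * (2 * (k : ℤ) ^ 2) * (lam + 1) ^ 2 := by ring
      _ ≤ 9 * (5 * (n * mu : ℤ)) * (lam + 1) ^ 2 := by gcongr
      _ = 5 * (n : ℤ) * (9 * mu * (lam + 1) ^ 2) := by ring
      _ ≤ 5 * n * (16 * (k : ℤ) ^ 2) := by gcongr
      _ = 80 * n * (k : ℤ) ^ 2 := by ring
  have h8 : 18 * ((lam : ℤ) + 1) ^ 2 ≤ 80 * n := by
    refine le_of_mul_le_mul_left ?_ (pow_pos (show (0 : ℤ) < k by linarith) 2)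
    linarith
  nlinarith

/-- An adjacency eigenvalue other than the degree is a root of the quadratic attached to the
parameters. -/
theorem IsAdjEigenvalue.sq_eq {r : ℝ} (hr : IsAdjEigenvalue G r) (h : G.IsSRGWith n k lam mu)
    (hrk : r ≠ k) : r ^ 2 = ((lam : ℝ) - mu) * r + (k - mu) := by
  obtain ⟨x, hx0, hx⟩ := hr
  have hsum : ∑ v, x v = 0 := by
    have h1 : (fun _ => (1 : ℝ)) ⬝ᵥ (G.adjMatrix ℝ).mulVec x = r * ∑ v, x v := by
      rw [hx]; simp [dotProduct, mul_sum]
    have h2 : Matrix.vecMul (fun _ => (1 : ℝ)) (G.adjMatrix ℝ) = fun _ => (k : ℝ) := by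
      ext v
      simp [SimpleGraph.adjMatrix_vecMul_apply, h.regular v]
    rw [Matrix.dotProduct_mulVec, h2] at h1
    simp only [dotProduct, ← mul_sum] at h1
    have h3 : (r - k) * ∑ v, x v = 0 := by linarith
    exact (mul_eq_zero.1 h3).resolve_left (sub_ne_zero.2 hrk)
  obtain ⟨v, hv⟩ := Function.ne_iff.1 hx0
  have hcompl : (Gᶜ.adjMatrix ℝ).mulVec x v = - x v - r * x v := by
    have h1 := SimpleGraph.one_add_adjMatrix_add_compl_adjMatrix_eq_of_one (α := ℝ) (G := G)
    rw [SimpleGraph.compl_adjMatrix_eq_adjMatrix_compl] at h1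
    have h2 := congrFun (congrArg (fun M => Matrix.mulVec M x) h1) v
    simp only [Matrix.add_mulVec, Matrix.one_mulVec, hx, Pi.add_apply, Pi.smul_apply,
      smul_eq_mul] at h2
    have h3 : (Matrix.of 1 : Matrix V V ℝ).mulVec x v = 0 := by
      simp [Matrix.mulVec, dotProduct, hsum]
    linarith
  have h1 := congrFun (congrArg (fun M => Matrix.mulVec M x) (h.matrix_eq (α := ℝ))) v
  simp only [pow_two, ← Matrix.mulVec_mulVec, hx, Matrix.mulVec_smul, Matrix.add_mulVec,
    Matrix.smul_mulVec, Matrix.one_mulVec, Pi.add_apply, Pi.smul_apply, smul_eq_mul,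
    hcompl] at h1
  simp only [nsmul_eq_mul] at h1
  refine mul_right_cancel₀ hv ?_
  linarith

end StronglyRegular

/-- **Corollary**: bound on the second-largest adjacency eigenvalue `r` of a connected
non-complete strongly regular graph. -/
theorem srg_r_bound {V : Type*} [Fintype V] [DecidableEq V] (G : SimpleGraph V)
    [DecidableRel G.Adj] (n k lam mu : ℕ) (r : ℝ)
    (hsrg : G.IsSRGWith n k lam mu) (hconn : G.Connected) (hnc : G ≠ ⊤)
    (hr : IsAdjEigenvalue G r) (hrk : r < (k : ℝ))
    (hsecond : ∀ θ : ℝ, IsAdjEigenvalue G θ → θ ≠ (k : ℝ) → θ ≤ r) :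
    r < max (4 * Real.sqrt (2 * n))
        (6 / (Real.sqrt 13 - 1) * Real.sqrt ((k : ℝ) * ((mu : ℝ) - 1))) +
      Real.sqrt (k : ℝ) := by
  by_contra! hle
  obtain ⟨v⟩ := hconn.nonempty
  have hn : 0 < n := hsrg.card ▸ Fintype.card_pos_iff.2 ⟨v⟩
  have hn' : (0 : ℝ) < n := by exact_mod_cast hn
  have hk0 := Real.sqrt_nonneg (k : ℝ)
  have hn1 : 4 * Real.sqrt (2 * n) ≤ r - Real.sqrt k := by
    linarith [le_max_left (4 * Real.sqrt (2 * n))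
      (6 / (Real.sqrt 13 - 1) * Real.sqrt ((k : ℝ) * ((mu : ℝ) - 1)))]
  have hmu1 : 6 / (Real.sqrt 13 - 1) * Real.sqrt ((k : ℝ) * ((mu : ℝ) - 1)) ≤
      r - Real.sqrt k := by
    linarith [le_max_right (4 * Real.sqrt (2 * n))
      (6 / (Real.sqrt 13 - 1) * Real.sqrt ((k : ℝ) * ((mu : ℝ) - 1)))]
  have hspos : 0 < Real.sqrt (2 * n) := Real.sqrt_pos.2 (by positivity)
  have hr0 : 0 < r := by linarith
  have hk : 1 ≤ k := by
    have : (0 : ℝ) < k := hr0.trans hrk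
    exact_mod_cast this
  have hquad := hr.sq_eq hsrg hrk.ne
  have hmu : 1 ≤ mu := by
    by_contra! hmu
    obtain rfl : mu = 0 := by omega
    have h1 := SimpleGraph.IsSRGWith.param_eq G hsrg hn
    have h2 : (k : ℝ) ≤ lam + 1 := by
      rcases Nat.mul_eq_zero.1 (h1.trans (mul_zero _)) with h3 | h3
      · omega
      · exact_mod_cast (show k ≤ lam + 1 by omega)
    push_cast at hquad
    nlinarith
  have hmu' : (1 : ℝ) ≤ mu := by exact_mod_cast hmu
  have hdiff : r - Real.sqrt k ≤ (lam : ℝ) - mu := by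
    have h1 := Real.sq_sqrt (Nat.cast_nonneg (α := ℝ) k)
    refine le_of_mul_le_mul_left ?_ hr0
    nlinarith
  have hlam : r - Real.sqrt k ≤ lam := by linarith
  have hn2 : 32 * (n : ℝ) ≤ (lam : ℝ) ^ 2 := by
    have h1 := Real.sq_sqrt (show (0 : ℝ) ≤ 2 * n by positivity)
    nlinarith [pow_le_pow_left₀ (by positivity) (hn1.trans hlam) 2]
  have hmu2 : 3 * (k : ℝ) * ((mu : ℝ) - 1) ≤ (lam : ℝ) ^ 2 := by
    have h13 : Real.sqrt 13 < 4 := by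
      rw [Real.sqrt_lt' (by norm_num)]; norm_num
    have h13' : 3 < Real.sqrt 13 := Real.lt_sqrt_of_sq_lt (by norm_num)
    have hC : 2 ≤ 6 / (Real.sqrt 13 - 1) := by
      rw [le_div_iff₀ (by linarith)]; linarith
    have h0 : 0 ≤ (k : ℝ) * ((mu : ℝ) - 1) := mul_nonneg (by positivity) (by linarith)
    have h1 := Real.sq_sqrt h0
    have h2 : 2 * Real.sqrt ((k : ℝ) * ((mu : ℝ) - 1)) ≤ lam :=
      (mul_le_mul_of_nonneg_right hC (Real.sqrt_nonneg _)).trans (hmu1.trans hlam)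
    nlinarith [pow_le_pow_left₀ (by positivity) h2 2]
  have h := hsrg.sq_le_card hmu hk (by exact_mod_cast hmu2) hnc
  have h' : (lam : ℝ) ^ 2 < 32 * n := by exact_mod_cast h
  linarith
end

section
/- Let G be a nontrivial strongly regular graph with parameters (n, k, λ, μ) and distinct adjacency eigenvalues k > r > s, satisfying the claw bound r ≤ max{ 2(−s − 1)(μ + 1 + s) + s, s(s + 1)(μ + 1)/2 − 1 }. Then λ < k^{2/3}·(μ + 1)^{1/3}. -/
open Finset

/-- `G` is a disjoint union of cliques: every connected component is a complete graph. -/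
def IsDisjointUnionOfCliques {V : Type*} (G : SimpleGraph V) : Prop :=
  ∀ u v : V, G.Reachable u v → u ≠ v → G.Adj u v

/-- A strongly regular graph is *nontrivial* if neither it nor its complement is a disjoint
union of cliques. -/
def NontrivialSRG {V : Type*} [Fintype V] [DecidableEq V] (G : SimpleGraph V)
    [DecidableRel G.Adj] (n k lam mu : ℕ) : Prop :=
  G.IsSRGWith n k lam mu ∧ ¬ IsDisjointUnionOfCliques G ∧ ¬ IsDisjointUnionOfCliques Gᶜ

theorem cube_lt_of_quadratic_neg {t M r : ℝ} (ht : 2 ≤ t) (hM : 1 ≤ M) (hr : 0 < r)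
    (hl : 0 ≤ M + r - (t + 1))
    (h : r * (r + (3 - t ^ 2) * M) + (3 - 2 * t) * M ^ 2 < 0) :
    (M + r - (t + 1)) ^ 3 < (M - 1 + r * t) ^ 2 * M := by
  have hrt : 0 < r * t := by positivity
  have hcube : (M + r) ^ 3 < (M + r * t) ^ 2 * M := by
    nlinarith [mul_neg_of_pos_of_neg hr h]
  have hratio : (M + r - (t + 1)) * (M + r * t) ≤ (M + r) * (M - 1 + r * t) := by
    nlinarith [mul_nonneg (by linarith : (0 : ℝ) ≤ t) (by linarith : (0 : ℝ) ≤ M)]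
  have hk : 0 < M - 1 + r * t := by linarith
  have hK : 0 < M + r * t := by linarith
  have hsq : ((M + r - (t + 1)) * (M + r * t)) ^ 2 ≤ ((M + r) * (M - 1 + r * t)) ^ 2 :=
    pow_le_pow_left₀ (by positivity) hratio 2
  have hmul := mul_le_mul (by linarith : M + r - (t + 1) ≤ M + r) hsq (by positivity)
    (by positivity)
  refine lt_of_mul_lt_mul_right ?_ (sq_nonneg (M + r * t))
  calc (M + r - (t + 1)) ^ 3 * (M + r * t) ^ 2
      = (M + r - (t + 1)) * ((M + r - (t + 1)) * (M + r * t)) ^ 2 := by ring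
    _ ≤ (M + r) * ((M + r) * (M - 1 + r * t)) ^ 2 := hmul
    _ = (M + r) ^ 3 * (M - 1 + r * t) ^ 2 := by ring
    _ < (M + r * t) ^ 2 * M * (M - 1 + r * t) ^ 2 := by gcongr
    _ = (M - 1 + r * t) ^ 2 * M * (M + r * t) ^ 2 := by ring

theorem cube_lt_of_le_half {t M r : ℝ} (ht : 2 ≤ t) (hM : 1 ≤ M) (hr : 0 < r)
    (hl : 0 ≤ M + r - (t + 1)) (h : r ≤ t * (t - 1) * M / 2 - 1) :
    (M + r - (t + 1)) ^ 3 < (M - 1 + r * t) ^ 2 * M := by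
  refine cube_lt_of_quadratic_neg ht hM hr hl ?_
  have h1 : r + (3 - t ^ 2) * M ≤ 0 := by
    nlinarith [mul_nonneg (mul_nonneg (by linarith : 0 ≤ t - 2) (by linarith : 0 ≤ t + 3))
      (by linarith : 0 ≤ M)]
  nlinarith [mul_nonpos_of_nonneg_of_nonpos hr.le h1, pow_pos (by linarith : 0 < M) 2]

/-- The case of smallest eigenvalue `-2`, where the multiplicity `f` of `r` is controlled by the
trace and `n` is controlled by `f`. -/
theorem cube_lt_of_absolute_bound {n f mu r : ℝ} (hmu : 0 < mu) (hr : 0 < r) (hf : 0 ≤ f)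
    (hl : 0 ≤ mu + 1 + r - 3) (hclaw : r ≤ 2 * (mu + 1 - 2) - 2)
    (hpar : (mu + 2 * r) * (r + 1) = (n - (mu + 2 * r) - 1) * mu)
    (htr : f * (r + 2) = 2 * (n - 1) - (mu + 2 * r))
    (habs : n ≤ (f + 1) ^ 2 + (f + 1)) :
    (mu + 1 + r - 3) ^ 3 < (mu + 2 * r) ^ 2 * (mu + 1) := by
  by_contra hcon
  have hquad : 0 ≤ r ^ 2 - r * (mu + 1) - (mu + 1) ^ 2 := by
    by_contra! hq
    have := cube_lt_of_quadratic_neg (t := 2) (M := mu + 1) (r := r) le_rfl (by linarith) hr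
      (by linarith) (by nlinarith)
    exact hcon (by nlinarith)
  have hlow : 8 / 5 * (mu + 1) ≤ r := by
    by_contra! hlt
    nlinarith
  have h15 : 14 ≤ mu := by linarith
  have hn : 10 * mu + 18 ≤ n := by
    have : (4.2 * mu + 3) * (1.6 * mu + 2) ≤ (mu + 2 * r) * (r + 1) := by
      apply mul_le_mul <;> linarith
    by_contra! hlt
    nlinarith
  have hf13 : f ≤ 13.2 := by
    have h1 : 2 * (n - 1) - (mu + 2 * r) ≤ 5 * (mu + 2 * r) := by
      have : (mu + 2 * r) * (r + 1) ≤ (mu + 2 * r) * (2 * mu) := by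
        gcongr; linarith
      have h2 : n - (mu + 2 * r) - 1 ≤ (mu + 2 * r) * 2 := by
        by_contra! hlt
        nlinarith
      linarith
    by_contra! hlt
    nlinarith
  have hn2 : n ≤ 217 := by nlinarith
  have h20 : mu ≤ 20 := by linarith
  apply hcon
  have hlam : (mu + 1 + r - 3) ^ 3 ≤ (3 * (mu - 2)) ^ 3 :=
    pow_le_pow_left₀ hl (by linarith) 3
  have hk : (4.2 * (mu + 1) - 1) ^ 2 ≤ (mu + 2 * r) ^ 2 :=
    pow_le_pow_left₀ (by linarith) (by linarith) 2
  have hpoly : (3 * (mu - 2)) ^ 3 < (4.2 * (mu + 1) - 1) ^ 2 * (mu + 1) := by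
    nlinarith [mul_nonneg (sub_nonneg.2 h15) (sub_nonneg.2 h20),
      mul_nonneg (mul_nonneg (sub_nonneg.2 h15) (sub_nonneg.2 h20)) hmu.le]
  calc _ ≤ _ := hlam
    _ < _ := hpoly
    _ ≤ _ := by gcongr

theorem Matrix.exists_eq_mul_of_rank {m n K : Type*} [Fintype m] [Fintype n] [Field K]
    (A : Matrix m n K) :
    ∃ (B : Matrix m (Fin A.rank) K) (C : Matrix (Fin A.rank) n K), A = B * C := by
  classical
  let b : Module.Basis (Fin A.rank) K (LinearMap.range A.mulVecLin) := Module.finBasis K _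
  let y (j : n) : LinearMap.range A.mulVecLin :=
    ⟨A.col j, Pi.single j 1, by simp⟩
  refine ⟨.of fun i l => (b l : m → K) i, .of fun l j => b.repr (y j) l, ?_⟩
  ext i j
  have h := congrArg (fun z : LinearMap.range A.mulVecLin => (z : m → K) i) (b.sum_repr (y j))
  simp only [Submodule.coe_sum, Submodule.coe_smul, Finset.sum_apply, Pi.smul_apply,
    smul_eq_mul] at h
  simp only [Matrix.mul_apply, Matrix.of_apply]
  rw [show A i j = (y j : m → K) i from rfl, ← h]
  exact Finset.sum_congr rfl fun _ _ => mul_comm _ _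

open Matrix in
theorem Matrix.rank_hadamard_le {m n K : Type*} [Fintype m] [Fintype n] [Field K]
    (A B : Matrix m n K) : (A ⊙ B).rank ≤ A.rank * B.rank := by
  obtain ⟨P, Q, hA⟩ := A.exists_eq_mul_of_rank
  obtain ⟨R, S, hB⟩ := B.exists_eq_mul_of_rank
  have h : A ⊙ B = (Matrix.of fun i (l : Fin A.rank × Fin B.rank) => P i l.1 * R i l.2) *
      (Matrix.of fun (l : Fin A.rank × Fin B.rank) j => Q l.1 j * S l.2 j) := by
    ext i j
    rw [Matrix.hadamard_apply, congrFun₂ hA, congrFun₂ hB]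
    simp only [Matrix.mul_apply, Matrix.of_apply, Fintype.sum_prod_type, Finset.sum_mul_sum]
    exact Finset.sum_congr rfl fun _ _ => Finset.sum_congr rfl fun _ _ => by ring
  rw [h]
  refine (Matrix.rank_mul_le_left _ _).trans ((Matrix.rank_le_card_width _).trans ?_)
  simp

theorem Matrix.rank_add_le {m n K : Type*} [Fintype m] [Fintype n] [Field K]
    (A B : Matrix m n K) : (A + B).rank ≤ A.rank + B.rank := by
  have hle : LinearMap.range (A + B).mulVecLin ≤
      LinearMap.range A.mulVecLin ⊔ LinearMap.range B.mulVecLin := by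
    rw [Matrix.mulVecLin_add]
    exact LinearMap.range_add_le _ _
  exact (Submodule.finrank_mono hle).trans (Submodule.finrank_add_le_finrank_add_finrank _ _)

theorem Matrix.rank_smul_le {m n K : Type*} [Fintype m] [Fintype n] [Field K] [DecidableEq n]
    (c : K) (A : Matrix m n K) : (c • A).rank ≤ A.rank := by
  simpa using Matrix.rank_mul_le_left A (c • (1 : Matrix n n K))

theorem Matrix.trace_eq_rank_of_isIdempotentElem {n K : Type*} [Fintype n] [DecidableEq n]
    [Field K] {E : Matrix n n K} (h : IsIdempotentElem E) : E.trace = E.rank := by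
  have h' : IsIdempotentElem (Matrix.toLin' E) := by
    rw [IsIdempotentElem, Module.End.mul_eq_comp, ← Matrix.toLin'_mul, h.eq]
  rw [← Matrix.trace_toLin'_eq, (LinearMap.IsIdempotentElem.isProj_range _ h').trace]
  rfl

namespace SimpleGraph

variable {V : Type*} [Fintype V] {G : SimpleGraph V} [DecidableRel G.Adj]
  {n k lam mu : ℕ}

theorem neighborSet_subset_of_degree_le_card_commonNeighbors {u v : V}
    (h : G.degree u ≤ Fintype.card (G.commonNeighbors u v)) :
    G.neighborSet u ⊆ G.neighborSet v := by
  have hsub : G.commonNeighbors u v ⊆ G.neighborSet u := Set.inter_subset_left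
  rw [← G.card_neighborSet_eq_degree, ← Nat.card_eq_fintype_card, ← Nat.card_eq_fintype_card,
    Nat.card_coe_set_eq, Nat.card_coe_set_eq] at h
  rw [← Set.eq_of_subset_of_ncard_le hsub h]
  exact Set.inter_subset_right

theorem IsSRGWith.mu_lt_degree_of_not_cliques (h : G.IsSRGWith n k lam mu)
    (hc : ¬ IsDisjointUnionOfCliques Gᶜ) : mu < k := by
  by_contra! hk
  have hstep {u v : V} (huv : Gᶜ.Adj u v) : G.neighborSet u ⊆ G.neighborSet v := by
    apply neighborSet_subset_of_degree_le_card_commonNeighbors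
    rw [compl_adj] at huv
    rw [h.regular.degree_eq, h.of_not_adj huv.1 huv.2]
    exact hk
  refine hc fun u v huv hne => ?_
  rw [compl_adj]
  refine ⟨hne, fun hadj => ?_⟩
  obtain ⟨p⟩ := huv
  have hall : G.neighborSet u ⊆ G.neighborSet v := by
    clear hadj hne
    induction p with
    | nil => exact subset_rfl
    | cons ha _ ih => exact (hstep ha).trans ih
  exact G.irrefl (hall hadj)

theorem IsSRGWith.lam_add_one_lt_degree_of_not_cliques (h : G.IsSRGWith n k lam mu)
    (hc : ¬ IsDisjointUnionOfCliques G) : lam + 1 < k := by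
  classical
  by_contra! hk
  have hstep {u v : V} (huv : G.Adj u v) :
      insert u (G.neighborSet u) ⊆ insert v (G.neighborSet v) := by
    have hsub : G.commonNeighbors u v ⊆ G.neighborSet u \ {v} := fun w hw =>
      ⟨hw.1, fun hwv => G.irrefl (hwv ▸ hw.2 : G.Adj v v)⟩
    have hcard : (G.neighborSet u \ {v}).ncard ≤ (G.commonNeighbors u v).ncard := by
      rw [Set.ncard_sdiff_singleton_of_mem (by exact huv), ← Nat.card_coe_set_eq,
        ← Nat.card_coe_set_eq, Nat.card_eq_fintype_card, Nat.card_eq_fintype_card,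
        h.of_adj u v huv, card_neighborSet_eq_degree, h.regular.degree_eq]
      omega
    have heq := Set.eq_of_subset_of_ncard_le hsub hcard
    rintro w (rfl | hw)
    · exact Or.inr huv.symm
    · by_cases hwv : w = v
      · exact Or.inl hwv
      · have : w ∈ G.commonNeighbors u v := heq ▸ ⟨hw, hwv⟩
        exact Or.inr this.2
  refine hc fun u v huv hne => ?_
  obtain ⟨p⟩ := huv
  have hall : insert u (G.neighborSet u) ⊆ insert v (G.neighborSet v) := by
    clear hne
    induction p with
    | nil => exact subset_rfl
    | cons ha _ ih => exact (hstep ha).trans ih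
  exact ((hall (Set.mem_insert _ _)).resolve_left hne).symm

theorem IsSRGWith.param_eq_real (h : G.IsSRGWith n k lam mu) (hn : 0 < n) (hl : lam + 1 < k) :
    (k : ℝ) * (k - lam - 1) = (n - k - 1) * mu := by
  have hp := IsSRGWith.param_eq G h hn
  have hkn : k + 1 ≤ n := by
    rw [← h.card] at hn ⊢
    obtain ⟨v⟩ := Fintype.card_pos_iff.1 hn
    rw [← h.regular.degree_eq v]
    exact G.degree_lt_card_verts v
  have h1 : ((k - lam - 1 : ℕ) : ℝ) = k - lam - 1 := by
    rw [Nat.cast_sub (by omega), Nat.cast_sub (by omega)]; simp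
  have h2 : ((n - k - 1 : ℕ) : ℝ) = n - k - 1 := by
    rw [Nat.cast_sub (by omega), Nat.cast_sub (by omega)]; simp
  rw [← h1, ← h2]
  exact_mod_cast hp

variable [DecidableEq V]

theorem IsSRGWith.adjMatrix_sq_eq (h : G.IsSRGWith n k lam mu) :
    G.adjMatrix ℝ * G.adjMatrix ℝ = ((k : ℝ) - mu) • (1 : Matrix V V ℝ) +
      ((lam : ℝ) - mu) • G.adjMatrix ℝ + (mu : ℝ) • Matrix.of fun _ _ => (1 : ℝ) := by
  rw [← sq, h.matrix_eq]
  simp only [← Nat.cast_smul_eq_nsmul ℝ]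
  ext u v
  by_cases huv : u = v
  · subst huv; simp
  · by_cases ha : G.Adj u v <;> simp [huv, ha]

theorem IsSRGWith.eigenvalue_sq_eq (h : G.IsSRGWith n k lam mu) {θ : ℝ}
    (hθ : IsAdjEigenvalue G θ) (hk : θ ≠ k) :
    θ ^ 2 = ((k : ℝ) - mu) + ((lam : ℝ) - mu) * θ := by
  obtain ⟨x, hx, hAx⟩ := hθ
  have hone : (G.adjMatrix ℝ).mulVec (fun _ => 1) = fun _ => (k : ℝ) := by
    ext v; simpa using adjMatrix_mulVec_const_apply_of_regular (a := (1 : ℝ)) h.regular (v := v)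
  have hsum : ∑ v, x v = 0 := by
    have h1 : (fun _ => (1 : ℝ)) ⬝ᵥ (G.adjMatrix ℝ).mulVec x = k * ∑ v, x v := by
      rw [Matrix.dotProduct_mulVec, ← Matrix.mulVec_transpose, transpose_adjMatrix, hone]
      simp [dotProduct, Finset.mul_sum]
    rw [hAx] at h1
    simp only [dotProduct, Pi.smul_apply, smul_eq_mul, one_mul, ← Finset.mul_sum] at h1
    have : (θ - k) * ∑ v, x v = 0 := by linarith
    exact (mul_eq_zero.1 this).resolve_left (sub_ne_zero.2 hk)
  obtain ⟨v, hv⟩ := Function.ne_iff.1 hx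
  have h2 := congrFun (congrArg (fun M => Matrix.mulVec M x) h.adjMatrix_sq_eq) v
  have h3 : ((Matrix.of fun _ _ => (1 : ℝ)) : Matrix V V ℝ).mulVec x = 0 := by
    ext w; simpa [Matrix.mulVec, dotProduct] using hsum
  simp only [← Matrix.mulVec_mulVec, hAx, Matrix.mulVec_smul, Matrix.add_mulVec,
    Matrix.smul_mulVec, Matrix.one_mulVec, h3, Pi.add_apply, Pi.smul_apply, smul_eq_mul,
    Pi.zero_apply, mul_zero] at h2
  exact mul_right_cancel₀ hv (by linear_combination h2)

/-- The projection onto the `r`-eigenspace is a combination of `A`, `1` and the all-ones matrix,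
and its rank is read off from its trace. -/
theorem IsSRGWith.exists_rank_eigenprojection (h : G.IsSRGWith n k lam mu) {r s : ℝ}
    (hn : 0 < n) (hl : lam + 1 < k) (hsr : s < r) (hadd : r + s = lam - mu)
    (hmul : r * s = mu - k) :
    ∃ E : Matrix V V ℝ, (E.rank : ℝ) * (r - s) = -s * (n - 1) - k ∧
      G.adjMatrix ℝ - s • 1 = (r - s) • E + ((k - s) / n) • Matrix.of fun _ _ => (1 : ℝ) := by
  have hd : r - s ≠ 0 := (sub_pos.2 hsr).ne'
  have hn' : (n : ℝ) ≠ 0 := by exact_mod_cast hn.ne'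
  have hpar := h.param_eq_real hn hl
  set A := G.adjMatrix ℝ with hA
  set J : Matrix V V ℝ := Matrix.of fun _ _ => (1 : ℝ) with hJ
  set c : ℝ := (k - s) / n with hc
  have hcn : c * n = k - s := div_mul_cancel₀ _ hn'
  have hcJ : mu - c * (k - r) = 0 := by
    rw [hc]; field_simp; linear_combination -hpar - hmul + k * hadd
  have hAJ : A * J = (k : ℝ) • J := by
    ext u v
    simp [hA, hJ, adjMatrix_mul_apply, h.regular.degree_eq]
  have hJA : J * A = (k : ℝ) • J := by
    ext u v
    simp [hA, hJ, mul_adjMatrix_apply, h.regular.degree_eq]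
  have hJJ : J * J = (n : ℝ) • J := by
    ext u v
    simp [hJ, Matrix.mul_apply, h.card]
  have hAA : A * A = (-(r * s)) • (1 : Matrix V V ℝ) + (r + s) • A + (mu : ℝ) • J := by
    rw [h.adjMatrix_sq_eq, hadd, hmul, neg_sub]
  have hsq : (A - s • 1 - c • J) * (A - s • 1 - c • J) = (r - s) • (A - s • 1 - c • J) := by
    simp only [sub_mul, mul_sub, Matrix.smul_mul, Matrix.mul_smul, one_mul, mul_one, hAJ, hJA,
      hJJ, hAA]
    ext u v
    simp only [Matrix.sub_apply, Matrix.add_apply, Matrix.smul_apply, smul_eq_mul]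
    linear_combination J u v * hcJ + c * J u v * hcn
  refine ⟨(r - s)⁻¹ • (A - s • 1 - c • J), ?_, ?_⟩
  · rw [← Matrix.trace_eq_rank_of_isIdempotentElem]
    · have htr : (A - s • 1 - c • J).trace = -s * (n - 1) - k := by
        simp only [Matrix.trace_sub, Matrix.trace_smul, Matrix.trace_one, hA, trace_adjMatrix,
          h.card, smul_eq_mul]
        have : J.trace = n := by simp [hJ, Matrix.trace, h.card]
        rw [this]
        linear_combination -hcn
      rw [Matrix.trace_smul, htr, smul_eq_mul]
      field_simp
    · rw [IsIdempotentElem, Matrix.smul_mul, Matrix.mul_smul, hsq, smul_smul (r - s)⁻¹ (r - s),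
        inv_mul_cancel₀ hd, one_smul]
  · rw [smul_smul, mul_inv_cancel₀ hd, one_smul]
    abel

/-- A quadratic analogue of the absolute bound, from `B ⊙ B = B + 2` for `B = A + 2`. -/
theorem card_le_of_adjMatrix_add_two_eq {E : Matrix V V ℝ} {a c : ℝ}
    (hE : G.adjMatrix ℝ - (-2 : ℝ) • 1 = a • E + c • Matrix.of fun _ _ => (1 : ℝ)) :
    Fintype.card V ≤ (E.rank + 1) ^ 2 + (E.rank + 1) := by
  set B := G.adjMatrix ℝ - (-2 : ℝ) • 1 with hB
  have hJ : (Matrix.of fun _ _ => (1 : ℝ) : Matrix V V ℝ).rank ≤ 1 := by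
    have : (Matrix.of fun _ _ => (1 : ℝ) : Matrix V V ℝ) = Matrix.vecMulVec 1 1 := by
      ext; simp [Matrix.vecMulVec]
    rw [this]
    exact Matrix.rank_vecMulVec_le _ _
  have hrank : B.rank ≤ E.rank + 1 := by
    rw [hE]
    exact (Matrix.rank_add_le _ _).trans
      (Nat.add_le_add (Matrix.rank_smul_le _ _) ((Matrix.rank_smul_le _ _).trans hJ))
  have hone : (1 : Matrix V V ℝ) = (2⁻¹ : ℝ) • (Matrix.hadamard B B + (-1 : ℝ) • B) := by
    ext u v
    by_cases huv : u = v
    · subst huv; simp [hB]; norm_num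
    · by_cases ha : G.Adj u v <;> simp [hB, huv, ha]
  calc Fintype.card V = (1 : Matrix V V ℝ).rank := Matrix.rank_one.symm
    _ ≤ (Matrix.hadamard B B + (-1 : ℝ) • B).rank := by
      rw [hone]; exact Matrix.rank_smul_le _ _
    _ ≤ B.rank * B.rank + B.rank := (Matrix.rank_add_le _ _).trans
      (Nat.add_le_add (Matrix.rank_hadamard_le _ _) (Matrix.rank_smul_le _ _))
    _ ≤ _ := by rw [sq]; gcongr

end SimpleGraph

theorem exists_int_eq_of_quadratic {x : ℝ} {b c : ℤ} {p q : ℚ} (hx : x ^ 2 = c + b * x)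
    (hq : q ≠ 0) (hxq : x * q = p) : ∃ z : ℤ, x = z := by
  have hxr : x = ((p / q : ℚ) : ℝ) := by
    have : (q : ℝ) ≠ 0 := by exact_mod_cast hq
    push_cast; rw [eq_div_iff this, hxq]
  have hint : IsIntegral ℤ (p / q : ℚ) := by
    refine ⟨.X ^ 2 - .C b * .X - .C c, by monicity!, ?_⟩
    rw [hxr] at hx
    have : (p / q : ℚ) ^ 2 = c + b * (p / q : ℚ) := by exact_mod_cast hx
    rw [← Polynomial.aeval_def]
    simp [-eq_intCast, this]
  obtain ⟨z, hz⟩ := IsIntegrallyClosed.isIntegral_iff.1 hint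
  exact ⟨z, by rw [hxr, ← hz]; simp⟩

theorem lt_rpow_of_cube_lt {l k M : ℝ} (hk : 0 ≤ k) (hM : 0 ≤ M) (h : l ^ 3 < k ^ 2 * M) :
    l < k ^ ((2 : ℝ) / 3) * M ^ ((1 : ℝ) / 3) := by
  refine lt_of_pow_lt_pow_left₀ 3 (by positivity) (h.trans_eq ?_)
  rw [mul_pow, ← Real.rpow_natCast (k ^ _), ← Real.rpow_natCast (M ^ _), ← Real.rpow_mul hk,
    ← Real.rpow_mul hM]
  norm_num

/-- **Spielman's bound**: for a nontrivial strongly regular graph with distinct adjacency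
eigenvalues `k > r > s` satisfying the claw bound, `λ < k^{2/3}(μ+1)^{1/3}`. -/
theorem spielman_lambda_bound {V : Type*} [Fintype V] [DecidableEq V] (G : SimpleGraph V)
    [DecidableRel G.Adj] (n k lam mu : ℕ) (r s : ℝ)
    (hsrg : NontrivialSRG G n k lam mu)
    (hr : IsAdjEigenvalue G r) (hs : IsAdjEigenvalue G s)
    (hrk : r < (k : ℝ)) (hsr : s < r)
    (hall : ∀ θ : ℝ, IsAdjEigenvalue G θ → θ = (k : ℝ) ∨ θ = r ∨ θ = s)
    (hclaw : r ≤ max (2 * (-s - 1) * ((mu : ℝ) + 1 + s) + s)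
      (s * (s + 1) * ((mu : ℝ) + 1) / 2 - 1)) :
    (lam : ℝ) < (k : ℝ) ^ ((2 : ℝ) / 3) * ((mu : ℝ) + 1) ^ ((1 : ℝ) / 3) := by
  obtain ⟨h, hG, hGc⟩ := hsrg
  apply lt_rpow_of_cube_lt (by positivity) (by positivity)
  have hlk := h.lam_add_one_lt_degree_of_not_cliques hG
  have hmk := h.mu_lt_degree_of_not_cliques hGc
  have hlkR : (lam : ℝ) + 1 < k := by exact_mod_cast hlk
  have hmkR : (mu : ℝ) < k := by exact_mod_cast hmk
  have hl0 : (0 : ℝ) ≤ lam := by positivity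
  have hmu0 : (0 : ℝ) ≤ mu := by positivity
  rcases le_or_gt lam mu with hle | hlt
  · have hleR : (lam : ℝ) ≤ mu := by exact_mod_cast hle
    have : (lam : ℝ) ^ 2 ≤ k ^ 2 := pow_le_pow_left₀ hl0 (by linarith) 2
    have hk2 : (0 : ℝ) < k ^ 2 := pow_pos (by linarith) 2
    nlinarith [mul_le_mul_of_nonneg_right this hl0]
  have hltR : (mu : ℝ) < lam := by exact_mod_cast hlt
  have hn : 0 < n := by
    obtain ⟨x, hx, -⟩ := hr
    obtain ⟨v, -⟩ := Function.ne_iff.1 hx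
    rw [← h.card]
    exact Fintype.card_pos_iff.2 ⟨v⟩
  have hr2 := h.eigenvalue_sq_eq hr hrk.ne
  have hs2 := h.eigenvalue_sq_eq hs (hsr.trans hrk).ne
  have hadd : r + s = lam - mu :=
    mul_left_cancel₀ (sub_pos.2 hsr).ne' (by linear_combination hr2 - hs2)
  have hmul : r * s = mu - k := by linear_combination r * hadd - hr2
  have hrs : (r + 1) * (s + 1) < 0 := by nlinarith
  have hs1 : s < -1 := by
    by_contra! hge
    nlinarith
  have hr0 : 0 < r := by linarith
  obtain ⟨E, htr, hE⟩ := h.exists_rank_eigenprojection hn hlk hsr hadd hmul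
  have hlin : s * ((2 * E.rank - (n - 1) : ℤ) : ℚ) =
      ((E.rank * (lam - mu) + k : ℤ) : ℚ) := by
    push_cast
    linear_combination E.rank * hadd - htr
  obtain ⟨z, hz⟩ := exists_int_eq_of_quadratic (b := lam - mu) (c := k - mu)
    (by push_cast; exact hs2) (fun h0 => by
      rw [h0] at hlin
      push_cast at hlin
      nlinarith [mul_nonneg (Nat.cast_nonneg (α := ℝ) E.rank) (sub_pos.2 hltR).le]) hlin
  have hz2 : z ≤ -2 := by
    rw [hz] at hs1
    have : z < -1 := by exact_mod_cast hs1
    omega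
  obtain ⟨t, ht⟩ : ∃ t : ℝ, s = -t := ⟨-s, by simp⟩
  have ht2 : 2 ≤ t := by
    have : (z : ℝ) ≤ -2 := by exact_mod_cast hz2
    linarith
  have hlam : (lam : ℝ) = (mu + 1) + r - (t + 1) := by linarith
  have hk : (k : ℝ) = (mu + 1) - 1 + r * t := by rw [ht] at hmul; linarith
  have hM : (1 : ℝ) ≤ mu + 1 := by linarith
  have hl : 0 ≤ ((mu : ℝ) + 1) + r - (t + 1) := hlam ▸ hl0
  rcases le_max_iff.1 hclaw with hc | hc
  · rcases le_or_gt z (-4) with h4 | h4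
    · have ht4 : 4 ≤ t := by
        have : (z : ℝ) ≤ -4 := by exact_mod_cast h4
        linarith
      rw [hlam, hk]
      refine cube_lt_of_le_half ht2 hM hr0 hl ?_
      subst ht
      nlinarith [mul_nonneg (mul_nonneg (by linarith : 0 ≤ t - 1) (by linarith : 0 ≤ t - 4))
        (by linarith : (0 : ℝ) ≤ mu + 1), mul_nonneg (by linarith : 0 ≤ t - 1)
        (by linarith : 0 ≤ t)]
    · obtain rfl | rfl : z = -3 ∨ z = -2 := by omega
      · obtain rfl : t = 3 := by push_cast at hz; linarith
        rw [hlam, hk]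
        refine cube_lt_of_quadratic_neg ht2 hM hr0 hl ?_
        subst ht
        have : r + (3 - 3 ^ 2) * ((mu : ℝ) + 1) ≤ 0 := by linarith
        nlinarith [mul_nonpos_of_nonneg_of_nonpos hr0.le this]
      · obtain rfl : t = 2 := by push_cast at hz; linarith
        subst ht
        have hkk : (k : ℝ) = mu + 2 * r := by linarith
        have hpar := h.param_eq_real hn hlk
        have habs := G.card_le_of_adjMatrix_add_two_eq hE
        rw [h.card] at habs
        rw [hlam, hkk]
        have := cube_lt_of_absolute_bound (n := n) (f := E.rank) (mu := mu) (r := r)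
          (by linarith) hr0 (by positivity) (by linarith) (by linarith)
          (by rw [← hkk, ← hpar]; congr 1; linarith) (by rw [← hkk]; linarith)
          (by exact_mod_cast habs)
        convert this using 2
        ring
  · rw [hlam, hk]
    refine cube_lt_of_le_half ht2 hM hr0 hl ?_
    subst ht
    linarith
end

section
/- Let G be a nontrivial strongly regular graph with parameters (n, k, λ, μ) and let r denote the second-largest eigenvalue of its adjacency matrix. Then (a) r < n^{1/4}·k^{1/2}, and (b) λ < n^{1/4}·k^{1/2} + μ. -/
open Finset

/-- If every indicator function is a product of two elements of the span of a family of real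
functions, then the number of points is at most the number of unordered pairs from the family. -/
lemma card_le_choose_of_single_eq_mul {V ι : Type*} [Fintype V] [DecidableEq V] [Fintype ι]
    (u : ι → V → ℝ)
    (h : ∀ v, ∃ g ∈ Submodule.span ℝ (Set.range u), ∃ g' ∈ Submodule.span ℝ (Set.range u),
      g * g' = Pi.single v 1) :
    Fintype.card V ≤ (Fintype.card ι + 1).choose 2 := by
  classical
  let φ : Sym2 ι → V → ℝ :=
    Sym2.lift ⟨fun a b ↦ u a * u b, fun a b ↦ mul_comm _ _⟩
  have hmul : Submodule.span ℝ (Set.range u) * Submodule.span ℝ (Set.range u) ≤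
      Submodule.span ℝ (Set.range φ) := by
    rw [Submodule.span_mul_span]
    refine Submodule.span_mono ?_
    rintro _ ⟨_, ⟨a, rfl⟩, _, ⟨b, rfl⟩, rfl⟩
    exact ⟨s(a, b), rfl⟩
  have htop : Submodule.span ℝ (Set.range φ) = ⊤ := by
    rw [eq_top_iff, ← (Pi.basisFun ℝ V).span_eq, Submodule.span_le]
    rintro _ ⟨v, rfl⟩
    obtain ⟨g, hg, g', hg', hgg⟩ := h v
    rw [Pi.basisFun_apply, ← hgg]
    exact hmul (Submodule.mul_mem_mul hg hg')
  have hcard := finrank_range_le_card (R := ℝ) φ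
  rw [Set.finrank, htop, finrank_top, Module.finrank_fintype_fun_eq_card, Sym2.card] at hcard
  exact hcard

/-- An orthonormal basis of an eigenspace of a real matrix, in coordinates, with Bessel's
inequality. -/
lemma exists_eigenspace_basis {V : Type*} [Fintype V] [DecidableEq V] (A : Matrix V V ℝ) (θ : ℝ) :
    ∃ (f : ℕ) (b : Fin f → V → ℝ), (∀ i, A.mulVec (b i) = θ • b i) ∧
      (∀ i, ∑ v, b i v ^ 2 = 1) ∧
      (∀ x, A.mulVec x = θ • x → x ∈ Submodule.span ℝ (Set.range b)) ∧
      ∀ x : V → ℝ, ∑ i, (∑ v, x v * b i v) ^ 2 ≤ ∑ v, x v ^ 2 := by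
  let W := Module.End.eigenspace (Matrix.toEuclideanLin A) θ
  let B := stdOrthonormalBasis ℝ W
  have hB : Orthonormal ℝ fun i ↦ (B i : EuclideanSpace ℝ V) :=
    B.orthonormal.comp_linearIsometry W.subtypeₗᵢ
  refine ⟨Module.finrank ℝ W, fun i ↦ (B i : EuclideanSpace ℝ V).ofLp, fun i ↦ ?_, fun i ↦ ?_,
    fun x hx ↦ ?_, fun x ↦ ?_⟩
  · have := Module.End.mem_eigenspace_iff.1 (B i).2
    simpa using congrArg WithLp.ofLp this
  · rw [← EuclideanSpace.real_norm_sq_eq, hB.1 i, one_pow]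
  · have hxW : WithLp.toLp 2 x ∈ W := by
      rw [Module.End.mem_eigenspace_iff, Matrix.toLpLin_toLp]
      simp [hx]
    have hsum := B.sum_repr ⟨_, hxW⟩
    have hx' : x = ∑ i, B.repr ⟨_, hxW⟩ i • (B i : EuclideanSpace ℝ V).ofLp := by
      have := congrArg (fun y : W ↦ (y : EuclideanSpace ℝ V).ofLp) hsum
      simpa using this.symm
    rw [hx']
    exact Submodule.sum_mem _ fun i _ ↦
      Submodule.smul_mem _ _ (Submodule.subset_span ⟨i, rfl⟩)
  · have := hB.sum_inner_products_le (WithLp.toLp 2 x) (s := Finset.univ)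
    simpa [EuclideanSpace.real_norm_sq_eq, PiLp.inner_apply] using this

namespace SimpleGraph

variable {V : Type*} [Fintype V] {G : SimpleGraph V} [DecidableRel G.Adj] {n k l m : ℕ}

lemma IsRegularOfDegree.sum_adjMatrix_apply (h : G.IsRegularOfDegree k) (v : V) :
    ∑ w, G.adjMatrix ℝ v w = k := by
  rw [← h v, ← card_neighborFinset_eq_degree, neighborFinset_eq_filter]
  simp [adjMatrix_apply]

lemma IsRegularOfDegree.adjMatrix_mulVec_one (h : G.IsRegularOfDegree k) :
    (G.adjMatrix ℝ).mulVec 1 = (k : ℝ) • 1 := by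
  ext v
  simpa only [Matrix.mulVec, dotProduct, Pi.one_apply, mul_one, Pi.smul_apply, smul_eq_mul]
    using h.sum_adjMatrix_apply v

/-- Eigenvectors of a regular graph for eigenvalues other than the degree sum to zero. -/
lemma IsRegularOfDegree.sum_eq_zero_of_mulVec_eq (h : G.IsRegularOfDegree k) {θ : ℝ}
    (hθ : θ ≠ k) {x : V → ℝ} (hx : (G.adjMatrix ℝ).mulVec x = θ • x) : ∑ v, x v = 0 := by
  have h2 := Matrix.dotProduct_mulVec 1 (G.adjMatrix ℝ) x
  rw [← Matrix.mulVec_transpose, transpose_adjMatrix, h.adjMatrix_mulVec_one, hx] at h2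
  simp only [dotProduct, Pi.one_apply, Pi.smul_apply, smul_eq_mul, one_mul, mul_one,
    ← Finset.mul_sum] at h2
  exact (mul_eq_zero.1 (show (θ - k) * ∑ v, x v = 0 by linarith)).resolve_left (sub_ne_zero.2 hθ)

/-- The multiplicity of an eigenvalue of a regular graph, bounded through the trace of the square
of the adjacency matrix. -/
lemma IsRegularOfDegree.card_mul_sq_le (h : G.IsRegularOfDegree k) (hn : Fintype.card V = n)
    (hn0 : 0 < n) {θ : ℝ} (hθ : θ ≠ k) {f : ℕ} {b : Fin f → V → ℝ}
    (hb : ∀ i, (G.adjMatrix ℝ).mulVec (b i) = θ • b i) (hb1 : ∀ i, ∑ v, b i v ^ 2 = 1)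
    (hbessel : ∀ x : V → ℝ, ∑ i, (∑ v, x v * b i v) ^ 2 ≤ ∑ v, x v ^ 2) :
    f * θ ^ 2 ≤ k * (n - k : ℝ) := by
  have hn0' : (n : ℝ) ≠ 0 := by positivity
  have hcoef (v : V) (i : Fin f) :
      ∑ w, (G.adjMatrix ℝ v w - k / n) * b i w = θ * b i v := by
    have h1 := congrFun (hb i) v
    simp only [Matrix.mulVec, dotProduct, Pi.smul_apply, smul_eq_mul] at h1
    simp only [sub_mul, Finset.sum_sub_distrib, ← Finset.mul_sum,
      h.sum_eq_zero_of_mulVec_eq hθ (hb i), h1]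
    ring
  have hnorm (v : V) : ∑ w, (G.adjMatrix ℝ v w - k / n) ^ 2 = k - k ^ 2 / n := by
    have hpt (w : V) : (G.adjMatrix ℝ v w - k / n) ^ 2 =
        (1 - 2 * (k / n)) * G.adjMatrix ℝ v w + (k / n) ^ 2 := by
      rw [adjMatrix_apply]; split_ifs <;> ring
    simp only [hpt, Finset.sum_add_distrib, ← Finset.mul_sum, h.sum_adjMatrix_apply,
      Finset.sum_const, Finset.card_univ, hn, nsmul_eq_mul]
    field_simp
    ring
  have hsum := Finset.sum_le_sum fun v (_ : v ∈ Finset.univ) ↦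
    hbessel fun w ↦ G.adjMatrix ℝ v w - k / n
  simp only [hcoef, hnorm] at hsum
  rw [Finset.sum_comm] at hsum
  simp only [mul_pow, ← Finset.mul_sum, hb1, Finset.sum_const, Finset.card_univ, Fintype.card_fin,
    hn, nsmul_eq_mul, mul_one] at hsum
  calc _ ≤ _ := hsum
    _ = _ := by field_simp

variable [DecidableEq V]

/-- The quadratic equation satisfied by the adjacency matrix of a strongly regular graph. -/
lemma IsSRGWith.mulVec_mulVec (h : G.IsSRGWith n k l m) (x : V → ℝ) (v : V) :
    (G.adjMatrix ℝ).mulVec ((G.adjMatrix ℝ).mulVec x) v =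
      (k - m) * x v + (l - m) * (G.adjMatrix ℝ).mulVec x v + m * ∑ w, x w := by
  have hsq := h.matrix_eq (α := ℝ)
  have hc : Gᶜ.adjMatrix ℝ = Matrix.of 1 - 1 - G.adjMatrix ℝ := by
    rw [← one_add_adjMatrix_add_compl_adjMatrix_eq_of_one (G := G) (α := ℝ)]
    rw [compl_adjMatrix_eq_adjMatrix_compl]; abel
  have hJ : (Matrix.of (1 : V → V → ℝ)).mulVec x v = ∑ w, x w := by
    simp [Matrix.mulVec, dotProduct]
  rw [Matrix.mulVec_mulVec, ← sq, hsq, hc]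
  simp only [← Nat.cast_smul_eq_nsmul ℝ, Matrix.add_mulVec, Matrix.sub_mulVec, Matrix.smul_mulVec,
    Matrix.one_mulVec, Pi.add_apply, Pi.sub_apply, Pi.smul_apply, smul_eq_mul, hJ]
  ring

/-- An eigenvalue other than the degree is a root of the quadratic with sum of roots `l - m` and
product of roots `m - k`. -/
lemma IsSRGWith.sq_eq_of_isAdjEigenvalue (h : G.IsSRGWith n k l m) {θ : ℝ}
    (hθ : IsAdjEigenvalue G θ) (hθk : θ ≠ k) : θ ^ 2 = (k - m) + (l - m) * θ := by
  obtain ⟨x, hx0, hx⟩ := hθ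
  obtain ⟨v, hv⟩ := Function.ne_iff.1 hx0
  have h1 := h.mulVec_mulVec x v
  rw [hx, Matrix.mulVec_smul, hx, h.regular.sum_eq_zero_of_mulVec_eq hθk hx] at h1
  simp only [Pi.smul_apply, smul_eq_mul] at h1
  exact mul_right_cancel₀ hv (by linarith)

/-- A row of `A - t • 1`, shifted by a constant. -/
def shiftedRow (G : SimpleGraph V) [DecidableRel G.Adj] (t c : ℝ) (v w : V) : ℝ :=
  G.adjMatrix ℝ v w - t * Pi.single (M := fun _ ↦ ℝ) v 1 w - c

/-- For the two roots `θ`, `t` of the quadratic equation of a strongly regular graph, suitably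
shifted rows of `A - t • 1` are eigenvectors for `θ`. -/
lemma IsSRGWith.mulVec_shiftedRow (h : G.IsSRGWith n k l m) {θ t : ℝ} (hθk : θ ≠ k)
    (hadd : θ + t = l - m) (hmul : θ * t = m - k) (v : V) :
    (G.adjMatrix ℝ).mulVec (G.shiftedRow t (m / (k - θ)) v) =
      θ • G.shiftedRow t (m / (k - θ)) v := by
  set e : V → ℝ := Pi.single v 1 with he
  set c : ℝ := m / (k - θ) with hc
  have hc' : c * (k - θ) = m := div_mul_cancel₀ _ (sub_ne_zero.2 hθk.symm)
  have hA : (G.adjMatrix ℝ).mulVec e = G.adjMatrix ℝ v := by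
    ext w; simp [he, adjMatrix_apply, adj_comm]
  have hrow : G.shiftedRow t c v = (G.adjMatrix ℝ).mulVec e - t • e - c • 1 := by
    rw [hA]; ext w; simp [shiftedRow, he]
  have hsum : ∑ w, e w = 1 := by simp [he]
  ext w
  rw [hrow, Matrix.mulVec_sub, Matrix.mulVec_sub, Matrix.mulVec_smul, Matrix.mulVec_smul,
    h.regular.adjMatrix_mulVec_one]
  simp only [Pi.sub_apply, Pi.smul_apply, smul_eq_mul, Pi.one_apply, h.mulVec_mulVec, hsum]
  linear_combination (-(G.adjMatrix ℝ).mulVec e w) * hadd + e w * hmul - hc'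

/-- The absolute bound, for an eigenvalue whose conjugate root is neither `0` nor `-1`. -/
lemma IsSRGWith.card_le_choose (h : G.IsSRGWith n k l m) {θ t : ℝ} (hθk : θ ≠ k)
    (hadd : θ + t = l - m) (hmul : θ * t = m - k) (ht0 : t ≠ 0) (ht1 : t ≠ -1)
    {f : ℕ} {b : Fin f → V → ℝ}
    (hspan : ∀ x, (G.adjMatrix ℝ).mulVec x = θ • x → x ∈ Submodule.span ℝ (Set.range b)) :
    n ≤ (f + 2).choose 2 := by
  let u : Option (Fin f) → V → ℝ := fun o ↦ o.elim 1 b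
  have hone : (1 : V → ℝ) ∈ Submodule.span ℝ (Set.range u) := Submodule.subset_span ⟨none, rfl⟩
  have hsub : Submodule.span ℝ (Set.range b) ≤ Submodule.span ℝ (Set.range u) := by
    refine Submodule.span_mono ?_
    rintro _ ⟨i, rfl⟩
    exact ⟨some i, rfl⟩
  have hmem (v : V) (c : ℝ) : G.shiftedRow t c v ∈ Submodule.span ℝ (Set.range u) := by
    have h1 := hsub (hspan _ (h.mulVec_shiftedRow hθk hadd hmul v))
    convert! Submodule.add_mem _ h1 (Submodule.smul_mem _ (m / (k - θ) - c) hone) using 1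
    ext w
    simp [shiftedRow]
  have := card_le_choose_of_single_eq_mul u fun v ↦
    ⟨(t * (t + 1))⁻¹ • G.shiftedRow t 0 v, Submodule.smul_mem _ _ (hmem v 0), _, hmem v 1, by
      have ht1' : t + 1 ≠ 0 := fun h0 ↦ ht1 (by linarith)
      ext w
      by_cases hvw : w = v
      · subst hvw
        simp [shiftedRow]
        field_simp
        ring
      · by_cases ha : G.Adj v w <;> simp [shiftedRow, hvw, ha]⟩
  simpa [h.card] using this

/-- In a strongly regular graph that is not a disjoint union of cliques, `l + 1 < k`. -/
lemma IsSRGWith.add_one_lt (h : G.IsSRGWith n k l m) (hG : ¬ IsDisjointUnionOfCliques G) :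
    l + 1 < k := by
  by_contra! hk
  refine hG fun u v huv ↦ ?_
  rw [reachable_iff_reflTransGen] at huv
  induction huv with
  | refl => exact fun h ↦ (h rfl).elim
  | @tail w v _ hwv ih =>
    intro huv
    by_cases huw : u = w
    · exact huw ▸ hwv
    have hadj := ih huw
    have hsub : (G.commonNeighbors u w).toFinset ⊆ (G.neighborFinset w).erase u := by
      intro z; simp only [Set.mem_toFinset, mem_commonNeighbors, Finset.mem_erase,
        mem_neighborFinset]
      exact fun hz ↦ ⟨hz.1.ne', hz.2⟩
    have heq := Finset.eq_of_subset_of_card_le hsub (by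
      rw [Finset.card_erase_of_mem (by simpa using hadj.symm), card_neighborFinset_eq_degree,
        h.regular w, Set.toFinset_card, h.of_adj u w hadj]
      lia)
    have hv : v ∈ (G.neighborFinset w).erase u := by simpa using ⟨Ne.symm huv, hwv⟩
    rw [← heq] at hv
    simp only [Set.mem_toFinset, mem_commonNeighbors] at hv
    exact hv.1

/-- In a strongly regular graph whose complement is not a disjoint union of cliques, `m < k`. -/
lemma IsSRGWith.lt_of_compl (h : G.IsSRGWith n k l m) (hG : ¬ IsDisjointUnionOfCliques Gᶜ) :
    m < k := by
  by_contra! hk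
  refine hG fun u v huv ↦ ?_
  rw [reachable_iff_reflTransGen] at huv
  induction huv with
  | refl => exact fun h ↦ (h rfl).elim
  | @tail w v _ hwv ih =>
    intro huv
    by_cases huw : u = w
    · exact huw ▸ hwv
    have hadj := ih huw
    rw [compl_adj] at hadj hwv ⊢
    refine ⟨huv, fun huv' ↦ hwv.2 ?_⟩
    have hsub : (G.commonNeighbors u w).toFinset ⊆ G.neighborFinset u := by
      intro z; simp only [Set.mem_toFinset, mem_commonNeighbors, mem_neighborFinset]
      exact fun hz ↦ hz.1
    have heq := Finset.eq_of_subset_of_card_le hsub (by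
      rw [card_neighborFinset_eq_degree, h.regular u, Set.toFinset_card,
        h.of_not_adj hadj.1 hadj.2]
      exact hk)
    have hv : v ∈ G.neighborFinset u := by simpa using huv'
    rw [← heq] at hv
    simp only [Set.mem_toFinset, mem_commonNeighbors] at hv
    exact hv.2

/-- The other root of the quadratic equation is an eigenvalue as well. -/
lemma IsSRGWith.isAdjEigenvalue_of_roots (h : G.IsSRGWith n k l m)
    (hG : ¬ IsDisjointUnionOfCliques Gᶜ) (hk : 0 < k) {θ t : ℝ} (hθk : θ ≠ k)
    (hadd : θ + t = l - m) (hmul : θ * t = m - k) : IsAdjEigenvalue G θ := by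
  obtain ⟨u, v, huv, hne, hnadj⟩ : ∃ u v, Gᶜ.Reachable u v ∧ u ≠ v ∧ ¬ Gᶜ.Adj u v := by
    simpa [IsDisjointUnionOfCliques] using hG
  obtain ⟨w, huw, hnadj⟩ : ∃ w, u ≠ w ∧ ¬ G.Adj u w := by
    rw [reachable_iff_reflTransGen] at huv
    obtain rfl | ⟨w, hw, -⟩ := huv.cases_head
    · exact (hne rfl).elim
    · exact ⟨w, hw⟩
  obtain ⟨z, hz⟩ : ∃ z, G.Adj u z := (G.degree_pos_iff_exists_adj u).1 (by rwa [h.regular u])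
  refine ⟨_, fun h0 ↦ ?_, h.mulVec_shiftedRow hθk hadd hmul u⟩
  have hw := congrFun h0 w
  have hz' := congrFun h0 z
  simp only [shiftedRow, adjMatrix_apply, hnadj, hz, if_true, if_false, Pi.zero_apply,
    Pi.single_eq_of_ne huw.symm, Pi.single_eq_of_ne hz.ne'] at hw hz'
  linarith

/-- A fourth power form of Pyber's bound, valid for every eigenvalue other than the degree. -/
lemma IsSRGWith.pow_four_lt (h : G.IsSRGWith n k l m) (hlk : l + 1 < k) (hmk : m < k) {θ t : ℝ}
    (hθk : θ ≠ k) (hadd : θ + t = l - m) (hmul : θ * t = m - k) (hkn : k < n) :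
    θ ^ 4 < n * (k : ℝ) ^ 2 := by
  obtain ⟨f, b, hb, hb1, hspan, hbessel⟩ := exists_eigenspace_basis (G.adjMatrix ℝ) θ
  have hmk' : (m : ℝ) < k := by exact_mod_cast hmk
  have hlk' : (l : ℝ) + 1 < k := by exact_mod_cast hlk
  have habs : n ≤ (f + 2).choose 2 :=
    h.card_le_choose hθk hadd hmul (by rintro rfl; linarith) (by rintro rfl; linarith) hspan
  have htr := h.regular.card_mul_sq_le h.card (by lia) hθk hb hb1 hbessel
  have hk2 : 2 ≤ k := by lia
  have hf : 0 < f := by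
    rcases Nat.eq_zero_or_pos f with rfl | hf
    · norm_num at habs; lia
    · exact hf
  have hnf : ((n - k : ℕ) : ℝ) ^ 2 < f ^ 2 * n := by
    rw [Nat.choose_two_right, Nat.le_div_iff_mul_le two_pos] at habs
    simp only [Nat.add_succ_sub_one] at habs
    obtain ⟨d, rfl⟩ := Nat.exists_eq_add_of_lt hkn
    norm_cast
    have hd : k + d + 1 - k = d + 1 := by lia
    rw [hd]
    by_cases hf4 : 4 ≤ f
    · have : k + d + 1 ≤ f ^ 2 := by nlinarith
      nlinarith
    · interval_cases f <;> nlinarith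
  rw [Nat.cast_sub hkn.le] at hnf
  have hkn' : (k : ℝ) < n := by exact_mod_cast hkn
  have hsq : ((f : ℝ) * θ ^ 2) ^ 2 ≤ (k * (n - k : ℝ)) ^ 2 :=
    pow_le_pow_left₀ (by positivity) htr 2
  have hk0 : (0 : ℝ) < (k : ℝ) ^ 2 := by positivity
  have hf0 : (0 : ℝ) < (f : ℝ) ^ 2 := by positivity
  refine lt_of_mul_lt_mul_left (a := (f : ℝ) ^ 2) ?_ hf0.le
  calc (f : ℝ) ^ 2 * θ ^ 4 = (f * θ ^ 2) ^ 2 := by ring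
    _ ≤ (k * (n - k : ℝ)) ^ 2 := hsq
    _ = k ^ 2 * (n - k : ℝ) ^ 2 := by ring
    _ < k ^ 2 * (f ^ 2 * n) := mul_lt_mul_of_pos_left hnf hk0
    _ = f ^ 2 * (n * k ^ 2) := by ring

end SimpleGraph

/-- **Pyber's bounds**: for a nontrivial strongly regular graph with second-largest adjacency
eigenvalue `r`, one has `r < n^{1/4}·k^{1/2}` and `λ < n^{1/4}·k^{1/2} + μ`. -/
theorem pyber_bounds {V : Type*} [Fintype V] [DecidableEq V] (G : SimpleGraph V)
    [DecidableRel G.Adj] (n k lam mu : ℕ) (r : ℝ)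
    (hsrg : NontrivialSRG G n k lam mu)
    (hr : IsAdjEigenvalue G r) (hrk : r < (k : ℝ))
    (hsecond : ∀ θ : ℝ, IsAdjEigenvalue G θ → θ ≠ (k : ℝ) → θ ≤ r) :
    r < (n : ℝ) ^ ((1 : ℝ) / 4) * (k : ℝ) ^ ((1 : ℝ) / 2) ∧
      (lam : ℝ) < (n : ℝ) ^ ((1 : ℝ) / 4) * (k : ℝ) ^ ((1 : ℝ) / 2) + (mu : ℝ) := by
  obtain ⟨h, hG, hGc⟩ := hsrg
  have hlk := h.add_one_lt hG
  have hmk := h.lt_of_compl hGc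
  have hlk' : (lam : ℝ) + 1 < k := by exact_mod_cast hlk
  have hmk' : (mu : ℝ) < k := by exact_mod_cast hmk
  obtain ⟨v⟩ : Nonempty V := by
    by_contra hV
    exact hG fun u ↦ (hV ⟨u⟩).elim
  have hkn : k < n := by
    rw [← h.card, ← h.regular v]
    exact G.degree_lt_card_verts v
  have hquad := h.sq_eq_of_isAdjEigenvalue hr hrk.ne
  obtain ⟨s, hs⟩ : ∃ s : ℝ, r + s = lam - mu := ⟨lam - mu - r, by ring⟩
  have hrs : r * s = mu - k := by linear_combination r * hs - hquad
  have hs0 : s < 0 := by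
    by_contra! hs0
    have hr0 : r < 0 := by nlinarith
    have hsk : s ≠ k := by
      rintro rfl
      have hp := h.param_eq (G := G) (by lia)
      have hp' : (k : ℝ) * (k - lam - 1) = (n - k - 1) * mu := by
        zify [show lam ≤ k by lia, show 1 ≤ k - lam by lia, hkn.le,
          show 1 ≤ n - k by lia] at hp
        exact_mod_cast hp
      have hnm : (n : ℝ) * mu = 0 := by linear_combination -hp' - hrs + k * hs
      have hn : (n : ℝ) ≠ 0 := by norm_cast; lia
      have hm : (mu : ℝ) = 0 := (mul_eq_zero.1 hnm).resolve_left hn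
      have hk0 : (0 : ℝ) < k := by linarith
      nlinarith
    have := hsecond s (h.isAdjEigenvalue_of_roots hGc (by lia) hsk (by rw [add_comm, hs])
      (by rw [mul_comm, hrs])) hsk
    linarith
  have hbound : r < (n : ℝ) ^ ((1 : ℝ) / 4) * (k : ℝ) ^ ((1 : ℝ) / 2) := by
    refine lt_of_pow_lt_pow_left₀ 4 (by positivity) ?_
    have hn4 : ((n : ℝ) ^ ((1 : ℝ) / 4)) ^ 4 = n := by
      rw [← Real.rpow_natCast, ← Real.rpow_mul (by positivity)]; norm_num
    have hk4 : ((k : ℝ) ^ ((1 : ℝ) / 2)) ^ 4 = (k : ℝ) ^ 2 := by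
      rw [← Real.rpow_natCast, ← Real.rpow_mul (by positivity), ← Real.rpow_natCast]; norm_num
    rw [mul_pow, hn4, hk4]
    exact h.pow_four_lt hlk hmk hrk.ne hs hrs hkn
  exact ⟨hbound, by linarith⟩
end

section
/- Define g(n, k) = min{ (k/n)^{4/3}, k^{1/2}/n^{3/4}, max{ (k/n)^{3/2}, n^{−1/2} } }. There exists an absolute constant C > 0 such that for every nontrivial strongly regular graph G with parameters (n, k, λ, μ) satisfying k ≤ (n − 1)/2, with distinct adjacency eigenvalues k > r > s satisfying the claw bound r ≤ max{ 2(−s − 1)(μ + 1 + s) + s, s(s + 1)(μ + 1)/2 − 1 }, one has r/n ≤ C·g(n, k). -/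
open Finset

/-- The piecewise bound function `g(n,k)` of Babai–Wilmes. -/
noncomputable def g (n k : ℕ) : ℝ :=
  min (((k : ℝ) / (n : ℝ)) ^ ((4 : ℝ) / 3))
    (min ((k : ℝ) ^ ((1 : ℝ) / 2) / (n : ℝ) ^ ((3 : ℝ) / 4))
      (max (((k : ℝ) / (n : ℝ)) ^ ((3 : ℝ) / 2)) ((n : ℝ) ^ (-(1 : ℝ) / 2))))

/-- A family of sets with at least `3 * l / 4` points each, pairwise meeting in at most one point
and covering every point at least three times, needs order of `l ^ 2` points. -/
lemma sq_le_card_of_linear_family {V : Type*} [Fintype V] [DecidableEq V]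
    (F : Finset (Finset V)) (l : ℝ) (hl : 0 < l)
    (hsize : ∀ K ∈ F, 3 * l ≤ 4 * (#K : ℝ))
    (hinter : ∀ K ∈ F, ∀ L ∈ F, K ≠ L → #(K ∩ L) ≤ 1)
    (hdeg : ∀ v, 3 ≤ #{K ∈ F | v ∈ K}) (hV : 0 < Fintype.card V) :
    9 * l ^ 2 ≤ 32 * (Fintype.card V : ℝ) := by
  set n : ℝ := (Fintype.card V : ℝ) with hn
  have hn0 : 0 < n := by rw [hn]; exact_mod_cast hV
  set d : V → ℝ := fun v ↦ (#{K ∈ F | v ∈ K} : ℝ) with hd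
  have hd' : ∀ v, d v = ∑ K ∈ F, if v ∈ K then (1 : ℝ) else 0 := fun v ↦ by simp [hd]
  set D : ℝ := ∑ v, d v with hD
  have hD3 : 3 * n ≤ D := by
    have : ∑ _v : V, (3 : ℝ) ≤ D := sum_le_sum fun v _ ↦ by simp only [hd]; exact_mod_cast hdeg v
    simpa [hn, mul_comm] using this
  have hDK : D = ∑ K ∈ F, (#K : ℝ) := by
    simp only [hD, hd']
    rw [sum_comm]
    simp
  have hL : 3 * l * #F ≤ 4 * D := by
    rw [hDK, mul_sum]
    calc 3 * l * #F = ∑ _K ∈ F, 3 * l := by simp [mul_comm]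
      _ ≤ _ := sum_le_sum hsize
  have hsq : ∑ v, d v ^ 2 ≤ D + (#F : ℝ) ^ 2 := by
    have h1 : ∑ v, d v ^ 2 = ∑ K ∈ F, ∑ L ∈ F, (#(K ∩ L) : ℝ) := by
      calc ∑ v, d v ^ 2
          = ∑ v, ∑ K ∈ F, ∑ L ∈ F, (if v ∈ K ∩ L then (1 : ℝ) else 0) := by
            refine sum_congr rfl fun v _ ↦ ?_
            rw [sq, hd', sum_mul_sum]
            refine sum_congr rfl fun K _ ↦ sum_congr rfl fun L _ ↦ ?_
            by_cases h : v ∈ K <;> by_cases h' : v ∈ L <;> simp [h, h']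
        _ = _ := by
            rw [sum_comm]
            refine sum_congr rfl fun K _ ↦ ?_
            rw [sum_comm]
            refine sum_congr rfl fun L _ ↦ ?_
            rw [sum_ite_mem]
            simp
    have h2 : ∀ K ∈ F, ∑ L ∈ F, (#(K ∩ L) : ℝ) ≤ #K + #F := by
      intro K hK
      calc ∑ L ∈ F, (#(K ∩ L) : ℝ) ≤ ∑ L ∈ F, ((if K = L then (#K : ℝ) else 0) + 1) := by
            refine sum_le_sum fun L hL ↦ ?_
            by_cases h : K = L
            · subst h; simp
            · simp only [h, if_false, zero_add]
              exact_mod_cast hinter K hK L hL h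
        _ = _ := by rw [sum_add_distrib]; simp [hK]
    calc ∑ v, d v ^ 2 = _ := h1
      _ ≤ ∑ K ∈ F, ((#K : ℝ) + #F) := sum_le_sum h2
      _ = _ := by rw [sum_add_distrib, hDK]; simp [sq]
  have hCS : D ^ 2 ≤ n * ∑ v, d v ^ 2 := by
    have := sq_sum_le_card_mul_sum_sq (s := (univ : Finset V)) (f := d)
    simpa [hD, hn] using this
  by_contra hcon
  push Not at hcon
  have hD0 : 0 < D := by linarith
  have h3 : (3 * l * #F) ^ 2 ≤ (4 * D) ^ 2 := pow_le_pow_left₀ (by positivity) hL 2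
  have h4 : D ^ 2 ≤ n * (D + (#F : ℝ) ^ 2) := hCS.trans (by gcongr)
  have h5 : 32 * n * (#F : ℝ) ^ 2 ≤ 16 * D ^ 2 := by
    nlinarith [sq_nonneg (#F : ℝ)]
  nlinarith

lemma exists_induced_path_of_not_isDisjointUnionOfCliques {V : Type*} (G : SimpleGraph V)
    (h : ¬ ∀ u v : V, G.Reachable u v → u ≠ v → G.Adj u v) :
    ∃ u v w, G.Adj u v ∧ G.Adj v w ∧ u ≠ w ∧ ¬ G.Adj u w := by
  by_contra! hcon
  have key : ∀ {u v : V}, G.Walk u v → u ≠ v → G.Adj u v := by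
    intro u v p
    induction p with
    | nil => exact fun h ↦ (h rfl).elim
    | @cons a b c hab _ ih =>
      intro hac
      by_cases hbc : b = c
      · exact hbc ▸ hab
      · exact hcon a b c hab (ih hbc) hac
  exact h fun u v ⟨p⟩ ↦ key p

lemma srg_card_of_adj {V : Type*} [Fintype V] [DecidableEq V] {G : SimpleGraph V}
    [DecidableRel G.Adj] {n k l m : ℕ} (h : G.IsSRGWith n k l m) {v w : V} (hvw : G.Adj v w) :
    #(G.neighborFinset v ∩ G.neighborFinset w) = l := by
  rw [← h.of_adj v w hvw, ← Set.toFinset_card]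
  congr 1
  ext x
  simp [SimpleGraph.mem_commonNeighbors]

lemma srg_card_of_not_adj {V : Type*} [Fintype V] [DecidableEq V] {G : SimpleGraph V}
    [DecidableRel G.Adj] {n k l m : ℕ} (h : G.IsSRGWith n k l m) {v w : V} (hne : v ≠ w)
    (hvw : ¬ G.Adj v w) :
    #(G.neighborFinset v ∩ G.neighborFinset w) = m := by
  rw [← h.of_not_adj hne hvw, ← Set.toFinset_card]
  congr 1
  ext x
  simp [SimpleGraph.mem_commonNeighbors]

/-- Parameter inequalities of a nontrivial strongly regular graph. -/
lemma srg_nontrivial_params {V : Type*} [Fintype V] [DecidableEq V] {G : SimpleGraph V}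
    [DecidableRel G.Adj] {n k l m : ℕ} (h : G.IsSRGWith n k l m)
    (h1 : ∃ u v w, G.Adj u v ∧ G.Adj v w ∧ u ≠ w ∧ ¬ G.Adj u w)
    (h2 : ∃ u v w, Gᶜ.Adj u v ∧ Gᶜ.Adj v w ∧ u ≠ w ∧ ¬ Gᶜ.Adj u w) :
    1 ≤ m ∧ m + 1 ≤ k ∧ l + 2 ≤ k := by
  obtain ⟨u, v, w, huv, hvw, huw, hnuw⟩ := h1
  obtain ⟨a, b, c, hab, hbc, hac, hnac⟩ := h2
  rw [SimpleGraph.compl_adj] at hab hbc hnac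
  have hac' : G.Adj a c := by tauto
  refine ⟨?_, ?_, ?_⟩
  · rw [← srg_card_of_not_adj h huw hnuw]
    exact card_pos.2 ⟨v, by simp [huv, hvw.symm]⟩
  · rw [← srg_card_of_not_adj h hab.1 hab.2, ← h.regular a, ← G.card_neighborFinset_eq_degree]
    refine card_lt_card (Finset.ssubset_iff_subset_ne.2 ⟨inter_subset_left, fun he ↦ ?_⟩)
    have : c ∈ G.neighborFinset a ∩ G.neighborFinset b := by rw [he]; simpa using hac'
    simp only [mem_inter, SimpleGraph.mem_neighborFinset] at this
    exact hbc.2 this.2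
  · rw [← srg_card_of_adj h huv.symm, ← h.regular v, ← G.card_neighborFinset_eq_degree]
    have hs : G.neighborFinset v ∩ G.neighborFinset u ⊆ ((G.neighborFinset v).erase u).erase w := by
      intro x hx
      simp only [mem_inter, SimpleGraph.mem_neighborFinset, mem_erase] at hx ⊢
      refine ⟨?_, ?_, hx.1⟩
      · rintro rfl; exact hnuw hx.2
      · rintro rfl; exact hx.2.ne rfl
    have hc := card_le_card hs
    rw [card_erase_of_mem (by simp [huw.symm, hvw]), card_erase_of_mem (by simp [huv.symm])] at hc
    have : 1 < #(G.neighborFinset v) :=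
      one_lt_card.2 ⟨u, by simp [huv.symm], w, by simp [hvw], huw⟩
    omega

/-- A coclique `T` in the neighbourhood of `v` covers many neighbours of `v`. -/
lemma srg_card_mul_le_of_coclique {V : Type*} [Fintype V] [DecidableEq V] {G : SimpleGraph V}
    [DecidableRel G.Adj] {n k l m : ℕ} (h : G.IsSRGWith n k l m) (v : V) (T : Finset V)
    (hT : ∀ x ∈ T, G.Adj v x) (hind : ∀ x ∈ T, ∀ y ∈ T, ¬ G.Adj x y) :
    #T * l ≤ k + #T * #T * m := by
  have key : #T * l ≤
      #(T.biUnion fun x ↦ G.neighborFinset v ∩ G.neighborFinset x) + #T * #T * m := by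
    induction T using Finset.induction_on with
    | empty => simp
    | @insert a T ha ih =>
      have ih := ih (fun x hx ↦ hT x (mem_insert_of_mem hx))
        (fun x hx y hy ↦ hind x (mem_insert_of_mem hx) y (mem_insert_of_mem hy))
      rw [biUnion_insert, card_insert_of_notMem ha]
      set U := T.biUnion fun x ↦ G.neighborFinset v ∩ G.neighborFinset x with hU
      set S := G.neighborFinset v ∩ G.neighborFinset a with hS
      have hSc : #S = l := srg_card_of_adj h (hT a (mem_insert_self a T))
      have hSU : #(S ∩ U) ≤ #T * m := by
        have hsub : S ∩ U ⊆ T.biUnion fun x ↦ G.neighborFinset a ∩ G.neighborFinset x := by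
          intro y hy
          simp only [hS, hU, mem_inter, mem_biUnion] at hy ⊢
          obtain ⟨⟨_, hya⟩, x, hx, _, hyx⟩ := hy
          exact ⟨x, hx, hya, hyx⟩
        refine (card_le_card hsub).trans (card_biUnion_le_card_mul _ _ _ fun x hx ↦ ?_)
        refine (srg_card_of_not_adj h ?_
          (hind a (mem_insert_self a T) x (mem_insert_of_mem hx))).le
        rintro rfl
        exact ha hx
      have := card_union_add_card_inter S U
      nlinarith
  refine key.trans (Nat.add_le_add_right ?_ _)
  rw [← h.regular v, ← G.card_neighborFinset_eq_degree]
  exact card_le_card (biUnion_subset.2 fun x _ ↦ inter_subset_left)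

/-- If `24 k μ ≤ λ²`, cocliques in a neighbourhood have at most `λ / (8 μ)` points. -/
lemma srg_coclique_card_le {V : Type*} [Fintype V] [DecidableEq V] {G : SimpleGraph V}
    [DecidableRel G.Adj] {n k l m : ℕ} (h : G.IsSRGWith n k l m) (hl : 0 < l) (hlk : l ≤ k)
    (hm : 24 * k * m ≤ l * l) (v : V) (T : Finset V)
    (hT : ∀ x ∈ T, G.Adj v x) (hind : ∀ x ∈ T, ∀ y ∈ T, ¬ G.Adj x y) :
    8 * (#T * m) ≤ l := by
  by_contra! hcon
  set t := 2 * k / l + 1 with ht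
  have h1 : 2 * k < t * l := by
    rw [ht, mul_comm _ l]; exact Nat.lt_mul_div_succ _ hl
  have h2 : t * l ≤ 3 * k := by
    have : 2 * k / l * l ≤ 2 * k := Nat.div_mul_le_self _ _
    rw [ht]; nlinarith
  have hmt : 8 * (t * m) ≤ l := by
    have : 8 * (t * m) * l ≤ l * l := by nlinarith
    exact Nat.le_of_mul_le_mul_right this hl
  have htT : t ≤ #T := by
    by_contra! hlt
    have : #T * m ≤ t * m := Nat.mul_le_mul_right _ hlt.le
    omega
  obtain ⟨S, hST, hS⟩ := exists_subset_card_eq htT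
  have := srg_card_mul_le_of_coclique h v S (fun x hx ↦ hT x (hST hx))
    (fun x hx y hy ↦ hind x (hST hx) y (hST hy))
  rw [hS] at this
  nlinarith

/-- If `24 k μ ≤ λ²`, every vertex is on at least `k / (λ + 1)` large cliques, no two of which lie
in a common clique. -/
lemma srg_exists_cliques {V : Type*} [Fintype V] [DecidableEq V] {G : SimpleGraph V}
    [DecidableRel G.Adj] {n k l m : ℕ} (h : G.IsSRGWith n k l m) (hl : 0 < l) (hlk : l ≤ k)
    (hm : 24 * k * m ≤ l * l) (v : V) :
    ∃ (T : Finset V) (K : V → Finset V), k ≤ #T * (l + 1) ∧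
      (∀ x ∈ T, ∀ y ∈ T, ¬ G.Adj x y) ∧
      ∀ x ∈ T, v ∈ K x ∧ x ∈ K x ∧ G.IsClique (K x : Set V) ∧ 3 * l ≤ 4 * #(K x) := by
  classical
  let P : Finset (Finset V) := {T | (∀ x ∈ T, G.Adj v x) ∧ ∀ x ∈ T, ∀ y ∈ T, ¬ G.Adj x y}
  obtain ⟨T, hTP, hmax⟩ := P.exists_max_image card ⟨∅, by simp [P]⟩
  have hTP' := hTP
  simp only [P, mem_filter, mem_univ, true_and] at hTP'
  obtain ⟨hTv, hTi⟩ := hTP'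
  have hmax' : ∀ S : Finset V, (∀ x ∈ S, G.Adj v x) → (∀ x ∈ S, ∀ y ∈ S, ¬ G.Adj x y) →
      #S ≤ #T := fun S h1 h2 ↦ hmax S (by simp only [P, mem_filter, mem_univ, true_and]; exact ⟨h1, h2⟩)
  have hTm := srg_coclique_card_le h hl hlk hm v T hTv hTi
  let C : V → Finset V := fun x ↦ (G.neighborFinset v ∩ G.neighborFinset x) \
    (T.erase x).biUnion fun y ↦ G.neighborFinset x ∩ G.neighborFinset y
  have hC : ∀ x y, y ∈ C x → G.Adj v y ∧ G.Adj x y ∧ ∀ z ∈ T, z ≠ x → ¬ G.Adj z y := by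
    intro x y hy
    simp only [C, mem_sdiff, mem_inter, SimpleGraph.mem_neighborFinset, mem_biUnion, mem_erase,
      not_exists, not_and] at hy
    exact ⟨hy.1.1, hy.1.2, fun z hz hzx ↦ hy.2 z ⟨hzx, hz⟩ hy.1.2⟩
  refine ⟨T, fun x ↦ insert v (insert x (C x)), ?_, hTi, fun x hx ↦ ⟨by simp, by simp, ?_, ?_⟩⟩
  · rw [← h.regular v, ← G.card_neighborFinset_eq_degree]
    have hsub : G.neighborFinset v ⊆
        T.biUnion fun x ↦ insert x (G.neighborFinset v ∩ G.neighborFinset x) := by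
      intro y hy
      rw [SimpleGraph.mem_neighborFinset] at hy
      by_contra hcon
      simp only [mem_biUnion, mem_insert, mem_inter, SimpleGraph.mem_neighborFinset, not_exists,
        not_and, not_or] at hcon
      have hyT : y ∉ T := fun hyT ↦ (hcon y hyT).1 rfl
      have hny : ∀ x ∈ T, ¬ G.Adj x y := fun x hx ↦ (hcon x hx).2 hy
      have := hmax' (insert y T)
        (by simpa [hy] using hTv)
        (by
          intro a ha b hb
          rw [mem_insert] at ha hb
          rcases ha with rfl | ha <;> rcases hb with rfl | hb
          · exact G.irrefl
          · exact fun hab ↦ hny b hb hab.symm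
          · exact hny a ha
          · exact hTi a ha b hb)
      rw [card_insert_of_notMem hyT] at this
      omega
    refine (card_le_card hsub).trans (card_biUnion_le_card_mul _ _ _ fun x hx ↦ ?_)
    refine (card_insert_le _ _).trans ?_
    rw [srg_card_of_adj h (hTv x hx)]
  · have hCC : ∀ y ∈ C x, ∀ z ∈ C x, y ≠ z → G.Adj y z := by
      intro y hy z hz hyz
      by_contra hnyz
      obtain ⟨hvy, hxy, hy'⟩ := hC x y hy
      obtain ⟨hvz, hxz, hz'⟩ := hC x z hz
      have hzT : z ∉ T.erase x := fun hz ↦ hTi x hx z (mem_of_mem_erase hz) hxz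
      have hyT : y ∉ insert z (T.erase x) := by
        rw [mem_insert, not_or]
        exact ⟨hyz, fun hy ↦ hTi x hx y (mem_of_mem_erase hy) hxy⟩
      have := hmax' (insert y (insert z (T.erase x)))
        (by
          intro a ha
          simp only [mem_insert, mem_erase] at ha
          rcases ha with rfl | rfl | ⟨_, ha⟩
          · exact hvy
          · exact hvz
          · exact hTv a ha)
        (by
          intro a ha b hb
          simp only [mem_insert, mem_erase] at ha hb
          rcases ha with rfl | rfl | ⟨hax, ha⟩ <;> rcases hb with rfl | rfl | ⟨hbx, hb⟩
          · exact G.irrefl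
          · exact hnyz
          · exact fun hab ↦ hy' b hb hbx hab.symm
          · exact fun hab ↦ hnyz hab.symm
          · exact G.irrefl
          · exact fun hab ↦ hz' b hb hbx hab.symm
          · exact hy' a ha hax
          · exact hz' a ha hax
          · exact hTi a ha b hb)
      rw [card_insert_of_notMem hyT, card_insert_of_notMem hzT, card_erase_of_mem hx] at this
      omega
    intro a ha b hb hab
    simp only [coe_insert, Set.mem_insert_iff, mem_coe] at ha hb
    rcases ha with rfl | rfl | ha <;> rcases hb with rfl | rfl | hb
    · exact (hab rfl).elim
    · exact hTv _ hx
    · exact (hC x b hb).1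
    · exact (hTv _ hx).symm
    · exact (hab rfl).elim
    · exact (hC _ b hb).2.1
    · exact (hC x a ha).1.symm
    · exact (hC _ a ha).2.1.symm
    · exact hCC a ha b hb hab
  · have h1 : #((T.erase x).biUnion fun y ↦ G.neighborFinset x ∩ G.neighborFinset y) ≤ #T * m := by
      refine (card_biUnion_le_card_mul _ _ m fun y hy ↦ ?_).trans
        (Nat.mul_le_mul_right _ (card_le_card (erase_subset _ _)))
      rw [mem_erase] at hy
      exact (srg_card_of_not_adj h hy.1.symm (hTi x hx y hy.2)).le
    have h2 := le_card_sdiff ((T.erase x).biUnion fun y ↦ G.neighborFinset x ∩ G.neighborFinset y)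
      (G.neighborFinset v ∩ G.neighborFinset x)
    rw [srg_card_of_adj h (hTv x hx)] at h2
    have h3 : #(C x) ≤ #(insert v (insert x (C x))) :=
      card_le_card ((subset_insert _ _).trans (subset_insert _ _))
    change _ ≤ #(C x) at h2
    change 3 * l ≤ 4 * #(insert v (insert x (C x)))
    omega

/-- Clique geometry: if `24 k μ ≤ λ²` and `2 (λ + 1) < k` then `λ² = O(n)`. -/
lemma srg_lambda_sq_le {V : Type*} [Fintype V] [DecidableEq V] {G : SimpleGraph V}
    [DecidableRel G.Adj] {n k l m : ℕ} (h : G.IsSRGWith n k l m) (hm1 : 1 ≤ m)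
    (hl : 0 < l) (hlk : 2 * (l + 1) < k) (hm : 24 * k * m ≤ l * l) (hn : 0 < n) :
    9 * (l : ℝ) ^ 2 ≤ 32 * (n : ℝ) := by
  classical
  have hlm : 48 * m ≤ l := by
    have : 48 * m * l ≤ l * l := by nlinarith
    exact Nat.le_of_mul_le_mul_right this hl
  let F : Finset (Finset V) :=
    {K | Maximal (fun S : Finset V ↦ G.IsClique (S : Set V)) K ∧ 3 * l ≤ 4 * #K}
  have hF : ∀ K, K ∈ F ↔
      Maximal (fun S : Finset V ↦ G.IsClique (S : Set V)) K ∧ 3 * l ≤ 4 * #K := by simp [F]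
  rw [← h.card] at hn ⊢
  refine sq_le_card_of_linear_family F l (by exact_mod_cast hl) ?_ ?_ ?_ hn
  · intro K hK
    exact_mod_cast ((hF K).1 hK).2
  · intro K hK L hL hKL
    obtain ⟨hK, hKc⟩ := (hF K).1 hK
    obtain ⟨hL, hLc⟩ := (hF L).1 hL
    by_contra! hlt
    obtain ⟨u, hu, v, hv, huv⟩ := one_lt_card.1 hlt
    rw [mem_inter] at hu hv
    have hadj : G.Adj u v := hK.1 hu.1 hv.1 huv
    have hsub : K ∪ L ⊆ insert u (insert v (G.neighborFinset u ∩ G.neighborFinset v)) := by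
      intro x hx
      simp only [mem_insert, mem_inter, SimpleGraph.mem_neighborFinset]
      by_cases hxu : x = u
      · exact Or.inl hxu
      by_cases hxv : x = v
      · exact Or.inr (Or.inl hxv)
      refine Or.inr (Or.inr ?_)
      rcases mem_union.1 hx with hx | hx
      · exact ⟨hK.1 hu.1 hx (Ne.symm hxu), hK.1 hv.1 hx (Ne.symm hxv)⟩
      · exact ⟨hL.1 hu.2 hx (Ne.symm hxu), hL.1 hv.2 hx (Ne.symm hxv)⟩
    have hUc : #(K ∪ L) ≤ l + 2 := by
      refine (card_le_card hsub).trans ((card_insert_le _ _).trans ?_)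
      have := card_insert_le v (G.neighborFinset u ∩ G.neighborFinset v)
      rw [srg_card_of_adj h hadj] at this
      omega
    have hUI := card_union_add_card_inter K L
    have hunion : G.IsClique ((K ∪ L : Finset V) : Set V) := by
      have hcross : ∀ a ∈ K, ∀ b ∈ L, a ≠ b → G.Adj a b := by
        intro a ha b hb hab
        by_contra hnab
        have hs : K ∩ L ⊆ G.neighborFinset a ∩ G.neighborFinset b := by
          intro x hx
          rw [mem_inter] at hx
          simp only [mem_inter, SimpleGraph.mem_neighborFinset]
          have hxa : a ≠ x := by
            rintro rfl
            exact hnab (hL.1 hx.2 hb hab)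
          have hxb : b ≠ x := by
            rintro rfl
            exact hnab (hK.1 ha hx.1 hab)
          exact ⟨hK.1 ha hx.1 hxa, hL.1 hb hx.2 hxb⟩
        have := card_le_card hs
        rw [srg_card_of_not_adj h hab hnab] at this
        omega
      intro a ha b hb hab
      rcases mem_union.1 (mem_coe.1 ha) with ha | ha <;>
        rcases mem_union.1 (mem_coe.1 hb) with hb | hb
      · exact hK.1 ha hb hab
      · exact hcross a ha b hb hab
      · exact (hcross b hb a ha hab.symm).symm
      · exact hL.1 ha hb hab
    exact hKL ((hK.eq_of_le hunion subset_union_left).trans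
      (hL.eq_of_le hunion subset_union_right).symm)
  · intro v
    obtain ⟨T, K, hTc, hTi, hK⟩ := srg_exists_cliques h hl (by omega) hm v
    have hT3 : 3 ≤ #T := by
      by_contra! hlt
      have : #T * (l + 1) ≤ 2 * (l + 1) := Nat.mul_le_mul_right _ (by omega)
      omega
    have hext : ∀ x : V, ∃ L : Finset V, x ∈ T → K x ⊆ L ∧
        Maximal (fun S : Finset V ↦ G.IsClique (S : Set V)) L := by
      intro x
      by_cases hx : x ∈ T
      · obtain ⟨L, hL⟩ := Finite.exists_le_maximal
          (p := fun S : Finset V ↦ G.IsClique (S : Set V)) (hK x hx).2.2.1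
        exact ⟨L, fun _ ↦ hL⟩
      · exact ⟨∅, fun hx' ↦ (hx hx').elim⟩
    choose L hL using hext
    refine hT3.trans (card_le_card_of_injOn L ?_ ?_)
    · intro x hx
      have hx := mem_coe.1 hx
      obtain ⟨hsub, hmaxi⟩ := hL x hx
      simp only [coe_filter, Set.mem_ofPred_eq]
      refine ⟨(hF _).2 ⟨hmaxi, ?_⟩, hsub (hK x hx).1⟩
      have := card_le_card hsub
      have := (hK x hx).2.2.2
      omega
    · intro x hx y hy hxy
      have hx := mem_coe.1 hx
      have hy := mem_coe.1 hy
      by_contra hne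
      have hxy : L x = L y := hxy
      have h1 : x ∈ L y := hxy ▸ (hL x hx).1 (hK x hx).2.1
      have h2 : y ∈ L y := (hL y hy).1 (hK y hy).2.1
      exact hTi x hx y hy ((hL y hy).2.1 h1 h2 hne)

section AdjacencyAlgebra

open Matrix

/-- If the diagonal entry of `E` differs from both off-diagonal values, the order of `E` is at most
`(rank E + 1) ^ 2`. -/
lemma card_le_rank_add_one_sq {V : Type*} [Fintype V] [DecidableEq V] (E : Matrix V V ℝ)
    (a b c : ℝ) (hab : a ≠ b) (hac : a ≠ c) (hdiag : ∀ i, E i i = a)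
    (hoff : ∀ i j, i ≠ j → E i j = b ∨ E i j = c) :
    Fintype.card V ≤ (E.rank + 1) ^ 2 := by
  classical
  let W := Submodule.span ℝ (Set.range E.row)
  let β : Module.Basis (Fin E.rank) ℝ W :=
    Module.finBasisOfFinrankEq ℝ W (Matrix.rank_eq_finrank_span_row E).symm
  have hmem : ∀ i, E.row i ∈ W := fun i ↦ Submodule.subset_span ⟨i, rfl⟩
  let P : V → Fin E.rank → ℝ := fun i x ↦ β.repr ⟨E.row i, hmem i⟩ x
  let Q : Fin E.rank → V → ℝ := fun x j ↦ (β x : V → ℝ) j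
  have hE : ∀ i j, E i j = ∑ x, P i x * Q x j := by
    intro i j
    have h1 := congrArg (fun w : W ↦ (w : V → ℝ) j) (β.sum_repr ⟨E.row i, hmem i⟩)
    simp only [Submodule.coe_sum, Submodule.coe_smul, Finset.sum_apply, Pi.smul_apply,
      smul_eq_mul] at h1
    exact h1.symm
  let P' : ℝ → V → Option (Fin E.rank) → ℝ := fun t i x ↦ x.elim (-t) (P i)
  let Q' : V → Option (Fin E.rank) → ℝ := fun j x ↦ x.elim 1 (fun x ↦ Q x j)
  have hE' : ∀ t i j, E i j - t = ∑ x, P' t i x * Q' j x := by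
    intro t i j
    rw [Fintype.sum_option, hE]
    simp [P', Q']
    ring
  let P2 : Matrix V (Option (Fin E.rank) × Option (Fin E.rank)) ℝ :=
    Matrix.of fun i x ↦ P' b i x.1 * P' c i x.2
  let Q2 : Matrix (Option (Fin E.rank) × Option (Fin E.rank)) V ℝ :=
    Matrix.of fun x j ↦ Q' j x.1 * Q' j x.2
  have hprod : P2 * Q2 = Matrix.diagonal fun _ ↦ (a - b) * (a - c) := by
    ext i j
    have h1 : (P2 * Q2) i j = (E i j - b) * (E i j - c) := by
      rw [hE' b, hE' c, Finset.sum_mul_sum, Matrix.mul_apply, Fintype.sum_prod_type]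
      refine Finset.sum_congr rfl fun x _ ↦ Finset.sum_congr rfl fun y _ ↦ ?_
      simp only [P2, Q2, Matrix.of_apply]
      ring
    rw [h1]
    by_cases hij : i = j
    · subst hij
      simp [hdiag]
    · rw [Matrix.diagonal_apply_ne _ hij]
      rcases hoff i j hij with h | h <;> simp [h]
  have hne : (a - b) * (a - c) ≠ 0 := mul_ne_zero (sub_ne_zero.2 hab) (sub_ne_zero.2 hac)
  have hr : (P2 * Q2).rank = Fintype.card V := by
    rw [hprod]
    refine Matrix.rank_of_det_ne_zero ?_
    rw [Matrix.det_diagonal]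
    exact Finset.prod_ne_zero_iff.2 fun _ _ ↦ hne
  calc Fintype.card V = (P2 * Q2).rank := hr.symm
    _ ≤ P2.rank := Matrix.rank_mul_le_left _ _
    _ ≤ Fintype.card (Option (Fin E.rank) × Option (Fin E.rank)) := Matrix.rank_le_card_width _
    _ = _ := by simp [sq]

lemma rank_eq_trace_of_isIdempotentElem {V : Type*} [Fintype V] [DecidableEq V]
    {E : Matrix V V ℝ} (hE : E * E = E) : (E.rank : ℝ) = E.trace := by
  have h : IsIdempotentElem (Matrix.toLin' E) := by
    rw [IsIdempotentElem, Module.End.mul_eq_comp, ← Matrix.toLin'_mul, hE]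
  rw [← Matrix.trace_toLin'_eq, (LinearMap.IsIdempotentElem.isProj_range _ h).trace]
  rfl

variable {V : Type*} [Fintype V] {G : SimpleGraph V} [DecidableRel G.Adj]
  {n k l m : ℕ}

lemma srg_adjMatrix_mul_self [DecidableEq V] (h : G.IsSRGWith n k l m) :
    G.adjMatrix ℝ * G.adjMatrix ℝ = ((k : ℝ) - m) • (1 : Matrix V V ℝ) +
      ((l : ℝ) - m) • G.adjMatrix ℝ + (m : ℝ) • Matrix.of fun _ _ ↦ (1 : ℝ) := by
  rw [← sq, h.matrix_eq, ← Nat.cast_smul_eq_nsmul ℝ, ← Nat.cast_smul_eq_nsmul ℝ,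
    ← Nat.cast_smul_eq_nsmul ℝ]
  ext i j
  simp only [Matrix.add_apply, Matrix.smul_apply, SimpleGraph.adjMatrix_apply, Matrix.one_apply,
    Matrix.of_apply, SimpleGraph.compl_adj, smul_eq_mul]
  by_cases hij : i = j
  · subst hij; simp
  · by_cases ha : G.Adj i j <;> simp [hij, ha]

lemma adjMatrix_mul_ones (h : G.IsSRGWith n k l m) :
    G.adjMatrix ℝ * (Matrix.of fun _ _ ↦ (1 : ℝ)) = (k : ℝ) • Matrix.of fun _ _ ↦ (1 : ℝ) := by
  ext i j
  simp [Matrix.mul_apply, ← SimpleGraph.neighborFinset_eq_filter, h.regular i]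

lemma ones_mul_adjMatrix (h : G.IsSRGWith n k l m) :
    (Matrix.of fun _ _ ↦ (1 : ℝ)) * G.adjMatrix ℝ = (k : ℝ) • Matrix.of fun _ _ ↦ (1 : ℝ) := by
  have := congrArg Matrix.transpose (adjMatrix_mul_ones h)
  rw [Matrix.transpose_mul, SimpleGraph.transpose_adjMatrix] at this
  exact this

lemma ones_mul_ones (h : G.IsSRGWith n k l m) :
    (Matrix.of fun _ _ ↦ (1 : ℝ) : Matrix V V ℝ) * (Matrix.of fun _ _ ↦ (1 : ℝ)) =
      (n : ℝ) • Matrix.of fun _ _ ↦ (1 : ℝ) := by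
  ext i j
  simp [Matrix.mul_apply, h.card]

lemma srg_param_eq_real [DecidableEq V] (h : G.IsSRGWith n k l m) (hn : 0 < n) :
    (k : ℝ) ^ 2 = k - m + (l - m) * k + m * n := by
  rw [← h.card] at hn
  obtain ⟨v⟩ := Fintype.card_pos_iff.1 hn
  have h1 := congrArg (fun M : Matrix V V ℝ ↦ (M * (Matrix.of fun _ _ ↦ (1 : ℝ)) : Matrix V V ℝ) v v)
    (srg_adjMatrix_mul_self h)
  simp only [Matrix.mul_assoc, Matrix.add_mul, Matrix.smul_mul, adjMatrix_mul_ones h,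
    Matrix.mul_smul, ones_mul_ones h, Matrix.one_mul] at h1
  simp at h1
  linarith

lemma srg_eigenvalue_eq [DecidableEq V] (h : G.IsSRGWith n k l m) {θ : ℝ} (hθ : IsAdjEigenvalue G θ)
    (hθk : θ ≠ k) : θ ^ 2 = k - m + (l - m) * θ := by
  obtain ⟨x, hx0, hx⟩ := hθ
  have hJ : (Matrix.of fun _ _ ↦ (1 : ℝ) : Matrix V V ℝ).mulVec x = 0 := by
    have h1 : (k : ℝ) • (Matrix.of fun _ _ ↦ (1 : ℝ) : Matrix V V ℝ).mulVec x =
        θ • (Matrix.of fun _ _ ↦ (1 : ℝ) : Matrix V V ℝ).mulVec x := by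
      rw [← Matrix.smul_mulVec, ← ones_mul_adjMatrix h, ← Matrix.mulVec_mulVec, hx,
        Matrix.mulVec_smul]
    rw [← sub_eq_zero, ← sub_smul] at h1
    exact (smul_eq_zero.1 h1).resolve_left (sub_ne_zero.2 hθk.symm)
  have h2 := congrArg (fun M : Matrix V V ℝ ↦ M.mulVec x) (srg_adjMatrix_mul_self h)
  simp only [← Matrix.mulVec_mulVec, hx, Matrix.mulVec_smul, Matrix.add_mulVec,
    Matrix.smul_mulVec, Matrix.one_mulVec, hJ, smul_zero, add_zero] at h2
  obtain ⟨v, hv⟩ := Function.ne_iff.1 hx0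
  have h3 := congrFun h2 v
  simp only [Pi.smul_apply, Pi.add_apply, smul_eq_mul] at h3
  refine mul_right_cancel₀ hv ?_
  simp only [Pi.zero_apply] at *
  linarith

/-- Absolute bound: the multiplicity of `r` is at least of order `√n`, and is known from the trace
of the spectral projection. -/
lemma srg_exists_multiplicity [DecidableEq V] (h : G.IsSRGWith n k l m) (hn : 0 < n) {r s : ℝ}
    (hadd : r + s = l - m) (hmul : r * s = m - k) (hsr : s < r) (hs : s < -1) :
    ∃ f : ℕ, n ≤ (f + 1) ^ 2 ∧ (f : ℝ) * (r - s) ≤ n * (-s) := by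
  have hn' : (0 : ℝ) < n := by exact_mod_cast hn
  set c : ℝ := (k - s) / n with hc
  have hcn : c * n = k - s := by rw [hc]; field_simp
  set J : Matrix V V ℝ := Matrix.of fun _ _ ↦ (1 : ℝ) with hJ
  set A := G.adjMatrix ℝ with hA
  set M : Matrix V V ℝ := A - s • (1 : Matrix V V ℝ) - c • J with hM
  have hpar := srg_param_eq_real h hn
  have hAJ : A * J = (k : ℝ) • J := adjMatrix_mul_ones h
  have hJA : J * A = (k : ℝ) • J := ones_mul_adjMatrix h
  have hJJ : J * J = (n : ℝ) • J := ones_mul_ones h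
  have hAA : A * A = ((k : ℝ) - m) • (1 : Matrix V V ℝ) + ((l : ℝ) - m) • A + (m : ℝ) • J :=
    srg_adjMatrix_mul_self h
  have hcr : (m : ℝ) = c * (k - r) := by
    have : (m : ℝ) * n = (c * n) * (k - r) := by rw [hcn]; nlinarith
    exact mul_right_cancel₀ hn'.ne' (by linarith)
  have hMM : M * M = (r - s) • M := by
    simp only [hM, Matrix.sub_mul, Matrix.mul_sub, Matrix.smul_mul, Matrix.mul_smul, hAA, hAJ,
      hJA, hJJ, Matrix.one_mul, Matrix.mul_one]
    have e1 : (k : ℝ) - m = -(r * s) := by linarith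
    rw [e1, ← hadd, hcr]
    have e2 : (n : ℝ) * c = k - s := by linarith
    ext i j
    simp only [Matrix.sub_apply, Matrix.add_apply, Matrix.smul_apply, smul_eq_mul]
    linear_combination (c * J i j) * e2
  have hrs : r - s ≠ 0 := (sub_pos.2 hsr).ne'
  set E : Matrix V V ℝ := (r - s)⁻¹ • M with hE
  have hEE : E * E = E := by
    rw [hE, Matrix.smul_mul, Matrix.mul_smul, hMM, smul_smul, smul_smul]
    congr 1
    field_simp
  refine ⟨E.rank, ?_, ?_⟩
  · rw [← h.card]
    refine card_le_rank_add_one_sq E ((r - s)⁻¹ * (-s - c)) ((r - s)⁻¹ * (1 - c))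
      ((r - s)⁻¹ * (-c)) ?_ ?_ ?_ ?_
    · intro he
      have := mul_left_cancel₀ (inv_ne_zero hrs) he
      linarith
    · intro he
      have := mul_left_cancel₀ (inv_ne_zero hrs) he
      linarith
    · intro i
      simp [hE, hM, hA, hJ]
    · intro i j hij
      by_cases ha : G.Adj i j
      · left; simp [hE, hM, hA, hJ, ha, hij]
      · right; simp [hE, hM, hA, hJ, ha, hij]
  · rw [rank_eq_trace_of_isIdempotentElem hEE]
    have htr : M.trace = n * (-s) - c * n := by
      simp [hM, hA, hJ, Matrix.trace, h.card]
      ring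
    rw [hE, Matrix.trace_smul, htr, smul_eq_mul, hcn]
    have : (r - s)⁻¹ * (n * (-s) - (k - s)) * (r - s) = n * (-s) - (k - s) := by field_simp
    rw [this]
    linarith

end AdjacencyAlgebra

/-- The three polynomial bounds on `r`, from the numerical constraints on the parameters. -/
lemma r_pow_bounds {n k l m r s f : ℝ} (hm1 : 1 ≤ m) (hmk : m + 1 ≤ k) (hlk : l + 2 ≤ k)
    (hl : 0 ≤ l) (hkn : k ≤ (n - 1) / 2) (hpar : k ^ 2 = k - m + (l - m) * k + m * n)
    (hadd : r + s = l - m) (hmul : r * s = m - k) (hr : 0 < r) (hs : s < -1)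
    (hfn : n ≤ (f + 1) ^ 2) (hf1 : 1 ≤ f) (hf : f * (r - s) ≤ n * (-s))
    (hclaw : r ≤ max (2 * (-s - 1) * (m + 1 + s) + s) (s * (s + 1) * (m + 1) / 2 - 1))
    (hgeom : 0 < l → 2 * (l + 1) < k → 24 * k * m ≤ l * l → 9 * l ^ 2 ≤ 32 * n) :
    r ^ 3 * n ≤ 16 * k ^ 4 ∧ r ^ 4 ≤ 4 * k ^ 2 * n ∧ r ^ 2 ≤ 400 * max (k ^ 3 / n) n := by
  have hn : 0 < n := by linarith
  have hk : 0 < k := by linarith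
  have hf0 : 0 < f := by linarith
  have hmn : m * n ≤ 4 * k ^ 2 := by
    have h1 : m * (n - 1 - k) ≤ k ^ 2 := by nlinarith
    have h2 : n ≤ 4 * (n - 1 - k) := by linarith
    nlinarith
  have hrs : r * (-s) ≤ k := by linarith
  have h1 : r ≤ 4 * s ^ 2 * m := by
    have hm0 : 0 ≤ m := by linarith
    have hs2 : 0 ≤ m * (s ^ 2 + s) := mul_nonneg hm0 (by nlinarith)
    have hs3 : 0 ≤ m * s ^ 2 := by positivity
    rcases le_max_iff.1 hclaw with h | h
    · have e1 : (-s - 1) * (m + 1 + s) ≤ (-s - 1) * (2 * m) :=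
        mul_le_mul_of_nonneg_left (by linarith) (by linarith)
      linarith
    · have e1 : s * (s + 1) * (m + 1) ≤ s * (s + 1) * (2 * m) :=
        mul_le_mul_of_nonneg_left (by linarith) (by nlinarith)
      have e2 : m * s ≤ 0 := mul_nonpos_of_nonneg_of_nonpos hm0 (by linarith)
      linarith
  have h3 : r ^ 3 ≤ 4 * k ^ 2 * m := by
    have e : r ^ 3 ≤ 4 * (r * (-s)) ^ 2 * m := by
      calc r ^ 3 = r ^ 2 * r := by ring
        _ ≤ r ^ 2 * (4 * s ^ 2 * m) := mul_le_mul_of_nonneg_left h1 (sq_nonneg r)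
        _ = _ := by ring
    have e2 : (r * (-s)) ^ 2 ≤ k ^ 2 :=
      pow_le_pow_left₀ (mul_nonneg hr.le (by linarith)) hrs 2
    have := mul_le_mul_of_nonneg_right e2 (by linarith : 0 ≤ m)
    linarith
  have h4 : r ^ 4 ≤ 4 * k ^ 2 * n := by
    have e1 : f * r ^ 2 ≤ k * n := by
      have e : f * r ≤ n * (-s) := by nlinarith
      have := mul_le_mul_of_nonneg_right e hr.le
      have := mul_le_mul_of_nonneg_left hrs hn.le
      linarith
    have e2 : (f * r ^ 2) ^ 2 ≤ (k * n) ^ 2 := pow_le_pow_left₀ (by positivity) e1 2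
    have e3 : n ≤ 4 * f ^ 2 := by nlinarith
    have e4 : n * r ^ 4 ≤ n * (4 * k ^ 2 * n) := by
      have := mul_le_mul_of_nonneg_right e3 (by positivity : 0 ≤ r ^ 4)
      linarith
    exact le_of_mul_le_mul_left e4 hn
  refine ⟨?_, h4, ?_⟩
  · have := mul_le_mul_of_nonneg_left hmn (by positivity : 0 ≤ 4 * k ^ 2)
    have := mul_le_mul_of_nonneg_right h3 hn.le
    linarith
  · by_contra! hcon
    have c1 : 400 * k ^ 3 < r ^ 2 * n := by
      have := (mul_le_mul_of_nonneg_left (le_max_left (k ^ 3 / n) n) (by norm_num)).trans_lt hcon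
      rw [← mul_div_assoc, div_lt_iff₀ hn] at this
      exact this
    have c2 : 400 * n < r ^ 2 :=
      (mul_le_mul_of_nonneg_left (le_max_right (k ^ 3 / n) n) (by norm_num)).trans_lt hcon
    have hsr : -s * 2 ≤ r := by
      have : r * (-s * 2) ≤ r * r := by linarith
      exact le_of_mul_le_mul_left this hr
    have hlr : r ≤ 2 * l := by linarith
    have hl0 : 0 < l := by linarith
    have hlsq : r ^ 2 ≤ 4 * l ^ 2 := by
      have := pow_le_pow_left₀ hr.le hlr 2
      linarith
    have hkm : 24 * k * m ≤ l * l := by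
      have e : 24 * k * m * n ≤ l * l * n := by
        have e1 := mul_le_mul_of_nonneg_left hmn hk.le
        have e2 := mul_le_mul_of_nonneg_right hlsq hn.le
        have e3 : 0 ≤ k ^ 3 := by positivity
        linarith
      exact le_of_mul_le_mul_right e hn
    by_cases hk2 : 2 * (l + 1) < k
    · have := hgeom hl0 hk2 hkm
      linarith
    · push Not at hk2
      have hml : 24 * m ≤ l := by
        have : m * l ≤ m * k := mul_le_mul_of_nonneg_left (by linarith) (by linarith)
        have : 24 * m * l ≤ l * l := by linarith
        exact le_of_mul_le_mul_right this hl0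
      have hkr : k ≤ 5 * r := by linarith
      have : r ^ 2 * r ^ 2 ≤ r ^ 2 * (100 * n) := by
        have : k ^ 2 ≤ (5 * r) ^ 2 := pow_le_pow_left₀ hk.le hkr 2
        have := mul_le_mul_of_nonneg_right this hn.le
        linarith
      have := le_of_mul_le_mul_left this (by positivity)
      linarith

/-- Translation of the polynomial bounds into a bound by `g`. -/
lemma div_le_mul_g {n k : ℕ} {r : ℝ} (hn : 0 < n)
    (h1 : r ^ 3 * n ≤ 16 * (k : ℝ) ^ 4) (h2 : r ^ 4 ≤ 4 * (k : ℝ) ^ 2 * n)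
    (h3 : r ^ 2 ≤ 400 * max ((k : ℝ) ^ 3 / n) n) : r / n ≤ 20 * g n k := by
  have hn' : (0 : ℝ) < n := by exact_mod_cast hn
  have hk : (0 : ℝ) ≤ k := k.cast_nonneg
  rw [g, mul_min_of_nonneg _ _ (by norm_num), mul_min_of_nonneg _ _ (by norm_num), le_min_iff,
    le_min_iff]
  refine ⟨?_, ?_, ?_⟩
  · refine le_of_pow_le_pow_left₀ three_ne_zero (by positivity) ?_
    rw [mul_pow, ← Real.rpow_mul_natCast (by positivity)]
    norm_num
    rw [div_pow, div_pow, ← mul_div_assoc, div_le_div_iff₀ (by positivity) (by positivity)]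
    have := mul_le_mul_of_nonneg_right h1 (by positivity : (0 : ℝ) ≤ (n : ℝ) ^ 3)
    nlinarith [(by positivity : 0 ≤ (k : ℝ) ^ 4 * (n : ℝ) ^ 3)]
  · refine le_of_pow_le_pow_left₀ four_ne_zero (by positivity) ?_
    rw [mul_pow, div_pow _ ((n : ℝ) ^ _), ← Real.rpow_mul_natCast hk, ← Real.rpow_mul_natCast hn'.le]
    norm_num
    rw [div_pow, ← mul_div_assoc, div_le_div_iff₀ (by positivity) (by positivity)]
    have := mul_le_mul_of_nonneg_right h2 (by positivity : (0 : ℝ) ≤ (n : ℝ) ^ 3)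
    nlinarith [(by positivity : 0 ≤ (k : ℝ) ^ 2 * (n : ℝ) ^ 4)]
  · rw [mul_max_of_nonneg _ _ (by norm_num), le_max_iff]
    rw [mul_max_of_nonneg _ _ (by norm_num), le_max_iff] at h3
    refine h3.imp (fun h ↦ ?_) (fun h ↦ ?_)
    · refine le_of_pow_le_pow_left₀ two_ne_zero (by positivity) ?_
      rw [mul_pow, ← Real.rpow_mul_natCast (by positivity)]
      norm_num
      rw [div_pow, div_pow, ← mul_div_assoc, div_le_div_iff₀ (by positivity) (by positivity)]
      rw [← mul_div_assoc, le_div_iff₀ hn'] at h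
      have := mul_le_mul_of_nonneg_right h (by positivity : (0 : ℝ) ≤ (n : ℝ) ^ 2)
      nlinarith
    · refine le_of_pow_le_pow_left₀ two_ne_zero (by positivity) ?_
      rw [mul_pow, ← Real.rpow_mul_natCast (by positivity)]
      norm_num
      rw [Real.rpow_neg_one, div_pow, div_le_iff₀ (by positivity)]
      have : 400 * (n : ℝ)⁻¹ * (n : ℝ) ^ 2 = 400 * n := by field_simp
      linarith

/-- **Summary theorem**: there is an absolute constant `C > 0` such that every nontrivial
strongly regular graph with `k ≤ (n-1)/2`, distinct eigenvalues `k > r > s`, and satisfying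
the claw bound has `r/n ≤ C·g(n,k)`. -/
theorem r_over_n_bound :
    ∃ C : ℝ, 0 < C ∧
      ∀ (V : Type*) [Fintype V] [DecidableEq V] (G : SimpleGraph V) [DecidableRel G.Adj]
        (n k lam mu : ℕ) (r s : ℝ),
        NontrivialSRG G n k lam mu →
        (k : ℝ) ≤ ((n : ℝ) - 1) / 2 →
        IsAdjEigenvalue G r → IsAdjEigenvalue G s →
        r < (k : ℝ) → s < r →
        (∀ θ : ℝ, IsAdjEigenvalue G θ → θ = (k : ℝ) ∨ θ = r ∨ θ = s) →
        r ≤ max (2 * (-s - 1) * ((mu : ℝ) + 1 + s) + s)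
          (s * (s + 1) * ((mu : ℝ) + 1) / 2 - 1) →
        r / (n : ℝ) ≤ C * g n k := by
  refine ⟨20, by norm_num, ?_⟩
  intro V _ _ G _ n k l m r s ⟨h, hG, hGc⟩ hkn hr hs hrk hsr _ hclaw
  obtain ⟨hm1, hmk, hlk⟩ := srg_nontrivial_params h
    (exists_induced_path_of_not_isDisjointUnionOfCliques G hG)
    (exists_induced_path_of_not_isDisjointUnionOfCliques Gᶜ hGc)
  have hm1' : (1 : ℝ) ≤ m := by exact_mod_cast hm1
  have hmk' : (m : ℝ) + 1 ≤ k := by exact_mod_cast hmk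
  have hlk' : (l : ℝ) + 2 ≤ k := by exact_mod_cast hlk
  have hl0 : (0 : ℝ) ≤ l := l.cast_nonneg
  have hn2 : (2 : ℝ) < n := by linarith
  have hn : 0 < n := by exact_mod_cast (by linarith : (0 : ℝ) < n)
  have er := srg_eigenvalue_eq h hr hrk.ne
  have es := srg_eigenvalue_eq h hs (hsr.trans hrk).ne
  have hadd : r + s = l - m :=
    mul_left_cancel₀ (sub_ne_zero.2 hsr.ne') (by linear_combination er - es)
  have hmul : r * s = m - k := by linear_combination r * hadd - er
  have hs1 : s < -1 := by
    by_contra! hcon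
    nlinarith [mul_nonneg (by linarith : 0 ≤ r + 1) (by linarith : 0 ≤ s + 1)]
  have hr0 : 0 < r := by
    by_contra! hcon
    nlinarith
  obtain ⟨f, hfn, hf⟩ := srg_exists_multiplicity h hn hadd hmul hsr hs1
  have hf1 : 1 ≤ f := by
    rcases Nat.eq_zero_or_pos f with rfl | hf
    · have : (n : ℝ) ≤ 1 := by exact_mod_cast hfn
      linarith
    · exact hf
  obtain ⟨b1, b2, b3⟩ := r_pow_bounds (f := f) hm1' hmk' hlk' hl0 hkn (srg_param_eq_real h hn)
    hadd hmul hr0 hs1 (by exact_mod_cast hfn) (by exact_mod_cast hf1) hf hclaw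
    (fun h0 h2 h3 ↦ srg_lambda_sq_le h hm1 (by exact_mod_cast h0) (by exact_mod_cast h2)
      (by exact_mod_cast h3) hn)
  exact div_le_mul_g hn b1 b2 b3
end
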